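/- arXiv:2103.01645 — 6 statements merged into one kernel-verified Lean document; each statement's English description precedes it below -/
import Mathlib

section
/- There exist an absolute constant c > 0 and a threshold N₀ such that for every N ≥ N₀, every subset A of the grid [N] × [N] (where [N] = {0,1,...,N-1}) with |A| ≥ N²/(log log N)^c contains an axis-parallel corner, i.e., three points of the form (a, b), (a + d, b), (a, b + d) with d ≠ 0. -/
open Finset

section Counting

variable {G : Type*} [AddCommGroup G] [Fintype G]

/-- `F` is close to `β • I` when tested against convolutions of bounded functions, up to an
absolute error `ζ` and a convolution error governed by `e`. -/
def ApproxBy (F I : G → ℝ) (β ζ : ℝ) (e : G → ℝ) : Prop :=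
  ∀ a b : G → ℝ, (∀ z, |a z| ≤ 1) → (∀ x, |b x| ≤ 1) →
    |∑ z, ∑ x, a z * b x * (F (z - x) - β * I (z - x))| ≤
      ζ + ∑ z, ∑ x, |a z| * |b x| * e (z - x)

lemma sum_sum_conv (f g : G → ℝ) : ∑ z, ∑ x, f x * g (z - x) = (∑ x, f x) * ∑ x, g x := by
  rw [sum_comm, sum_mul]
  refine sum_congr rfl fun x _ => ?_
  rw [← mul_sum]
  congr 1
  exact Fintype.sum_equiv (Equiv.subRight x) _ _ fun _ => rfl

lemma sum_conv_comm (f g : G → ℝ) (z : G) : ∑ x, f x * g (z - x) = ∑ x, g x * f (z - x) :=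
  Fintype.sum_equiv (Equiv.subLeft z) _ _ fun x => by simp [mul_comm]

lemma ApproxBy.family {F I e : G → ℝ} {β ζ : ℝ} (h : ApproxBy F I β ζ e) {κ : Type*} [Fintype κ]
    (a b : κ → G → ℝ) (ha : ∀ k z, |a k z| ≤ 1) (hb : ∀ k x, |b k x| ≤ 1) :
    |∑ k, ∑ z, ∑ x, a k z * b k x * F (z - x) - ∑ k, ∑ z, ∑ x, a k z * b k x * (β * I (z - x))| ≤
      Fintype.card κ * ζ + ∑ k, ∑ z, ∑ x, |a k z| * |b k x| * e (z - x) := by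
  rw [← sum_sub_distrib]
  refine (abs_sum_le_sum_abs _ _).trans ?_
  have : (Fintype.card κ : ℝ) * ζ = ∑ _k : κ, ζ := by simp
  rw [this, ← sum_add_distrib]
  refine sum_le_sum fun k _ => ?_
  refine le_trans (le_of_eq ?_) (h (a k) (b k) (ha k) (hb k))
  simp only [mul_sub, sum_sub_distrib]

lemma weighted_cauchy_schwarz {ι : Type*} [Fintype ι] (p a b : ι → ℝ) (hp : ∀ i, 0 ≤ p i)
    (ha : ∀ i, |a i| ≤ 1) : (∑ i, p i * a i * b i) ^ 2 ≤ (∑ i, p i) * ∑ i, p i * b i ^ 2 := by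
  refine sum_sq_le_sum_mul_sum_of_sq_le_mul _ (fun i _ => hp i)
    (fun i _ => mul_nonneg (hp i) (sq_nonneg _)) fun i _ => ?_
  have h1 : a i ^ 2 ≤ 1 := by
    have := ha i
    rw [← sq_abs]; nlinarith [abs_nonneg (a i)]
  calc (p i * a i * b i) ^ 2 = (p i * b i) ^ 2 * a i ^ 2 := by ring
    _ ≤ (p i * b i) ^ 2 * 1 := by gcongr
    _ = _ := by ring

lemma sum_mul_sq_expand {ι κ : Type*} [Fintype ι] [Fintype κ] (p : ι → ℝ) (g : ι → κ → ℝ) :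
    ∑ i, p i * (∑ y, g i y) ^ 2 = ∑ k : κ × κ, ∑ i, p i * (g i k.1 * g i k.2) := by
  rw [sum_comm]
  refine sum_congr rfl fun i _ => ?_
  rw [sq, sum_mul_sum, ← mul_sum, Fintype.sum_prod_type]

/-- Data for the relative counting of corners: `A ⊆ F₁ × F₂`, of relative density `τ`. -/
structure CornerSystem (G : Type*) [AddCommGroup G] [Fintype G] where
  A : G → G → ℝ
  F₁ : G → ℝ
  F₂ : G → ℝ
  I : G → ℝ
  L : ℝ
  τ : ℝ
  β₁ : ℝ
  β₂ : ℝ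
  hL : 0 < L
  hτ : 0 < τ
  hτ' : τ ≤ 1
  hβ₁ : 0 < β₁
  hβ₂ : 0 < β₂
  hβ₁' : β₁ ≤ 1
  hβ₂' : β₂ ≤ 1
  A_mem : ∀ x y, A x y = 0 ∨ A x y = 1
  I_mem : ∀ x, I x = 0 ∨ I x = 1
  F₁_mem : ∀ x, F₁ x = 0 ∨ F₁ x = 1
  F₂_mem : ∀ x, F₂ x = 0 ∨ F₂ x = 1
  A_le : ∀ x y, A x y ≤ F₁ x * F₂ y
  sum_I : ∑ x, I x = L
  card_le : (Fintype.card G : ℝ) ≤ 2 * L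
  sum_F₁ : ∑ x, F₁ x = β₁ * L
  sum_F₂ : ∑ x, F₂ x = β₂ * L
  sum_A : ∑ x, ∑ y, A x y = τ * (β₁ * L) * (β₂ * L)

namespace CornerSystem

variable (S : CornerSystem G)

/-- The balanced function of `A` relative to `F₁ × F₂`. -/
def bal (x y : G) : ℝ := S.A x y - S.τ * (S.F₁ x * S.F₂ y)

lemma F₁_nonneg (x : G) : 0 ≤ S.F₁ x := by rcases S.F₁_mem x with h | h <;> simp [h]
lemma F₂_nonneg (x : G) : 0 ≤ S.F₂ x := by rcases S.F₂_mem x with h | h <;> simp [h]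
lemma F₁_le (x : G) : S.F₁ x ≤ 1 := by rcases S.F₁_mem x with h | h <;> simp [h]
lemma F₂_le (x : G) : S.F₂ x ≤ 1 := by rcases S.F₂_mem x with h | h <;> simp [h]
lemma I_nonneg (x : G) : 0 ≤ S.I x := by rcases S.I_mem x with h | h <;> simp [h]
lemma I_le (x : G) : S.I x ≤ 1 := by rcases S.I_mem x with h | h <;> simp [h]
lemma A_nonneg (x y : G) : 0 ≤ S.A x y := by rcases S.A_mem x y with h | h <;> simp [h]
lemma A_le_one (x y : G) : S.A x y ≤ 1 := by rcases S.A_mem x y with h | h <;> simp [h]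

lemma F₁_mul_A (x y : G) : S.F₁ x * S.A x y = S.A x y := by
  rcases S.A_mem x y with h | h
  · simp [h]
  · have := S.A_le x y
    rcases S.F₁_mem x with h' | h'
    · rw [h, h'] at this; norm_num at this
    · simp [h']

lemma F₂_mul_A (x y : G) : S.F₂ y * S.A x y = S.A x y := by
  rcases S.A_mem x y with h | h
  · simp [h]
  · have := S.A_le x y
    rcases S.F₂_mem y with h' | h'
    · rw [h, h'] at this; norm_num at this
    · simp [h']

lemma F₁_mul_bal (x y : G) : S.F₁ x * S.bal x y = S.bal x y := by
  rcases S.F₁_mem x with h | h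
  · have : S.A x y = 0 := by rw [← F₁_mul_A, h, zero_mul]
    simp [bal, h, this]
  · simp [h]

lemma F₂_mul_bal (x y : G) : S.F₂ y * S.bal x y = S.bal x y := by
  rcases S.F₂_mem y with h | h
  · have : S.A x y = 0 := by rw [← F₂_mul_A, h, zero_mul]
    simp [bal, h, this]
  · simp [h]

lemma abs_bal_le (x y : G) : |S.bal x y| ≤ 1 := by
  have h1 := S.A_nonneg x y
  have h2 := S.A_le_one x y
  have h3 : 0 ≤ S.F₁ x * S.F₂ y := mul_nonneg (S.F₁_nonneg x) (S.F₂_nonneg y)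
  have h4 : S.F₁ x * S.F₂ y ≤ 1 := mul_le_one₀ (S.F₁_le x) (S.F₂_nonneg y) (S.F₂_le y)
  have h5 := S.hτ
  have h6 := S.hτ'
  rw [bal, abs_le]
  constructor <;> nlinarith

/-- The convolution of `F₁` and `F₂`. -/
def conv (z : G) : ℝ := ∑ x, S.F₁ x * S.F₂ (z - x)

lemma conv_nonneg (z : G) : 0 ≤ S.conv z :=
  sum_nonneg fun x _ => mul_nonneg (S.F₁_nonneg x) (S.F₂_nonneg _)

lemma conv_eq (z : G) : S.conv z = ∑ y, S.F₂ y * S.F₁ (z - y) := sum_conv_comm _ _ z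

open Classical in
/-- Indicator of the anti-diagonals meeting `F₁ × F₂` in at most twice the expected number
of points. -/
noncomputable def good (z : G) : ℝ := if S.conv z ≤ 2 * (S.β₁ * S.β₂ * S.L) then 1 else 0

lemma good_mem (z : G) : S.good z = 0 ∨ S.good z = 1 := by
  unfold good; split_ifs <;> simp

lemma good_nonneg (z : G) : 0 ≤ S.good z := by rcases S.good_mem z with h | h <;> simp [h]
lemma good_le (z : G) : S.good z ≤ 1 := by rcases S.good_mem z with h | h <;> simp [h]

lemma good_mul_conv_le (z : G) : S.good z * S.conv z ≤ 2 * (S.β₁ * S.β₂ * S.L) := by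
  have := S.hβ₁
  have := S.hβ₂
  have := S.hL
  unfold good
  split_ifs with h
  · simpa using h
  · rw [zero_mul]; positivity

lemma bad_mul_conv_le (z : G) : (1 - S.good z) * S.conv z ≤
    2 * ((1 - S.good z) * (S.conv z - S.β₁ * S.β₂ * ∑ x, S.I x * S.I (z - x))) := by
  unfold good
  split_ifs with h
  · simp
  · have h1 : ∑ x, S.I x * S.I (z - x) ≤ S.L := by
      rw [← S.sum_I]
      exact sum_le_sum fun x _ => mul_le_of_le_one_right (S.I_nonneg x) (S.I_le _)
    have h2 : 0 < S.β₁ * S.β₂ := mul_pos S.hβ₁ S.hβ₂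
    nlinarith

variable {e₁ e₂ : G → ℝ} {ε ζ : ℝ}

lemma sum_bad_conv_le (h₁ : ApproxBy S.F₁ S.I S.β₁ ζ e₁) (h₂ : ApproxBy S.F₂ S.I S.β₂ ζ e₂)
    (he₁ : ∀ x, 0 ≤ e₁ x) (he₂ : ∀ x, 0 ≤ e₂ x) (hs₁ : ∑ x, e₁ x ≤ ε * (S.β₁ * S.L))
    (hs₂ : ∑ x, e₂ x ≤ ε * (S.β₂ * S.L)) (hζ : 0 ≤ ζ) :
    ∑ z, (1 - S.good z) * S.conv z ≤ 4 * ζ + 4 * ε * (S.β₁ * S.L) * (S.β₂ * S.L) := by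
  have hg0 : ∀ z, 0 ≤ 1 - S.good z := fun z => by linarith [S.good_le z]
  have hg : ∀ z, |1 - S.good z| ≤ 1 := fun z => by
    rw [abs_of_nonneg (hg0 z)]; linarith [S.good_nonneg z]
  have hβ₁ := S.hβ₁
  have hβ₂ := S.hβ₂
  have hL := S.hL
  have hF : ∀ x, |S.F₁ x| ≤ 1 := fun x => by
    rw [abs_of_nonneg (S.F₁_nonneg x)]; exact S.F₁_le x
  have hI : ∀ x, |S.I x| ≤ 1 := fun x => by
    rw [abs_of_nonneg (S.I_nonneg x)]; exact S.I_le x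
  have k1 := (le_abs_self _).trans (h₂ (fun z => 1 - S.good z) S.F₁ hg hF)
  have k2 := (le_abs_self _).trans (h₁ (fun z => 1 - S.good z) S.I hg hI)
  have k1' : ∑ z, ∑ x, |1 - S.good z| * |S.F₁ x| * e₂ (z - x) ≤
      (S.β₁ * S.L) * (ε * (S.β₂ * S.L)) := by
    calc _ ≤ ∑ z, ∑ x, S.F₁ x * e₂ (z - x) := by
          refine sum_le_sum fun z _ => sum_le_sum fun x _ => ?_
          refine mul_le_mul_of_nonneg_right ?_ (he₂ _)
          rw [abs_of_nonneg (S.F₁_nonneg x)]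
          exact mul_le_of_le_one_left (S.F₁_nonneg x) (hg z)
      _ ≤ _ := by
          rw [sum_sum_conv, S.sum_F₁]
          gcongr
  have k2' : ∑ z, ∑ x, |1 - S.good z| * |S.I x| * e₁ (z - x) ≤ S.L * (ε * (S.β₁ * S.L)) := by
    calc _ ≤ ∑ z, ∑ x, S.I x * e₁ (z - x) := by
          refine sum_le_sum fun z _ => sum_le_sum fun x _ => ?_
          refine mul_le_mul_of_nonneg_right ?_ (he₁ _)
          rw [abs_of_nonneg (S.I_nonneg x)]
          exact mul_le_of_le_one_left (S.I_nonneg x) (hg z)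
      _ ≤ _ := by
          rw [sum_sum_conv, S.sum_I]
          gcongr
  have key : ∑ z, (1 - S.good z) * (S.conv z - S.β₁ * S.β₂ * ∑ x, S.I x * S.I (z - x)) =
      ∑ z, ∑ x, (1 - S.good z) * S.F₁ x * (S.F₂ (z - x) - S.β₂ * S.I (z - x)) +
      S.β₂ * ∑ z, ∑ x, (1 - S.good z) * S.I x * (S.F₁ (z - x) - S.β₁ * S.I (z - x)) := by
    rw [mul_sum, ← sum_add_distrib]
    refine sum_congr rfl fun z _ => ?_
    have e1 : ∑ x, (1 - S.good z) * S.F₁ x * (S.F₂ (z - x) - S.β₂ * S.I (z - x)) =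
        (1 - S.good z) * S.conv z - (1 - S.good z) * S.β₂ * ∑ x, S.F₁ x * S.I (z - x) := by
      rw [conv, mul_sum, mul_sum, ← sum_sub_distrib]
      exact sum_congr rfl fun x _ => by ring
    have e2 : ∑ x, (1 - S.good z) * S.I x * (S.F₁ (z - x) - S.β₁ * S.I (z - x)) =
        (1 - S.good z) * ∑ x, S.I x * S.F₁ (z - x) -
          (1 - S.good z) * S.β₁ * ∑ x, S.I x * S.I (z - x) := by
      rw [mul_sum, mul_sum, ← sum_sub_distrib]
      exact sum_congr rfl fun x _ => by ring
    rw [e1, e2, sum_conv_comm S.F₁ S.I z]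
    ring
  calc _ ≤ ∑ z, 2 * ((1 - S.good z) * (S.conv z - S.β₁ * S.β₂ * ∑ x, S.I x * S.I (z - x))) :=
        sum_le_sum fun z _ => S.bad_mul_conv_le z
    _ = 2 * (∑ z, ∑ x, (1 - S.good z) * S.F₁ x * (S.F₂ (z - x) - S.β₂ * S.I (z - x)) +
      S.β₂ * ∑ z, ∑ x, (1 - S.good z) * S.I x * (S.F₁ (z - x) - S.β₁ * S.I (z - x))) := by
        rw [← mul_sum, key]
    _ ≤ 2 * ((ζ + (S.β₁ * S.L) * (ε * (S.β₂ * S.L))) +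
          S.β₂ * (ζ + S.L * (ε * (S.β₁ * S.L)))) := by
        gcongr
        · linarith
        · linarith
    _ ≤ _ := by nlinarith [S.hβ₂']

end CornerSystem

end Counting

section DualSquare
variable {G : Type*} [AddCommGroup G] [Fintype G]
namespace CornerSystem

variable (S : CornerSystem G)

/-- The number of points of `A` on an anti-diagonal. -/
def diag (z : G) : ℝ := ∑ x, S.A x (z - x)

lemma diag_eq (z : G) : S.diag z = ∑ y, S.A (z - y) y :=
  Fintype.sum_equiv (Equiv.subLeft z) _ _ fun x => by simp

lemma diag_nonneg (z : G) : 0 ≤ S.diag z := sum_nonneg fun _ _ => S.A_nonneg _ _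

lemma diag_le_conv (z : G) : S.diag z ≤ S.conv z := sum_le_sum fun _ _ => S.A_le _ _

lemma sum_diag : ∑ z, S.diag z = S.τ * (S.β₁ * S.L) * (S.β₂ * S.L) := by
  rw [← S.sum_A]
  unfold diag
  rw [sum_comm]
  exact sum_congr rfl fun x _ => Fintype.sum_equiv (Equiv.subRight x) _ _ fun _ => rfl

/-- The corner form evaluated at the balanced function and twice at `A`. -/
noncomputable def cornerForm : ℝ :=
  ∑ z, ∑ x, S.good z * S.A x (z - x) * ∑ y, S.A (z - y) y * S.bal x y

lemma cornerForm_eq : S.cornerForm =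
    ∑ z, S.good z * ∑ x, ∑ y, S.A x (z - x) * S.A (z - y) y * S.A x y -
      S.τ * ∑ z, S.good z * S.diag z ^ 2 := by
  rw [cornerForm, mul_sum, ← sum_sub_distrib]
  refine sum_congr rfl fun z _ => ?_
  have : S.diag z ^ 2 = ∑ x, ∑ y, S.A x (z - x) * S.A (z - y) y := by
    rw [sq]; nth_rewrite 2 [diag_eq]; rw [diag, sum_mul_sum]
  rw [this, mul_left_comm, ← mul_sub, mul_sum, ← sum_sub_distrib, mul_sum]
  refine sum_congr rfl fun x _ => ?_
  rw [mul_assoc]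
  congr 1
  rw [mul_sum, mul_sum, ← sum_sub_distrib]
  refine sum_congr rfl fun y _ => ?_
  calc S.A x (z - x) * (S.A (z - y) y * S.bal x y)
      = S.A x (z - x) * S.A (z - y) y * S.A x y -
        S.τ * ((S.F₁ x * S.A x (z - x)) * (S.F₂ y * S.A (z - y) y)) := by rw [bal]; ring
    _ = _ := by rw [F₁_mul_A, F₂_mul_A]

lemma cornerForm_le
    (hcf : ∑ z, ∑ x, ∑ y, S.A x (z - x) * S.A (z - y) y * S.A x y ≤ ∑ x, ∑ y, S.A x y)
    (hbad : ∑ z, (1 - S.good z) * S.conv z ≤ S.τ * (S.β₁ * S.L) * (S.β₂ * S.L) / 2)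
    (hbig : 16 ≤ S.τ ^ 2 * S.β₁ * S.β₂ * S.L) :
    S.τ ^ 3 * S.β₁ ^ 2 * S.β₂ ^ 2 * S.L ^ 3 / 16 ≤ -S.cornerForm := by
  have hL := S.hL
  have hτ := S.hτ
  have hβ₁ := S.hβ₁
  have hβ₂ := S.hβ₂
  set N := S.τ * (S.β₁ * S.L) * (S.β₂ * S.L) with hN
  have hNpos : 0 < N := by positivity
  have h1 : ∑ z, S.good z * ∑ x, ∑ y, S.A x (z - x) * S.A (z - y) y * S.A x y ≤ N := by
    refine le_trans (sum_le_sum fun z _ => ?_) (hcf.trans_eq S.sum_A)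
    refine mul_le_of_le_one_left ?_ (S.good_le z)
    exact sum_nonneg fun _ _ => sum_nonneg fun _ _ =>
      mul_nonneg (mul_nonneg (S.A_nonneg _ _) (S.A_nonneg _ _)) (S.A_nonneg _ _)
  have h2 : N / 2 ≤ ∑ z, S.good z * S.diag z := by
    have e : ∑ z, S.good z * S.diag z = N - ∑ z, (1 - S.good z) * S.diag z := by
      rw [hN, ← sum_diag, ← sum_sub_distrib]
      exact sum_congr rfl fun _ _ => by ring
    have : ∑ z, (1 - S.good z) * S.diag z ≤ ∑ z, (1 - S.good z) * S.conv z :=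
      sum_le_sum fun z _ =>
        mul_le_mul_of_nonneg_left (S.diag_le_conv z) (by linarith [S.good_le z])
    linarith
  have h3 : (∑ z, S.good z * S.diag z) ^ 2 ≤ 2 * S.L * ∑ z, S.good z * S.diag z ^ 2 := by
    have := sq_sum_le_card_mul_sum_sq (s := (univ : Finset G)) (f := fun z => S.good z * S.diag z)
    refine this.trans ?_
    have e : ∀ z, (S.good z * S.diag z) ^ 2 = S.good z * S.diag z ^ 2 := fun z => by
      rcases S.good_mem z with h | h <;> simp [h]
    simp only [e]
    refine mul_le_mul_of_nonneg_right S.card_le ?_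
    exact sum_nonneg fun z _ => mul_nonneg (S.good_nonneg z) (sq_nonneg _)
  have h4 : N ^ 2 / (8 * S.L) ≤ ∑ z, S.good z * S.diag z ^ 2 := by
    rw [div_le_iff₀ (by positivity)]
    nlinarith
  have h5 : N ≤ S.τ * (N ^ 2 / (8 * S.L)) / 2 := by
    have : S.τ * (N ^ 2 / (8 * S.L)) / 2 = N * (S.τ ^ 2 * S.β₁ * S.β₂ * S.L / 16) := by
      rw [hN]; field_simp; ring
    rw [this]
    exact le_mul_of_one_le_right hNpos.le (by linarith)
  have h6 : S.τ ^ 3 * S.β₁ ^ 2 * S.β₂ ^ 2 * S.L ^ 3 / 16 = S.τ * (N ^ 2 / (8 * S.L)) / 2 := by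
    rw [hN]; field_simp; ring
  rw [cornerForm_eq, h6]
  have h7 := mul_le_mul_of_nonneg_left h4 hτ.le
  linarith

/-- The form obtained from `cornerForm` after one application of Cauchy-Schwarz. -/
noncomputable def form₁ : ℝ :=
  ∑ k : G × G, ∑ z, ∑ x, (S.good z * (S.A (z - k.1) k.1 * S.A (z - k.2) k.2)) *
    (S.F₁ x * (S.bal x k.1 * S.bal x k.2)) * S.F₂ (z - x)

/-- `form₁` with the last factor replaced by its model. -/
noncomputable def form₁' : ℝ :=
  ∑ k : G × G, ∑ z, ∑ x, (S.good z * (S.A (z - k.1) k.1 * S.A (z - k.2) k.2)) *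
    (S.F₁ x * (S.bal x k.1 * S.bal x k.2)) * (S.β₂ * S.I (z - x))

lemma cornerForm_sq_le : S.cornerForm ^ 2 ≤ (S.β₁ * S.L) * (S.β₂ * S.L) * S.form₁ := by
  have h := weighted_cauchy_schwarz (ι := G × G)
    (fun i => S.good i.1 * (S.F₁ i.2 * S.F₂ (i.1 - i.2))) (fun i => S.A i.2 (i.1 - i.2))
    (fun i => ∑ y, S.A (i.1 - y) y * S.bal i.2 y)
    (fun i => mul_nonneg (S.good_nonneg _) (mul_nonneg (S.F₁_nonneg _) (S.F₂_nonneg _)))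
    (fun i => by rw [abs_of_nonneg (S.A_nonneg _ _)]; exact S.A_le_one _ _)
  have e1 : S.cornerForm = ∑ i : G × G, S.good i.1 * (S.F₁ i.2 * S.F₂ (i.1 - i.2)) *
      S.A i.2 (i.1 - i.2) * ∑ y, S.A (i.1 - y) y * S.bal i.2 y := by
    rw [cornerForm, Fintype.sum_prod_type]
    refine sum_congr rfl fun z _ => sum_congr rfl fun x _ => ?_
    congr 1
    rw [mul_assoc, mul_assoc, F₂_mul_A, F₁_mul_A]
  have e2 : ∑ i : G × G, S.good i.1 * (S.F₁ i.2 * S.F₂ (i.1 - i.2)) ≤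
      (S.β₁ * S.L) * (S.β₂ * S.L) := by
    rw [← S.sum_F₁, ← S.sum_F₂, ← sum_sum_conv, Fintype.sum_prod_type]
    exact sum_le_sum fun z _ => sum_le_sum fun x _ =>
      mul_le_of_le_one_left (mul_nonneg (S.F₁_nonneg _) (S.F₂_nonneg _)) (S.good_le _)
  have e3 : ∑ i : G × G, S.good i.1 * (S.F₁ i.2 * S.F₂ (i.1 - i.2)) *
      (∑ y, S.A (i.1 - y) y * S.bal i.2 y) ^ 2 = S.form₁ := by
    rw [sum_mul_sq_expand, form₁]
    refine sum_congr rfl fun k _ => ?_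
    rw [Fintype.sum_prod_type]
    exact sum_congr rfl fun z _ => sum_congr rfl fun x _ => by ring
  rw [← e1, e3] at h
  refine h.trans (mul_le_mul_of_nonneg_right e2 ?_)
  rw [← e3]
  exact sum_nonneg fun i _ => mul_nonneg (mul_nonneg (S.good_nonneg _)
    (mul_nonneg (S.F₁_nonneg _) (S.F₂_nonneg _))) (sq_nonneg _)

variable {e₁ e₂ : G → ℝ} {ε ζ : ℝ}

lemma abs_bal_mul_le (x y x' y' : G) : |S.bal x y * S.bal x' y'| ≤ 1 := by
  rw [abs_mul]
  exact mul_le_one₀ (S.abs_bal_le _ _) (abs_nonneg _) (S.abs_bal_le _ _)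

lemma form₁_le (h₂ : ApproxBy S.F₂ S.I S.β₂ ζ e₂) (he₂ : ∀ x, 0 ≤ e₂ x)
    (hs₂ : ∑ x, e₂ x ≤ ε * (S.β₂ * S.L)) (hζ : 0 ≤ ζ) :
    S.form₁ ≤ S.form₁' + 4 * S.L ^ 2 * ζ + 4 * ε * (S.β₁ * S.β₂) ^ 3 * S.L ^ 4 := by
  have hL := S.hL
  have hβ₁ := S.hβ₁
  have hβ₂ := S.hβ₂
  have ha0 : ∀ (k : G × G) z, 0 ≤ S.good z * (S.A (z - k.1) k.1 * S.A (z - k.2) k.2) :=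
    fun k z => mul_nonneg (S.good_nonneg _) (mul_nonneg (S.A_nonneg _ _) (S.A_nonneg _ _))
  have ha : ∀ (k : G × G) z, |S.good z * (S.A (z - k.1) k.1 * S.A (z - k.2) k.2)| ≤ 1 := by
    intro k z
    rw [abs_of_nonneg (ha0 k z)]
    exact mul_le_one₀ (S.good_le _) (mul_nonneg (S.A_nonneg _ _) (S.A_nonneg _ _))
      (mul_le_one₀ (S.A_le_one _ _) (S.A_nonneg _ _) (S.A_le_one _ _))
  have hb' : ∀ (k : G × G) x, |S.F₁ x * (S.bal x k.1 * S.bal x k.2)| ≤ S.F₁ x := by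
    intro k x
    rw [abs_mul, abs_of_nonneg (S.F₁_nonneg x)]
    exact mul_le_of_le_one_right (S.F₁_nonneg x) (S.abs_bal_mul_le _ _ _ _)
  have h := h₂.family (κ := G × G) _ _ ha (fun k x => (hb' k x).trans (S.F₁_le x))
  have h' := (le_abs_self _).trans h
  have hcard : (Fintype.card (G × G) : ℝ) * ζ ≤ 4 * S.L ^ 2 * ζ := by
    rw [Fintype.card_prod, Nat.cast_mul]
    have := S.card_le
    have h0 : (0 : ℝ) ≤ Fintype.card G := Nat.cast_nonneg _
    refine mul_le_mul_of_nonneg_right ?_ hζ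
    nlinarith
  have herr : ∑ k : G × G, ∑ z, ∑ x, |S.good z * (S.A (z - k.1) k.1 * S.A (z - k.2) k.2)| *
      |S.F₁ x * (S.bal x k.1 * S.bal x k.2)| * e₂ (z - x) ≤
      4 * ε * (S.β₁ * S.β₂) ^ 3 * S.L ^ 4 := by
    calc _ ≤ ∑ k : G × G, ∑ z, ∑ x, (S.good z * (S.A (z - k.1) k.1 * S.A (z - k.2) k.2)) *
          (S.F₁ x * e₂ (z - x)) := by
          refine sum_le_sum fun k _ => sum_le_sum fun z _ => sum_le_sum fun x _ => ?_
          rw [abs_of_nonneg (ha0 k z), mul_assoc]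
          exact mul_le_mul_of_nonneg_left (mul_le_mul_of_nonneg_right (hb' k x) (he₂ _)) (ha0 k z)
      _ = ∑ z, (S.good z * S.diag z ^ 2) * ∑ x, S.F₁ x * e₂ (z - x) := by
          rw [sum_comm]
          refine sum_congr rfl fun z _ => ?_
          simp only [← mul_sum, ← sum_mul]
          congr 1
          rw [sq, diag_eq, sum_mul_sum, Fintype.sum_prod_type]
      _ ≤ ∑ z, (2 * (S.β₁ * S.β₂ * S.L)) ^ 2 * ∑ x, S.F₁ x * e₂ (z - x) := by
          refine sum_le_sum fun z _ => mul_le_mul_of_nonneg_right ?_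
            (sum_nonneg fun x _ => mul_nonneg (S.F₁_nonneg _) (he₂ _))
          have h1 := S.good_mul_conv_le z
          have h2 : S.good z * S.diag z ^ 2 = (S.good z * S.diag z) ^ 2 := by
            rcases S.good_mem z with h | h <;> simp [h]
          rw [h2]
          exact pow_le_pow_left₀ (mul_nonneg (S.good_nonneg _) (S.diag_nonneg _))
            ((mul_le_mul_of_nonneg_left (S.diag_le_conv z) (S.good_nonneg z)).trans h1) 2
      _ = (2 * (S.β₁ * S.β₂ * S.L)) ^ 2 * ((S.β₁ * S.L) * ∑ x, e₂ x) := by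
          rw [← mul_sum, sum_sum_conv, S.sum_F₁]
      _ ≤ (2 * (S.β₁ * S.β₂ * S.L)) ^ 2 * ((S.β₁ * S.L) * (ε * (S.β₂ * S.L))) := by gcongr
      _ = _ := by ring
  change S.form₁ - S.form₁' ≤ _ at h'
  linarith

end CornerSystem
end DualSquare

section BoxNorm
variable {G : Type*} [AddCommGroup G] [Fintype G]
namespace CornerSystem

variable (S : CornerSystem G)

/-- The weight used in the second application of Cauchy-Schwarz. -/
def pairWeight (x x' y y' : G) : ℝ :=
  S.F₁ x * S.F₁ x' * (S.F₂ y * S.F₂ y') *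
    (S.bal x y * S.bal x y' * (S.bal x' y * S.bal x' y'))

lemma abs_pairWeight_le (x x' y y' : G) :
    |S.pairWeight x x' y y'| ≤ S.F₁ x * S.F₁ x' * (S.F₂ y * S.F₂ y') := by
  have h0 : 0 ≤ S.F₁ x * S.F₁ x' * (S.F₂ y * S.F₂ y') :=
    mul_nonneg (mul_nonneg (S.F₁_nonneg _) (S.F₁_nonneg _))
      (mul_nonneg (S.F₂_nonneg _) (S.F₂_nonneg _))
  rw [pairWeight, abs_mul, abs_of_nonneg h0, abs_mul]
  exact mul_le_of_le_one_right h0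
    (mul_le_one₀ (S.abs_bal_mul_le _ _ _ _) (abs_nonneg _) (S.abs_bal_mul_le _ _ _ _))

lemma F_prod_le_one (x x' y y' : G) : S.F₁ x * S.F₁ x' * (S.F₂ y * S.F₂ y') ≤ 1 :=
  mul_le_one₀ (mul_le_one₀ (S.F₁_le _) (S.F₁_nonneg _) (S.F₁_le _))
    (mul_nonneg (S.F₂_nonneg _) (S.F₂_nonneg _))
    (mul_le_one₀ (S.F₂_le _) (S.F₂_nonneg _) (S.F₂_le _))

/-- The form obtained from `form₁'` after one application of Cauchy-Schwarz. Here `k` stands for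
`(x, x', y')`. -/
noncomputable def form₂ : ℝ :=
  ∑ k : G × G × G, ∑ z, ∑ y, (S.good z * (S.I (z - k.1) * S.I (z - k.2.1)) * S.F₁ (z - k.2.2)) *
    S.pairWeight k.1 k.2.1 y k.2.2 * S.F₁ (z - y)

/-- `form₂` with one factor replaced by its model. -/
noncomputable def form₂' : ℝ :=
  ∑ k : G × G × G, ∑ z, ∑ y, (S.good z * (S.I (z - k.1) * S.I (z - k.2.1)) * S.F₁ (z - k.2.2)) *
    S.pairWeight k.1 k.2.1 y k.2.2 * (S.β₁ * S.I (z - y))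

/-- `form₂` with two factors replaced by their models. -/
noncomputable def form₃ : ℝ :=
  ∑ k : G × G × G, ∑ z, ∑ y', (S.good z * (S.I (z - k.1) * S.I (z - k.2.1)) *
    (S.β₁ * S.I (z - k.2.2))) * S.pairWeight k.1 k.2.1 k.2.2 y' * (S.β₁ * S.I (z - y'))

lemma form₁'_sq_le : S.form₁' ^ 2 ≤ 8 * S.β₁ ^ 2 * S.β₂ ^ 4 * S.L ^ 3 * S.form₂ := by
  have hL := S.hL
  have hβ₁ := S.hβ₁
  have hβ₂ := S.hβ₂
  have hp : ∀ i : (G × G) × G, 0 ≤ S.good i.2 *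
      ((S.F₂ i.1.1 * S.F₁ (i.2 - i.1.1)) * (S.F₂ i.1.2 * S.F₁ (i.2 - i.1.2))) := fun i =>
    mul_nonneg (S.good_nonneg _) (mul_nonneg (mul_nonneg (S.F₂_nonneg _) (S.F₁_nonneg _))
      (mul_nonneg (S.F₂_nonneg _) (S.F₁_nonneg _)))
  have h := weighted_cauchy_schwarz (ι := (G × G) × G)
    (fun i => S.good i.2 *
      ((S.F₂ i.1.1 * S.F₁ (i.2 - i.1.1)) * (S.F₂ i.1.2 * S.F₁ (i.2 - i.1.2))))
    (fun i => S.A (i.2 - i.1.1) i.1.1 * S.A (i.2 - i.1.2) i.1.2)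
    (fun i => ∑ x, S.F₁ x * (S.bal x i.1.1 * S.bal x i.1.2) * S.I (i.2 - x)) hp
    (fun i => by
      rw [abs_of_nonneg (mul_nonneg (S.A_nonneg _ _) (S.A_nonneg _ _))]
      exact mul_le_one₀ (S.A_le_one _ _) (S.A_nonneg _ _) (S.A_le_one _ _))
  have e1 : S.form₁' = S.β₂ * ∑ i : (G × G) × G, S.good i.2 *
      ((S.F₂ i.1.1 * S.F₁ (i.2 - i.1.1)) * (S.F₂ i.1.2 * S.F₁ (i.2 - i.1.2))) *
      (S.A (i.2 - i.1.1) i.1.1 * S.A (i.2 - i.1.2) i.1.2) *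
      ∑ x, S.F₁ x * (S.bal x i.1.1 * S.bal x i.1.2) * S.I (i.2 - x) := by
    rw [form₁', Fintype.sum_prod_type (α₁ := G × G), mul_sum]
    refine sum_congr rfl fun k _ => ?_
    rw [mul_sum]
    refine sum_congr rfl fun z _ => ?_
    rw [mul_sum, mul_sum]
    refine sum_congr rfl fun x _ => ?_
    have a1 := S.F₁_mul_A (z - k.1) k.1
    have a2 := S.F₂_mul_A (z - k.1) k.1
    have a3 := S.F₁_mul_A (z - k.2) k.2
    have a4 := S.F₂_mul_A (z - k.2) k.2
    have a5 : (S.F₂ k.1 * S.F₁ (z - k.1)) * (S.F₂ k.2 * S.F₁ (z - k.2)) *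
        (S.A (z - k.1) k.1 * S.A (z - k.2) k.2) = S.A (z - k.1) k.1 * S.A (z - k.2) k.2 := by
      calc _ = (S.F₂ k.1 * (S.F₁ (z - k.1) * S.A (z - k.1) k.1)) *
          (S.F₂ k.2 * (S.F₁ (z - k.2) * S.A (z - k.2) k.2)) := by ring
        _ = _ := by rw [a1, a2, a3, a4]
    dsimp only
    linear_combination (-(S.β₂ * S.good z * (S.F₁ x * (S.bal x k.1 * S.bal x k.2) *
      S.I (z - x)))) * a5
  have e2 : ∑ i : (G × G) × G, S.good i.2 *
      ((S.F₂ i.1.1 * S.F₁ (i.2 - i.1.1)) * (S.F₂ i.1.2 * S.F₁ (i.2 - i.1.2))) ≤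
      8 * S.β₁ ^ 2 * S.β₂ ^ 2 * S.L ^ 3 := by
    calc _ = ∑ z, S.good z * S.conv z ^ 2 := by
          rw [Fintype.sum_prod_type_right (α₂ := G)]
          refine sum_congr rfl fun z _ => ?_
          dsimp only
          rw [← mul_sum, sq, conv_eq, sum_mul_sum, Fintype.sum_prod_type]
      _ ≤ ∑ _z : G, (2 * (S.β₁ * S.β₂ * S.L)) ^ 2 := by
          refine sum_le_sum fun z _ => ?_
          have h2 : S.good z * S.conv z ^ 2 = (S.good z * S.conv z) ^ 2 := by
            rcases S.good_mem z with h | h <;> simp [h]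
          rw [h2]
          exact pow_le_pow_left₀ (mul_nonneg (S.good_nonneg _) (S.conv_nonneg _))
            (S.good_mul_conv_le z) 2
      _ = Fintype.card G * (2 * (S.β₁ * S.β₂ * S.L)) ^ 2 := by simp
      _ ≤ (2 * S.L) * (2 * (S.β₁ * S.β₂ * S.L)) ^ 2 := by gcongr; exact S.card_le
      _ = _ := by ring
  have e3 : ∑ i : (G × G) × G, S.good i.2 *
      ((S.F₂ i.1.1 * S.F₁ (i.2 - i.1.1)) * (S.F₂ i.1.2 * S.F₁ (i.2 - i.1.2))) *
      (∑ x, S.F₁ x * (S.bal x i.1.1 * S.bal x i.1.2) * S.I (i.2 - x)) ^ 2 = S.form₂ := by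
    rw [sum_mul_sq_expand, form₂]
    simp only [Fintype.sum_prod_type]
    refine sum_congr rfl fun x _ => sum_congr rfl fun x' _ => ?_
    rw [sum_comm]
    refine sum_congr rfl fun y' _ => ?_
    rw [sum_comm]
    refine sum_congr rfl fun z _ => sum_congr rfl fun y _ => ?_
    rw [pairWeight]
    ring
  rw [e3] at h
  have h0 : 0 ≤ S.form₂ := by
    rw [← e3]
    exact sum_nonneg fun i _ => mul_nonneg (hp i) (sq_nonneg _)
  rw [e1, mul_pow]
  calc _ ≤ S.β₂ ^ 2 * (8 * S.β₁ ^ 2 * S.β₂ ^ 2 * S.L ^ 3 * S.form₂) := by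
        refine mul_le_mul_of_nonneg_left (h.trans ?_) (sq_nonneg _)
        exact mul_le_mul_of_nonneg_right e2 h0
    _ = _ := by ring

variable {e₁ : G → ℝ} {ε ζ : ℝ}

lemma card_cube_mul_le (hζ : 0 ≤ ζ) :
    (Fintype.card (G × G × G) : ℝ) * ζ ≤ 8 * S.L ^ 3 * ζ := by
  refine mul_le_mul_of_nonneg_right ?_ hζ
  rw [Fintype.card_prod, Fintype.card_prod, Nat.cast_mul, Nat.cast_mul]
  have := S.card_le
  have h0 : (0 : ℝ) ≤ Fintype.card G := Nat.cast_nonneg _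
  calc _ = (Fintype.card G : ℝ) ^ 3 := by ring
    _ ≤ (2 * S.L) ^ 3 := by gcongr
    _ = _ := by ring

lemma form₂_le (h₁ : ApproxBy S.F₁ S.I S.β₁ ζ e₁) (he₁ : ∀ x, 0 ≤ e₁ x)
    (hs₁ : ∑ x, e₁ x ≤ ε * (S.β₁ * S.L)) (hζ : 0 ≤ ζ) :
    S.form₂ ≤ S.form₂' + 8 * S.L ^ 3 * ζ + 2 * ε * S.β₁ ^ 4 * S.β₂ ^ 2 * S.L ^ 5 := by
  have hL := S.hL
  have hβ₁ := S.hβ₁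
  have hβ₂ := S.hβ₂
  have ha0 : ∀ (k : G × G × G) z,
      0 ≤ S.good z * (S.I (z - k.1) * S.I (z - k.2.1)) * S.F₁ (z - k.2.2) := fun k z =>
    mul_nonneg (mul_nonneg (S.good_nonneg _) (mul_nonneg (S.I_nonneg _) (S.I_nonneg _)))
      (S.F₁_nonneg _)
  have hI1 : ∀ (k : G × G × G) z, S.I (z - k.1) * S.I (z - k.2.1) ≤ 1 := fun k z =>
    mul_le_one₀ (S.I_le _) (S.I_nonneg _) (S.I_le _)
  have ha : ∀ (k : G × G × G) z,
      |S.good z * (S.I (z - k.1) * S.I (z - k.2.1)) * S.F₁ (z - k.2.2)| ≤ 1 := by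
    intro k z
    rw [abs_of_nonneg (ha0 k z)]
    exact mul_le_one₀ (mul_le_one₀ (S.good_le _) (mul_nonneg (S.I_nonneg _) (S.I_nonneg _))
      (hI1 k z)) (S.F₁_nonneg _) (S.F₁_le _)
  have h := h₁.family (κ := G × G × G) _ (fun k y => S.pairWeight k.1 k.2.1 y k.2.2) ha
    (fun k x => (S.abs_pairWeight_le _ _ _ _).trans (S.F_prod_le_one _ _ _ _))
  have h' := (le_abs_self _).trans h
  have hcard := S.card_cube_mul_le hζ
  have herr : ∑ k : G × G × G, ∑ z, ∑ y,
      |S.good z * (S.I (z - k.1) * S.I (z - k.2.1)) * S.F₁ (z - k.2.2)| *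
      |S.pairWeight k.1 k.2.1 y k.2.2| * e₁ (z - y) ≤
      2 * ε * S.β₁ ^ 4 * S.β₂ ^ 2 * S.L ^ 5 := by
    calc _ ≤ ∑ k : G × G × G, ∑ z, ∑ y, (S.good z * S.F₁ (z - k.2.2)) *
          (S.F₁ k.1 * S.F₁ k.2.1 * (S.F₂ y * S.F₂ k.2.2) * e₁ (z - y)) := by
          refine sum_le_sum fun k _ => sum_le_sum fun z _ => sum_le_sum fun y _ => ?_
          rw [abs_of_nonneg (ha0 k z), mul_assoc]
          refine mul_le_mul ?_ (mul_le_mul_of_nonneg_right (S.abs_pairWeight_le _ _ _ _) (he₁ _))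
            (mul_nonneg (abs_nonneg _) (he₁ _))
            (mul_nonneg (S.good_nonneg _) (S.F₁_nonneg _))
          exact mul_le_mul_of_nonneg_right
            (mul_le_of_le_one_right (S.good_nonneg _) (hI1 k z)) (S.F₁_nonneg _)
      _ = (∑ x, S.F₁ x) ^ 2 * ∑ z, (S.good z * S.conv z) * ∑ y, S.F₂ y * e₁ (z - y) := by
          simp only [Fintype.sum_prod_type]
          rw [sq, sum_mul_sum, sum_mul]
          refine sum_congr rfl fun x _ => ?_
          rw [sum_mul]
          refine sum_congr rfl fun x' _ => ?_
          rw [sum_comm, mul_sum]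
          refine sum_congr rfl fun z _ => ?_
          rw [conv_eq, mul_assoc (S.good z), sum_mul_sum]
          simp only [mul_sum]
          exact sum_congr rfl fun y' _ => sum_congr rfl fun y _ => by ring
      _ ≤ (∑ x, S.F₁ x) ^ 2 * ∑ z, (2 * (S.β₁ * S.β₂ * S.L)) * ∑ y, S.F₂ y * e₁ (z - y) := by
          refine mul_le_mul_of_nonneg_left (sum_le_sum fun z _ => ?_) (sq_nonneg _)
          exact mul_le_mul_of_nonneg_right (S.good_mul_conv_le z)
            (sum_nonneg fun x _ => mul_nonneg (S.F₂_nonneg _) (he₁ _))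
      _ = (S.β₁ * S.L) ^ 2 * ((2 * (S.β₁ * S.β₂ * S.L)) * ((S.β₂ * S.L) * ∑ x, e₁ x)) := by
          rw [← mul_sum, sum_sum_conv, S.sum_F₁, S.sum_F₂]
      _ ≤ (S.β₁ * S.L) ^ 2 *
          ((2 * (S.β₁ * S.β₂ * S.L)) * ((S.β₂ * S.L) * (ε * (S.β₁ * S.L)))) := by gcongr
      _ = _ := by ring
  change S.form₂ - S.form₂' ≤ _ at h'
  linarith

lemma form₂'_eq : S.form₂' = ∑ k : G × G × G, ∑ z, ∑ y', (S.good z *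
    (S.I (z - k.1) * S.I (z - k.2.1)) * (S.β₁ * S.I (z - k.2.2))) *
    S.pairWeight k.1 k.2.1 k.2.2 y' * S.F₁ (z - y') := by
  rw [form₂']
  simp only [Fintype.sum_prod_type]
  refine sum_congr rfl fun x _ => sum_congr rfl fun x' _ => ?_
  rw [sum_comm, sum_comm (s := (univ : Finset G)) (t := (univ : Finset G))
    (f := fun y z => ∑ y', (S.good z * (S.I (z - x) * S.I (z - x')) * (S.β₁ * S.I (z - y))) *
      S.pairWeight x x' y y' * S.F₁ (z - y'))]
  refine sum_congr rfl fun z _ => ?_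
  rw [sum_comm]
  exact sum_congr rfl fun y _ => sum_congr rfl fun y' _ => by ring

lemma form₂'_le (h₁ : ApproxBy S.F₁ S.I S.β₁ ζ e₁) (he₁ : ∀ x, 0 ≤ e₁ x)
    (hs₁ : ∑ x, e₁ x ≤ ε * (S.β₁ * S.L)) (hζ : 0 ≤ ζ) :
    S.form₂' ≤ S.form₃ + 8 * S.L ^ 3 * ζ + ε * S.β₁ ^ 4 * S.β₂ ^ 2 * S.L ^ 5 := by
  have hL := S.hL
  have hβ₁ := S.hβ₁
  have hβ₂ := S.hβ₂
  have ha0 : ∀ (k : G × G × G) z,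
      0 ≤ S.good z * (S.I (z - k.1) * S.I (z - k.2.1)) * (S.β₁ * S.I (z - k.2.2)) := fun k z =>
    mul_nonneg (mul_nonneg (S.good_nonneg _) (mul_nonneg (S.I_nonneg _) (S.I_nonneg _)))
      (mul_nonneg hβ₁.le (S.I_nonneg _))
  have ha' : ∀ (k : G × G × G) z,
      S.good z * (S.I (z - k.1) * S.I (z - k.2.1)) * (S.β₁ * S.I (z - k.2.2)) ≤ S.β₁ := by
    intro k z
    rw [mul_left_comm]
    refine mul_le_of_le_one_right hβ₁.le ?_
    exact mul_le_one₀ (mul_le_one₀ (S.good_le _) (mul_nonneg (S.I_nonneg _) (S.I_nonneg _))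
      (mul_le_one₀ (S.I_le _) (S.I_nonneg _) (S.I_le _))) (S.I_nonneg _) (S.I_le _)
  have ha : ∀ (k : G × G × G) z,
      |S.good z * (S.I (z - k.1) * S.I (z - k.2.1)) * (S.β₁ * S.I (z - k.2.2))| ≤ 1 := by
    intro k z
    rw [abs_of_nonneg (ha0 k z)]
    exact (ha' k z).trans S.hβ₁'
  have h := h₁.family (κ := G × G × G) _ (fun k y => S.pairWeight k.1 k.2.1 k.2.2 y) ha
    (fun k x => (S.abs_pairWeight_le _ _ _ _).trans (S.F_prod_le_one _ _ _ _))
  have h' := (le_abs_self _).trans h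
  have hcard := S.card_cube_mul_le hζ
  have herr : ∑ k : G × G × G, ∑ z, ∑ y,
      |S.good z * (S.I (z - k.1) * S.I (z - k.2.1)) * (S.β₁ * S.I (z - k.2.2))| *
      |S.pairWeight k.1 k.2.1 k.2.2 y| * e₁ (z - y) ≤ ε * S.β₁ ^ 4 * S.β₂ ^ 2 * S.L ^ 5 := by
    calc _ ≤ ∑ k : G × G × G, ∑ z, ∑ y, (S.β₁ * (S.F₁ k.1 * S.F₁ k.2.1 * S.F₂ k.2.2)) *
          (S.F₂ y * e₁ (z - y)) := by
          refine sum_le_sum fun k _ => sum_le_sum fun z _ => sum_le_sum fun y _ => ?_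
          rw [abs_of_nonneg (ha0 k z)]
          calc _ ≤ S.β₁ * (S.F₁ k.1 * S.F₁ k.2.1 * (S.F₂ k.2.2 * S.F₂ y)) * e₁ (z - y) :=
                mul_le_mul_of_nonneg_right (mul_le_mul (ha' k z) (S.abs_pairWeight_le _ _ _ _)
                  (abs_nonneg _) hβ₁.le) (he₁ _)
            _ = _ := by ring
      _ = S.β₁ * ((∑ x, S.F₁ x) ^ 2 * ∑ x, S.F₂ x) * ((∑ x, S.F₂ x) * ∑ x, e₁ x) := by
          simp only [← mul_sum, sum_sum_conv]
          rw [← sum_mul, ← mul_sum]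
          congr 2
          simp only [Fintype.sum_prod_type, ← mul_sum, ← sum_mul]
          rw [sq]
      _ ≤ S.β₁ * ((S.β₁ * S.L) ^ 2 * (S.β₂ * S.L)) * ((S.β₂ * S.L) * (ε * (S.β₁ * S.L))) := by
          rw [S.sum_F₁, S.sum_F₂]
          gcongr
      _ = _ := by ring
  rw [form₂'_eq]
  rw [form₃]
  linarith

end CornerSystem
end BoxNorm

section CornerCount
variable {G : Type*} [AddCommGroup G] [Fintype G]
namespace CornerSystem

variable (S : CornerSystem G) {e₁ e₂ : G → ℝ} {ε ζ σ : ℝ}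

lemma abs_sum_bal_mul_le
    (hσ : ∀ u v : G → ℝ, (∀ x, u x = 0 ∨ u x = 1) → (∀ y, v y = 0 ∨ v y = 1) →
      |∑ x, ∑ y, S.bal x y * u x * v y| ≤ σ * (S.β₁ * S.L) * (S.β₂ * S.L)) (z x' y' : G) :
    |∑ x, ∑ y, S.bal x y * (S.I (z - x) * S.bal x y') * (S.I (z - y) * S.bal x' y)| ≤
      4 * (σ * (S.β₁ * S.L) * (S.β₂ * S.L)) := by
  have key : ∑ x, ∑ y, S.bal x y * (S.I (z - x) * S.bal x y') * (S.I (z - y) * S.bal x' y) =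
      ∑ x, ∑ y, S.bal x y * (S.I (z - x) * S.A x y') * (S.I (z - y) * S.A x' y) -
      S.τ * S.F₁ x' * ∑ x, ∑ y, S.bal x y * (S.I (z - x) * S.A x y') * S.I (z - y) -
      S.τ * S.F₂ y' * ∑ x, ∑ y, S.bal x y * S.I (z - x) * (S.I (z - y) * S.A x' y) +
      (S.τ * S.F₁ x') * (S.τ * S.F₂ y') * ∑ x, ∑ y, S.bal x y * S.I (z - x) * S.I (z - y) := by
    simp only [mul_sum, ← sum_sub_distrib, ← sum_add_distrib]
    refine sum_congr rfl fun x _ => sum_congr rfl fun y _ => ?_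
    have h1 := S.F₁_mul_bal x y
    have h2 := S.F₂_mul_bal x y
    calc S.bal x y * (S.I (z - x) * S.bal x y') * (S.I (z - y) * S.bal x' y)
        = S.bal x y * S.I (z - x) * S.I (z - y) * (S.A x y' * S.A x' y) -
          S.τ * S.F₁ x' * (S.F₂ y * S.bal x y) * (S.I (z - x) * S.A x y') * S.I (z - y) -
          S.τ * S.F₂ y' * (S.F₁ x * S.bal x y) * S.I (z - x) * (S.I (z - y) * S.A x' y) +
          (S.τ * S.F₁ x') * (S.τ * S.F₂ y') * (S.F₁ x * (S.F₂ y * S.bal x y)) *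
            S.I (z - x) * S.I (z - y) := by
          rw [show S.bal x y' = S.A x y' - S.τ * (S.F₁ x * S.F₂ y') from rfl,
            show S.bal x' y = S.A x' y - S.τ * (S.F₁ x' * S.F₂ y) from rfl]
          ring
      _ = _ := by rw [h2, h1]; ring
  have hu : ∀ x, S.I (z - x) * S.A x y' = 0 ∨ S.I (z - x) * S.A x y' = 1 := fun x => by
    rcases S.I_mem (z - x) with h | h <;> rcases S.A_mem x y' with h' | h' <;> simp [h, h']
  have hv : ∀ y, S.I (z - y) * S.A x' y = 0 ∨ S.I (z - y) * S.A x' y = 1 := fun y => by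
    rcases S.I_mem (z - y) with h | h <;> rcases S.A_mem x' y with h' | h' <;> simp [h, h']
  have b1 := hσ _ _ hu hv
  have b2 := hσ _ _ hu (fun y => S.I_mem (z - y))
  have b3 := hσ _ _ (fun x => S.I_mem (z - x)) hv
  have b4 := hσ _ _ (fun x => S.I_mem (z - x)) (fun y => S.I_mem (z - y))
  have hc1 : |S.τ * S.F₁ x'| ≤ 1 := by
    rw [abs_of_nonneg (mul_nonneg S.hτ.le (S.F₁_nonneg _))]
    exact mul_le_one₀ S.hτ' (S.F₁_nonneg _) (S.F₁_le _)
  have hc2 : |S.τ * S.F₂ y'| ≤ 1 := by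
    rw [abs_of_nonneg (mul_nonneg S.hτ.le (S.F₂_nonneg _))]
    exact mul_le_one₀ S.hτ' (S.F₂_nonneg _) (S.F₂_le _)
  have mul_bound : ∀ {c X B : ℝ}, |c| ≤ 1 → |X| ≤ B → |c * X| ≤ B := fun {c X B} hc hX => by
    rw [abs_mul]; exact (mul_le_of_le_one_left (abs_nonneg _) hc).trans hX
  have hc12 : |S.τ * S.F₁ x' * (S.τ * S.F₂ y')| ≤ 1 := mul_bound hc1 hc2
  rw [key]
  have b2' := abs_le.mp (mul_bound hc1 b2)
  have b3' := abs_le.mp (mul_bound hc2 b3)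
  have b4' := abs_le.mp (mul_bound hc12 b4)
  have b1' := abs_le.mp b1
  rw [abs_le]
  constructor <;> linarith

lemma form₃_le
    (hσ : ∀ u v : G → ℝ, (∀ x, u x = 0 ∨ u x = 1) → (∀ y, v y = 0 ∨ v y = 1) →
      |∑ x, ∑ y, S.bal x y * u x * v y| ≤ σ * (S.β₁ * S.L) * (S.β₂ * S.L)) :
    S.form₃ ≤ 8 * σ * S.β₁ ^ 4 * S.β₂ ^ 2 * S.L ^ 5 := by
  have hL := S.hL
  have hβ₁ := S.hβ₁
  have hβ₂ := S.hβ₂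
  have key : S.form₃ = ∑ z, ∑ x', ∑ y', (S.β₁ ^ 2 * (S.F₁ x' * S.F₂ y') *
      (S.good z * (S.I (z - x') * S.I (z - y') * S.bal x' y'))) *
      ∑ x, ∑ y, S.bal x y * (S.I (z - x) * S.bal x y') * (S.I (z - y) * S.bal x' y) := by
    rw [form₃, sum_comm]
    refine sum_congr rfl fun z _ => ?_
    simp only [Fintype.sum_prod_type]
    rw [sum_comm]
    refine sum_congr rfl fun x' _ => ?_
    simp only [mul_sum]
    rw [sum_comm' (t' := univ) (s' := fun _ => univ) (by simp)]
    conv_rhs => rw [sum_comm]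
    rw [sum_comm]
    refine sum_congr rfl fun x _ => ?_
    conv_rhs => rw [sum_comm]
    refine sum_congr rfl fun y _ => sum_congr rfl fun y' _ => ?_
    rw [pairWeight]
    have h1 := S.F₁_mul_bal x y
    have h2 := S.F₂_mul_bal x y
    linear_combination (S.good z * (S.I (z - x) * S.I (z - x')) * (S.β₁ * S.I (z - y)) *
      (S.F₁ x' * S.F₂ y') * (S.bal x y' * (S.bal x' y * S.bal x' y')) * (S.β₁ * S.I (z - y'))) *
      (S.F₂ y * h1 + h2)
  have h0 : 0 ≤ σ * (S.β₁ * S.L) * (S.β₂ * S.L) :=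
    (abs_nonneg _).trans (hσ (fun _ => 0) (fun _ => 0) (by simp) (by simp))
  calc S.form₃ ≤ ∑ _z : G, ∑ x', ∑ y', (S.β₁ ^ 2 * (S.F₁ x' * S.F₂ y')) *
        (4 * (σ * (S.β₁ * S.L) * (S.β₂ * S.L))) := by
        rw [key]
        refine sum_le_sum fun z _ => sum_le_sum fun x' _ => sum_le_sum fun y' _ => ?_
        refine (le_abs_self _).trans ?_
        have hF : 0 ≤ S.β₁ ^ 2 * (S.F₁ x' * S.F₂ y') :=
          mul_nonneg (sq_nonneg _) (mul_nonneg (S.F₁_nonneg _) (S.F₂_nonneg _))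
        rw [abs_mul, abs_mul, abs_of_nonneg hF]
        refine mul_le_mul (mul_le_of_le_one_right hF ?_) (S.abs_sum_bal_mul_le hσ z x' y')
          (abs_nonneg _) hF
        rw [abs_mul, abs_mul, abs_mul, abs_of_nonneg (S.good_nonneg _),
          abs_of_nonneg (S.I_nonneg _), abs_of_nonneg (S.I_nonneg _)]
        exact mul_le_one₀ (S.good_le _) (mul_nonneg (mul_nonneg (S.I_nonneg _) (S.I_nonneg _))
          (abs_nonneg _)) (mul_le_one₀ (mul_le_one₀ (S.I_le _) (S.I_nonneg _) (S.I_le _))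
            (abs_nonneg _) (S.abs_bal_le _ _))
    _ = Fintype.card G * ((S.β₁ ^ 2 * ((S.β₁ * S.L) * (S.β₂ * S.L))) *
        (4 * (σ * (S.β₁ * S.L) * (S.β₂ * S.L)))) := by
        simp only [← sum_mul, ← mul_sum, S.sum_F₁, S.sum_F₂]
        simp [mul_assoc]
    _ ≤ (2 * S.L) * ((S.β₁ ^ 2 * ((S.β₁ * S.L) * (S.β₂ * S.L))) *
        (4 * (σ * (S.β₁ * S.L) * (S.β₂ * S.L)))) :=
        mul_le_mul_of_nonneg_right S.card_le (by positivity)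
    _ = _ := by ring

/-- A corner system cannot be regular and corner-free at the same time. -/
theorem not_regular_of_cornerFree
    (h₁ : ApproxBy S.F₁ S.I S.β₁ ζ e₁) (h₂ : ApproxBy S.F₂ S.I S.β₂ ζ e₂)
    (he₁ : ∀ x, 0 ≤ e₁ x) (he₂ : ∀ x, 0 ≤ e₂ x) (hs₁ : ∑ x, e₁ x ≤ ε * (S.β₁ * S.L))
    (hs₂ : ∑ x, e₂ x ≤ ε * (S.β₂ * S.L)) (hζ : 0 ≤ ζ)
    (hσ : ∀ u v : G → ℝ, (∀ x, u x = 0 ∨ u x = 1) → (∀ y, v y = 0 ∨ v y = 1) →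
      |∑ x, ∑ y, S.bal x y * u x * v y| ≤ σ * (S.β₁ * S.L) * (S.β₂ * S.L))
    (hcf : ∑ z, ∑ x, ∑ y, S.A x (z - x) * S.A (z - y) y * S.A x y ≤ ∑ x, ∑ y, S.A x y)
    (hbig : 16 ≤ S.τ ^ 2 * S.β₁ * S.β₂ * S.L)
    (hε : ε ≤ S.τ ^ 12 / 2 ^ 24) (hσ' : σ ≤ S.τ ^ 12 / 2 ^ 26)
    (hζ' : ζ ≤ S.τ ^ 12 * (S.β₁ * S.β₂) ^ 4 * S.L ^ 2 / 2 ^ 28) : False := by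
  have hL := S.hL
  have hβ₁ := S.hβ₁
  have hβ₂ := S.hβ₂
  have hτ := S.hτ
  have hβ₁' := S.hβ₁'
  have hβ₂' := S.hβ₂'
  have hτ' := S.hτ'
  have hW : 0 < S.β₁ * S.β₂ := mul_pos hβ₁ hβ₂
  have hW1 : S.β₁ * S.β₂ ≤ 1 := mul_le_one₀ hβ₁' hβ₂.le hβ₂'
  have hτ6 : S.τ ^ 12 ≤ S.τ ^ 6 := pow_le_pow_of_le_one hτ.le hτ' (by norm_num)
  have hτ1 : S.τ ^ 12 ≤ S.τ := by
    simpa using pow_le_pow_of_le_one hτ.le hτ' (show 1 ≤ 12 by norm_num)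
  have hW3 : (S.β₁ * S.β₂) ^ 4 ≤ (S.β₁ * S.β₂) ^ 3 :=
    pow_le_pow_of_le_one hW.le hW1 (by norm_num)
  have hW4 : (S.β₁ * S.β₂) ^ 4 ≤ S.β₁ * S.β₂ := by
    simpa using pow_le_pow_of_le_one hW.le hW1 (show 1 ≤ 4 by norm_num)
  have hWP : (S.β₁ * S.β₂) ^ 4 ≤ S.β₁ ^ 4 * S.β₂ ^ 2 := by
    rw [mul_pow]
    exact mul_le_mul_of_nonneg_left (pow_le_pow_of_le_one hβ₂.le hβ₂' (by norm_num)) (by positivity)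
  have ζ1 : ζ ≤ S.τ * (S.β₁ * S.β₂) * S.L ^ 2 / 2 ^ 28 := hζ'.trans (by gcongr)
  have ζ2 : ζ ≤ S.τ ^ 6 * (S.β₁ * S.β₂) ^ 3 * S.L ^ 2 / 2 ^ 28 := hζ'.trans (by gcongr)
  have ζ3 : ζ ≤ S.τ ^ 12 * (S.β₁ ^ 4 * S.β₂ ^ 2) * S.L ^ 2 / 2 ^ 28 := hζ'.trans (by gcongr)
  have hbad := S.sum_bad_conv_le h₁ h₂ he₁ he₂ hs₁ hs₂ hζ
  have hbad' : ∑ z, (1 - S.good z) * S.conv z ≤ S.τ * (S.β₁ * S.L) * (S.β₂ * S.L) / 2 := by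
    have : ε * ((S.β₁ * S.L) * (S.β₂ * S.L)) ≤ S.τ / 2 ^ 24 * ((S.β₁ * S.L) * (S.β₂ * S.L)) :=
      mul_le_mul_of_nonneg_right (hε.trans (by gcongr)) (by positivity)
    have hp : 0 ≤ S.τ * ((S.β₁ * S.L) * (S.β₂ * S.L)) := by positivity
    nlinarith
  have hT := S.cornerForm_le hcf hbad' hbig
  have hT2 := S.cornerForm_sq_le
  have hf1 := S.form₁_le h₂ he₂ hs₂ hζ
  have hf1' := S.form₁'_sq_le
  have hf2 := S.form₂_le h₁ he₁ hs₁ hζ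
  have hf2' := S.form₂'_le h₁ he₁ hs₁ hζ
  have hf3 := S.form₃_le hσ
  have c1 : S.τ ^ 6 * (S.β₁ * S.β₂) ^ 3 * S.L ^ 4 / 256 ≤ S.form₁ := by
    have h0 : 0 ≤ S.τ ^ 3 * S.β₁ ^ 2 * S.β₂ ^ 2 * S.L ^ 3 / 16 := by positivity
    have h1 := pow_le_pow_left₀ h0 hT 2
    rw [neg_sq] at h1
    have h2 : (S.β₁ * S.L * (S.β₂ * S.L)) * (S.τ ^ 6 * (S.β₁ * S.β₂) ^ 3 * S.L ^ 4 / 256) ≤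
        (S.β₁ * S.L * (S.β₂ * S.L)) * S.form₁ := by
      refine le_trans (le_of_eq ?_) (h1.trans hT2)
      ring
    exact le_of_mul_le_mul_left h2 (by positivity)
  have c2 : S.τ ^ 6 * (S.β₁ * S.β₂) ^ 3 * S.L ^ 4 / 512 ≤ S.form₁' := by
    have h1 : ε * ((S.β₁ * S.β₂) ^ 3 * S.L ^ 4) ≤
        S.τ ^ 6 / 2 ^ 24 * ((S.β₁ * S.β₂) ^ 3 * S.L ^ 4) :=
      mul_le_mul_of_nonneg_right (hε.trans (by gcongr)) (by positivity)
    have h2 : S.L ^ 2 * ζ ≤ S.L ^ 2 * (S.τ ^ 6 * (S.β₁ * S.β₂) ^ 3 * S.L ^ 2 / 2 ^ 28) :=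
      mul_le_mul_of_nonneg_left ζ2 (by positivity)
    have hp : 0 ≤ S.τ ^ 6 * (S.β₁ * S.β₂) ^ 3 * S.L ^ 4 := by positivity
    have e1 : S.L ^ 2 * (S.τ ^ 6 * (S.β₁ * S.β₂) ^ 3 * S.L ^ 2 / 2 ^ 28) =
      S.τ ^ 6 * (S.β₁ * S.β₂) ^ 3 * S.L ^ 4 / 2 ^ 28 := by ring
    linarith
  have c3 : S.τ ^ 12 * (S.β₁ ^ 4 * S.β₂ ^ 2 * S.L ^ 5) / 2 ^ 21 ≤ S.form₂ := by
    have h1 := pow_le_pow_left₀ (by positivity) c2 2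
    have h2 : (8 * S.β₁ ^ 2 * S.β₂ ^ 4 * S.L ^ 3) *
        (S.τ ^ 12 * (S.β₁ ^ 4 * S.β₂ ^ 2 * S.L ^ 5) / 2 ^ 21) ≤
        (8 * S.β₁ ^ 2 * S.β₂ ^ 4 * S.L ^ 3) * S.form₂ := by
      refine le_trans (le_of_eq ?_) (h1.trans hf1')
      ring
    exact le_of_mul_le_mul_left h2 (by positivity)
  have hP : 0 < S.β₁ ^ 4 * S.β₂ ^ 2 * S.L ^ 5 := by positivity
  have hP' : 0 < S.τ ^ 12 * (S.β₁ ^ 4 * S.β₂ ^ 2 * S.L ^ 5) := by positivity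
  have k1 := mul_le_mul_of_nonneg_right hε hP.le
  have k2 := mul_le_mul_of_nonneg_right hσ' hP.le
  have k3 : S.L ^ 3 * ζ ≤ S.L ^ 3 * (S.τ ^ 12 * (S.β₁ ^ 4 * S.β₂ ^ 2) * S.L ^ 2 / 2 ^ 28) :=
    mul_le_mul_of_nonneg_left ζ3 (by positivity)
  have e1 : S.L ^ 3 * (S.τ ^ 12 * (S.β₁ ^ 4 * S.β₂ ^ 2) * S.L ^ 2 / 2 ^ 28) =
    S.τ ^ 12 * (S.β₁ ^ 4 * S.β₂ ^ 2 * S.L ^ 5) / 2 ^ 28 := by ring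
  linarith

end CornerSystem
end CornerCount

section Fourier

variable {M : ℕ} [NeZero M]

/-- The Fourier transform of a real function on `ZMod M`. -/
noncomputable def realDFT (f : ZMod M → ℝ) (r : ZMod M) : ℂ :=
  ∑ x, (f x : ℂ) * ZMod.stdAddChar (-(r * x))

lemma norm_realDFT_le {f : ZMod M → ℝ} (hf : ∀ x, |f x| ≤ 1) (r : ZMod M) :
    ‖realDFT f r‖ ≤ M := by
  refine (norm_sum_le _ _).trans ?_
  calc _ ≤ ∑ _x : ZMod M, (1 : ℝ) := sum_le_sum fun x _ => by
        rw [norm_mul, AddChar.norm_apply, mul_one, Complex.norm_real]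
        exact hf x
    _ = M := by simp [ZMod.card]

lemma conj_realDFT (f : ZMod M → ℝ) (r : ZMod M) :
    (starRingEnd ℂ) (realDFT f r) = ∑ x, (f x : ℂ) * ZMod.stdAddChar (r * x) := by
  rw [realDFT, map_sum]
  refine sum_congr rfl fun x _ => ?_
  rw [map_mul, Complex.conj_ofReal, ← AddChar.map_neg_eq_conj, neg_neg]

lemma sum_norm_realDFT_sq (f : ZMod M → ℝ) :
    ∑ r, ‖realDFT f r‖ ^ 2 = M * ∑ x, f x ^ 2 := by
  have h : ∀ r, ((‖realDFT f r‖ ^ 2 : ℝ) : ℂ) =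
      ∑ x, ∑ y, (f x : ℂ) * (f y : ℂ) * ZMod.stdAddChar (r * (y - x)) := by
    intro r
    rw [← Complex.normSq_eq_norm_sq, ← Complex.mul_conj, conj_realDFT, realDFT, sum_mul_sum]
    refine sum_congr rfl fun x _ => sum_congr rfl fun y _ => ?_
    rw [mul_mul_mul_comm, ← AddChar.map_add_eq_mul]
    congr 2
    ring
  have : ((∑ r, ‖realDFT f r‖ ^ 2 : ℝ) : ℂ) = ((M * ∑ x, f x ^ 2 : ℝ) : ℂ) := by
    rw [Complex.ofReal_sum, sum_congr rfl fun r _ => h r, sum_comm]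
    push_cast
    rw [mul_sum]
    refine sum_congr rfl fun x _ => ?_
    rw [sum_comm]
    simp_rw [← mul_sum, AddChar.sum_mulShift _ (ZMod.isPrimitive_stdAddChar M), sub_eq_zero]
    simp [ZMod.card]
    ring
  exact_mod_cast this

lemma sum_realDFT_mul (a b f : ZMod M → ℝ) :
    ∑ r, realDFT f r * ((starRingEnd ℂ) (realDFT a r) * realDFT b r) =
      M * ((∑ z, ∑ x, a z * b x * f (z - x) : ℝ) : ℂ) := by
  have h : ∀ r, realDFT f r * ((starRingEnd ℂ) (realDFT a r) * realDFT b r) =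
      ∑ z, ∑ x, ∑ y, (a z : ℂ) * b x * f y * ZMod.stdAddChar (r * (z - x - y)) := by
    intro r
    rw [conj_realDFT, realDFT, realDFT, sum_mul_sum, sum_mul_sum, sum_comm]
    simp_rw [mul_sum]
    refine sum_congr rfl fun z _ => ?_
    rw [sum_comm]
    refine sum_congr rfl fun x _ => sum_congr rfl fun y _ => ?_
    rw [show r * (z - x - y) = -(r * y) + (r * z + -(r * x)) by ring, AddChar.map_add_eq_mul,
      AddChar.map_add_eq_mul]
    ring
  rw [sum_congr rfl fun r _ => h r, sum_comm]
  push_cast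
  rw [mul_sum]
  refine sum_congr rfl fun z _ => ?_
  rw [sum_comm, mul_sum]
  refine sum_congr rfl fun x _ => ?_
  rw [sum_comm]
  simp_rw [← mul_sum, AddChar.sum_mulShift _ (ZMod.isPrimitive_stdAddChar M), sub_eq_zero]
  simp [ZMod.card]
  ring

lemma abs_sum_conv_le_of_norm_realDFT_le {a b f : ZMod M → ℝ} {B : ℝ} (ha : ∀ x, |a x| ≤ 1)
    (hb : ∀ x, |b x| ≤ 1) (hf : ∀ r, ‖realDFT f r‖ ≤ B) :
    |∑ z, ∑ x, a z * b x * f (z - x)| ≤ B * M := by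
  have hM : (0 : ℝ) < M := Nat.cast_pos.mpr (NeZero.pos M)
  have hB : 0 ≤ B := (norm_nonneg _).trans (hf 0)
  have hsq : ∀ g : ZMod M → ℝ, (∀ x, |g x| ≤ 1) → ∑ r, ‖realDFT g r‖ ^ 2 ≤ M * M := by
    intro g hg
    rw [sum_norm_realDFT_sq]
    refine mul_le_mul_of_nonneg_left ?_ hM.le
    calc ∑ x, g x ^ 2 ≤ ∑ _x : ZMod M, (1 : ℝ) :=
          sum_le_sum fun x _ => (sq_le_one_iff_abs_le_one _).mpr (hg x)
      _ = M := by simp [ZMod.card]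
  have h1 : (M : ℝ) * |∑ z, ∑ x, a z * b x * f (z - x)| ≤ B * (M * M) := by
    calc (M : ℝ) * |∑ z, ∑ x, a z * b x * f (z - x)|
        = ‖(M : ℂ) * ((∑ z, ∑ x, a z * b x * f (z - x) : ℝ) : ℂ)‖ := by
          rw [norm_mul, Complex.norm_real, Complex.norm_natCast, Real.norm_eq_abs]
      _ ≤ ∑ r, ‖realDFT f r * ((starRingEnd ℂ) (realDFT a r) * realDFT b r)‖ := by
          rw [← sum_realDFT_mul]; exact norm_sum_le _ _
      _ ≤ ∑ r, B * ((‖realDFT a r‖ ^ 2 + ‖realDFT b r‖ ^ 2) / 2) := by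
          refine sum_le_sum fun r _ => ?_
          rw [norm_mul, norm_mul, RCLike.norm_conj]
          refine mul_le_mul (hf r) ?_ (by positivity) hB
          linarith [two_mul_le_add_sq ‖realDFT a r‖ ‖realDFT b r‖]
      _ = B * ((∑ r, ‖realDFT a r‖ ^ 2 + ∑ r, ‖realDFT b r‖ ^ 2) / 2) := by
          rw [← mul_sum, ← sum_div, sum_add_distrib]
      _ ≤ _ := mul_le_mul_of_nonneg_left (by linarith [hsq a ha, hsq b hb]) hB
  have h2 : (M : ℝ) * |∑ z, ∑ x, a z * b x * f (z - x)| ≤ M * (B * M) := by linarith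
  exact le_of_mul_le_mul_left h2 hM

lemma card_large_spectrum_le {f : ZMod M → ℝ} (hf : ∀ x, |f x| ≤ 1) {m : ℕ} :
    #{r : ZMod M | (M : ℝ) ≤ m * ‖realDFT f r‖} ≤ m ^ 2 := by
  have hM : (0 : ℝ) < M := Nat.cast_pos.mpr (NeZero.pos M)
  set Λ : Finset (ZMod M) := {r : ZMod M | (M : ℝ) ≤ m * ‖realDFT f r‖} with hΛ
  have h : (#Λ : ℝ) * (M * M) ≤ (m : ℝ) ^ 2 * (M * M) := by
    calc (#Λ : ℝ) * (M * M) = ∑ _r ∈ Λ, (M : ℝ) ^ 2 := by simp [sq]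
      _ ≤ ∑ r ∈ Λ, (m : ℝ) ^ 2 * ‖realDFT f r‖ ^ 2 := sum_le_sum fun r hr => by
          rw [← mul_pow]
          exact pow_le_pow_left₀ hM.le (by simpa [hΛ] using hr) 2
      _ ≤ ∑ r, (m : ℝ) ^ 2 * ‖realDFT f r‖ ^ 2 :=
          sum_le_sum_of_subset_of_nonneg (subset_univ _) fun _ _ _ => by positivity
      _ = (m : ℝ) ^ 2 * (M * ∑ x, f x ^ 2) := by rw [← mul_sum, sum_norm_realDFT_sq]
      _ ≤ _ := by
          have : ∑ x, f x ^ 2 ≤ M := by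
            calc ∑ x, f x ^ 2 ≤ ∑ _x : ZMod M, (1 : ℝ) :=
                  sum_le_sum fun x _ => (sq_le_one_iff_abs_le_one _).mpr (hf x)
              _ = M := by simp [ZMod.card]
          gcongr
  have := le_of_mul_le_mul_right h (mul_pos hM hM)
  exact_mod_cast this

lemma norm_stdAddChar_sub_one_le (a b : ℕ) :
    ‖(ZMod.stdAddChar ((a : ZMod M) - (b : ZMod M)) : ℂ) - 1‖ ≤
      2 * Real.pi * |(a : ℝ) - b| / M := by
  have h := ZMod.stdAddChar_coe (N := M) ((a : ℤ) - b)
  push_cast at h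
  rw [h]
  have := Real.norm_exp_I_mul_ofReal_sub_one_le (x := 2 * Real.pi * ((a : ℝ) - b) / M)
  push_cast at this
  refine le_trans (le_of_eq ?_) (this.trans (le_of_eq ?_))
  · congr 3
    ring
  · rw [Real.norm_eq_abs, abs_div, abs_mul, abs_of_pos (by positivity : (0:ℝ) < 2 * Real.pi),
      Nat.abs_cast]

/-- Simultaneous Diophantine approximation for characters of `ZMod M`. -/
lemma exists_nat_norm_stdAddChar_sub_one_le (Λ : Finset (ZMod M)) {T : ℕ} (hT : 0 < T) :
    ∃ q : ℕ, 1 ≤ q ∧ q ≤ T ^ #Λ ∧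
      ∀ r ∈ Λ, ‖(ZMod.stdAddChar (r * (q : ZMod M)) : ℂ) - 1‖ ≤ 2 * Real.pi / T := by
  have hM : 0 < M := NeZero.pos M
  let g : Fin (T ^ #Λ + 1) → (Λ → Fin T) := fun q r =>
    ⟨(r.1 * ((q : ℕ) : ZMod M)).val * T / M, by
      rw [Nat.div_lt_iff_lt_mul hM, mul_comm T]
      exact Nat.mul_lt_mul_of_pos_right (ZMod.val_lt _) hT⟩
  obtain ⟨q₁, q₂, hne, hg⟩ := Fintype.exists_ne_map_eq_of_card_lt g (by simp)
  wlog hlt : q₁ < q₂ generalizing q₁ q₂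
  · exact this q₂ q₁ hne.symm hg.symm (lt_of_le_of_ne (not_lt.mp hlt) hne.symm)
  have hlt' : (q₁ : ℕ) < q₂ := hlt
  refine ⟨q₂ - q₁, by omega, by omega, fun r hr => ?_⟩
  have h := congrArg Fin.val (congrFun hg ⟨r, hr⟩)
  simp only [g] at h
  set v₁ := (r * ((q₁ : ℕ) : ZMod M)).val with hv₁
  set v₂ := (r * ((q₂ : ℕ) : ZMod M)).val with hv₂
  have e : r * ((q₂ - q₁ : ℕ) : ZMod M) = (v₂ : ZMod M) - v₁ := by
    rw [hv₁, hv₂, ZMod.natCast_zmod_val, ZMod.natCast_zmod_val, Nat.cast_sub hlt'.le]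
    ring
  rw [e]
  refine (norm_stdAddChar_sub_one_le v₂ v₁).trans ?_
  have hMr : (0 : ℝ) < M := Nat.cast_pos.mpr hM
  have hTr : (0 : ℝ) < T := Nat.cast_pos.mpr hT
  have hd : |(v₂ : ℝ) - v₁| * T ≤ M := by
    have a1 := Nat.div_add_mod (v₁ * T) M
    have a2 := Nat.div_add_mod (v₂ * T) M
    have b1 := Nat.mod_lt (v₁ * T) hM
    have b2 := Nat.mod_lt (v₂ * T) hM
    rw [h] at a1
    have c1 : v₁ * T ≤ v₂ * T + M := by omega
    have c2 : v₂ * T ≤ v₁ * T + M := by omega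
    have d1 : (v₁ : ℝ) * T ≤ v₂ * T + M := by exact_mod_cast c1
    have d2 : (v₂ : ℝ) * T ≤ v₁ * T + M := by exact_mod_cast c2
    rw [← abs_of_pos hTr, ← abs_mul, abs_le]
    constructor <;> linarith
  rw [div_le_div_iff₀ hMr hTr]
  nlinarith [Real.pi_pos]

/-- The average of `f` over `ℓ` consecutive translates by multiples of `q`. -/
noncomputable def progAvg (q ℓ : ℕ) (f : ZMod M → ℝ) (x : ZMod M) : ℝ :=
  (∑ j ∈ range ℓ, f (x + q * j)) / ℓ

lemma realDFT_progAvg (q ℓ : ℕ) (f : ZMod M → ℝ) (r : ZMod M) :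
    realDFT (progAvg q ℓ f) r =
      realDFT f r * ((∑ j ∈ range ℓ, (ZMod.stdAddChar (r * (q : ZMod M)) : ℂ) ^ j) / ℓ) := by
  have h : ∀ j : ℕ, ∑ x, (f (x + q * j) : ℂ) * ZMod.stdAddChar (-(r * x)) =
      realDFT f r * (ZMod.stdAddChar (r * (q : ZMod M)) : ℂ) ^ j := by
    intro j
    rw [realDFT, sum_mul]
    refine Fintype.sum_equiv (Equiv.addRight ((q : ZMod M) * j)) _ _ fun x => ?_
    rw [← AddChar.map_nsmul_eq_pow, mul_assoc, ← AddChar.map_add_eq_mul, Equiv.coe_addRight]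
    congr 2
    rw [nsmul_eq_mul]
    ring
  rw [mul_div_assoc', mul_sum, ← sum_congr rfl fun j _ => h j, sum_comm, realDFT, sum_div]
  refine sum_congr rfl fun x _ => ?_
  rw [progAvg]
  push_cast
  rw [← sum_mul, div_mul_eq_mul_div]

lemma norm_pow_sub_one_le {w : ℂ} (hw : ‖w‖ = 1) (j : ℕ) : ‖w ^ j - 1‖ ≤ j * ‖w - 1‖ := by
  rw [← geom_sum_mul, norm_mul]
  refine mul_le_mul_of_nonneg_right ((norm_sum_le _ _).trans ?_) (norm_nonneg _)
  simp [hw]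

lemma norm_realDFT_sub_progAvg_le (q ℓ : ℕ) (hℓ : 0 < ℓ) (f : ZMod M → ℝ) (r : ZMod M) :
    ‖realDFT (fun x => f x - progAvg q ℓ f x) r‖ ≤
      ‖realDFT f r‖ * min 2 (ℓ * ‖(ZMod.stdAddChar (r * (q : ZMod M)) : ℂ) - 1‖) := by
  have hℓ' : (0 : ℝ) < ℓ := Nat.cast_pos.mpr hℓ
  have hℓc : (ℓ : ℂ) ≠ 0 := Nat.cast_ne_zero.mpr hℓ.ne'
  set w : ℂ := ZMod.stdAddChar (r * (q : ZMod M)) with hw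
  have hw1 : ‖w‖ = 1 := AddChar.norm_apply _ _
  have e : realDFT (fun x => f x - progAvg q ℓ f x) r =
      realDFT f r * ((∑ j ∈ range ℓ, (1 - w ^ j)) / ℓ) := by
    have : realDFT (fun x => f x - progAvg q ℓ f x) r =
        realDFT f r - realDFT (progAvg q ℓ f) r := by
      simp only [realDFT, Complex.ofReal_sub, sub_mul, sum_sub_distrib]
    rw [this, realDFT_progAvg, ← hw, sum_sub_distrib]
    simp only [sum_const, card_range, nsmul_eq_mul, mul_one]
    field_simp
  rw [e, norm_mul]
  refine mul_le_mul_of_nonneg_left ?_ (norm_nonneg _)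
  rw [norm_div, Complex.norm_natCast, div_le_iff₀ hℓ']
  refine (norm_sum_le _ _).trans ?_
  calc ∑ j ∈ range ℓ, ‖1 - w ^ j‖ ≤ ∑ j ∈ range ℓ, min 2 (ℓ * ‖w - 1‖) := by
        refine sum_le_sum fun j hj => le_min ?_ ?_
        · refine (norm_sub_le _ _).trans (le_of_eq ?_)
          rw [norm_pow, hw1]; norm_num
        · rw [norm_sub_rev]
          refine (norm_pow_sub_one_le hw1 j).trans ?_
          have : (j : ℝ) ≤ ℓ := by exact_mod_cast (mem_range.mp hj).le
          gcongr
    _ = _ := by rw [sum_const, card_range, nsmul_eq_mul, mul_comm]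

/-- Two bounded functions are simultaneously indistinguishable, in the Fourier sense, from their
averages along a common progression of small difference. -/
theorem exists_progAvg_approx {F₁ F₂ : ZMod M → ℝ} (hF₁ : ∀ x, |F₁ x| ≤ 1)
    (hF₂ : ∀ x, |F₂ x| ≤ 1) {m ℓ : ℕ} (hm : 0 < m) (hℓ : 0 < ℓ) :
    ∃ q : ℕ, 1 ≤ q ∧ q ≤ (7 * ℓ * m) ^ (2 * m ^ 2) ∧
      ∀ a b : ZMod M → ℝ, (∀ x, |a x| ≤ 1) → (∀ x, |b x| ≤ 1) →
        |∑ z, ∑ x, a z * b x * (F₁ (z - x) - progAvg q ℓ F₁ (z - x))| ≤ 2 / m * M ^ 2 ∧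
        |∑ z, ∑ x, a z * b x * (F₂ (z - x) - progAvg q ℓ F₂ (z - x))| ≤ 2 / m * M ^ 2 := by
  have hM : (0 : ℝ) < M := Nat.cast_pos.mpr (NeZero.pos M)
  have hmr : (0 : ℝ) < m := Nat.cast_pos.mpr hm
  have hℓr : (0 : ℝ) < ℓ := Nat.cast_pos.mpr hℓ
  set Λ : (ZMod M → ℝ) → Finset (ZMod M) :=
    fun f => {r : ZMod M | (M : ℝ) ≤ m * ‖realDFT f r‖} with hΛ
  obtain ⟨q, hq1, hq2, hq⟩ := exists_nat_norm_stdAddChar_sub_one_le (Λ F₁ ∪ Λ F₂)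
    (T := 7 * ℓ * m) (by positivity)
  have hcard : #(Λ F₁ ∪ Λ F₂) ≤ 2 * m ^ 2 :=
    (card_union_le _ _).trans (by
      have h1 := card_large_spectrum_le hF₁ (m := m)
      have h2 := card_large_spectrum_le hF₂ (m := m)
      simp only [hΛ]
      omega)
  refine ⟨q, hq1, hq2.trans (Nat.pow_le_pow_right (by positivity) hcard), fun a b ha hb => ?_⟩
  have key : ∀ F : ZMod M → ℝ, (∀ x, |F x| ≤ 1) → Λ F ⊆ Λ F₁ ∪ Λ F₂ →
      |∑ z, ∑ x, a z * b x * (F (z - x) - progAvg q ℓ F (z - x))| ≤ 2 / m * M ^ 2 := by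
    intro F hF hsub
    refine (abs_sum_conv_le_of_norm_realDFT_le (f := fun x => F x - progAvg q ℓ F x)
      (B := 2 / m * M) ha hb fun r => ?_).trans (le_of_eq (by ring))
    refine (norm_realDFT_sub_progAvg_le q ℓ hℓ F r).trans ?_
    by_cases hr : r ∈ Λ F
    · have h1 := hq r (hsub hr)
      have h2 : ℓ * ‖(ZMod.stdAddChar (r * (q : ZMod M)) : ℂ) - 1‖ ≤ 1 / m := by
        calc _ ≤ ℓ * (2 * Real.pi / (7 * ℓ * m : ℕ)) := by gcongr
          _ = (2 * Real.pi / 7) * (1 / m) := by push_cast; field_simp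
          _ ≤ 1 * (1 / m) := by
              gcongr
              linarith [Real.pi_lt_d2]
          _ = _ := one_mul _
      calc _ ≤ (M : ℝ) * (1 / m) := mul_le_mul (norm_realDFT_le hF r)
            ((min_le_right _ _).trans h2) (by positivity) hM.le
        _ ≤ 2 / m * M := by
            have : 0 ≤ (M : ℝ) * (1 / m) := by positivity
            calc _ ≤ 2 * ((M : ℝ) * (1 / m)) := by linarith
              _ = _ := by ring
    · have h1 : m * ‖realDFT F r‖ < M := by simpa [hΛ] using hr
      have h2 : ‖realDFT F r‖ ≤ M / m := by rw [le_div_iff₀ hmr]; linarith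
      calc _ ≤ (M : ℝ) / m * 2 := mul_le_mul h2 (min_le_left _ _) (by positivity) (by positivity)
        _ = _ := by ring
  exact ⟨key F₁ hF₁ subset_union_left, key F₂ hF₂ subset_union_right⟩

end Fourier

section Regularity

lemma rpow_one_sub_le {u κ : ℝ} (hu : 0 ≤ u) (hκ : 0 < κ) (hκ' : κ ≤ 1 / 2) :
    u ^ (1 - κ) ≤ (1 - 2 * κ) * u + 2 * κ * √u := by
  have h := Real.geom_mean_le_arith_mean2_weighted (w₁ := 1 - 2 * κ) (w₂ := 2 * κ) (p₁ := u)
    (p₂ := √u) (by linarith) (by linarith) hu (Real.sqrt_nonneg u) (by ring)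
  refine le_trans (le_of_eq ?_) h
  rcases hu.eq_or_lt with rfl | hu
  · rw [Real.sqrt_zero, Real.zero_rpow (by linarith), Real.zero_rpow (x := 2 * κ) (by linarith),
      mul_zero]
  · rw [Real.sqrt_eq_rpow, ← Real.rpow_mul hu.le, ← Real.rpow_add hu]
    congr 1
    ring

variable {G : Type*} [Fintype G]

lemma sum_sqrt_mul_le {u I : G → ℝ} {L : ℝ} (hu : ∀ x, 0 ≤ u x) (hI : ∀ x, I x = 0 ∨ I x = 1)
    (hL : 0 ≤ L) (hsu : ∑ x, u x = L) (hsI : ∑ x, I x = L) : ∑ x, √(u x) * I x ≤ L := by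
  have h : (∑ x, √(u x) * I x) ^ 2 ≤ L * L := by
    calc _ ≤ (∑ x, √(u x) ^ 2) * ∑ x, I x ^ 2 := sum_mul_sq_le_sq_mul_sq _ _ _
      _ = L * L := by
        congr 1
        · rw [← hsu]
          exact sum_congr rfl fun x _ => Real.sq_sqrt (hu x)
        · rw [← hsI]
          exact sum_congr rfl fun x _ => by rcases hI x with h | h <;> simp [h]
  exact abs_le_of_sq_le_sq' (by linarith [sq L]) hL |>.2

lemma sum_rpow_le {u I : G → ℝ} {L κ η : ℝ} (hu : ∀ x, 0 ≤ u x) (hI : ∀ x, I x = 0 ∨ I x = 1)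
    (hL : 0 ≤ L) (hsu : ∑ x, u x = L) (hsI : ∑ x, I x = L)
    (hout : ∑ x, √(u x) * (1 - I x) ≤ η * L) (hη : 0 ≤ η) (hκ : 0 < κ) (hκ' : κ ≤ 1 / 2) :
    ∑ x, u x ^ (1 - κ) ≤ (1 - 2 * κ) * L + 2 * κ * ((∑ x, √(u x) * I x) + η * L) ∧
      ∑ x, u x ^ (1 - κ) ≤ (1 + η) * L := by
  have h1 : ∑ x, u x ^ (1 - κ) ≤ (1 - 2 * κ) * L + 2 * κ * ∑ x, √(u x) := by
    rw [← hsu, mul_sum, mul_sum, ← sum_add_distrib]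
    exact sum_le_sum fun x _ => rpow_one_sub_le (hu x) hκ hκ'
  have h2 : ∑ x, √(u x) = ∑ x, √(u x) * I x + ∑ x, √(u x) * (1 - I x) := by
    rw [← sum_add_distrib]
    exact sum_congr rfl fun x _ => by ring
  have h3 := sum_sqrt_mul_le hu hI hL hsu hsI
  have h4 : ∑ x, u x ^ (1 - κ) ≤
      (1 - 2 * κ) * L + 2 * κ * ((∑ x, √(u x) * I x) + η * L) := by
    refine h1.trans ?_
    rw [h2]
    gcongr
  refine ⟨h4, h4.trans ?_⟩
  have h5 : 2 * κ * ((∑ x, √(u x) * I x) + η * L) ≤ 2 * κ * (L + η * L) := by gcongr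
  have h6 : 0 ≤ η * L := mul_nonneg hη hL
  nlinarith

/-- If the `1 - κ` moments of two densities are nearly maximal, then the first density is close
in `L¹` to the indicator function of the interval. -/
theorem sum_abs_sub_le_of_moments {u₁ u₂ I : G → ℝ} {L κ ω : ℝ} (hu₁ : ∀ x, 0 ≤ u₁ x)
    (hu₂ : ∀ x, 0 ≤ u₂ x) (hI : ∀ x, I x = 0 ∨ I x = 1) (hL : 0 < L) (hsu₁ : ∑ x, u₁ x = L)
    (hsu₂ : ∑ x, u₂ x = L) (hsI : ∑ x, I x = L) (hκ : 0 < κ) (hκ' : κ ≤ 1 / 2) (hω : 0 ≤ ω)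
    (hout₁ : ∑ x, √(u₁ x) * (1 - I x) ≤ κ * ω ^ 2 * L)
    (hout₂ : ∑ x, √(u₂ x) * (1 - I x) ≤ κ * ω ^ 2 * L)
    (h : L ^ 2 ≤ (1 + κ * ω ^ 2) * ((∑ x, u₁ x ^ (1 - κ)) * ∑ x, u₂ x ^ (1 - κ))) :
    ∑ x, |u₁ x - I x| ≤ 4 * ω * L := by
  set η := κ * ω ^ 2 with hη
  have hη0 : 0 ≤ η := by positivity
  obtain ⟨a1, -⟩ := sum_rpow_le hu₁ hI hL.le hsu₁ hsI hout₁ hη0 hκ hκ'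
  obtain ⟨-, a2⟩ := sum_rpow_le hu₂ hI hL.le hsu₂ hsI hout₂ hη0 hκ hκ'
  set U₁ := ∑ x, u₁ x ^ (1 - κ)
  set U₂ := ∑ x, u₂ x ^ (1 - κ)
  set S := ∑ x, √(u₁ x) * I x with hS
  have hU₁0 : 0 ≤ U₁ := sum_nonneg fun x _ => Real.rpow_nonneg (hu₁ x) _
  have b1 : L ≤ (1 + η) ^ 2 * U₁ := by
    have : L * L ≤ ((1 + η) ^ 2 * U₁) * L := by
      calc L * L = L ^ 2 := by ring
        _ ≤ (1 + η) * (U₁ * U₂) := h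
        _ ≤ (1 + η) * (U₁ * ((1 + η) * L)) := by gcongr
        _ = _ := by ring
    exact le_of_mul_le_mul_right this hL
  have b2 : (1 - 2 * η) * L ≤ U₁ := by
    have h1 : (1 - 2 * η) * (1 + η) ^ 2 ≤ 1 := by nlinarith [mul_nonneg hη0 (sq_nonneg η)]
    rcases le_total (1 - 2 * η) 0 with h0 | h0
    · nlinarith
    · calc (1 - 2 * η) * L ≤ (1 - 2 * η) * ((1 + η) ^ 2 * U₁) := by gcongr
        _ = ((1 - 2 * η) * (1 + η) ^ 2) * U₁ := by ring
        _ ≤ 1 * U₁ := by gcongr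
        _ = U₁ := one_mul _
  have b3 : L - ω ^ 2 * L - η * L ≤ S := by
    have : 2 * κ * (L - ω ^ 2 * L - η * L) ≤ 2 * κ * S := by
      have e : 2 * κ * (ω ^ 2 * L) = 2 * η * L := by rw [hη]; ring
      nlinarith
    exact le_of_mul_le_mul_left this (by linarith)
  have hηω : η ≤ ω ^ 2 := by rw [hη]; nlinarith [sq_nonneg ω]
  have hsq1 : ∑ x, (√(u₁ x) - I x) ^ 2 ≤ 4 * ω ^ 2 * L := by
    have : ∑ x, (√(u₁ x) - I x) ^ 2 = L - 2 * S + L := by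
      nth_rewrite 1 [← hsu₁]
      nth_rewrite 1 [← hsI]
      rw [hS, mul_sum, ← sum_sub_distrib, ← sum_add_distrib]
      refine sum_congr rfl fun x _ => ?_
      have h1 := Real.sq_sqrt (hu₁ x)
      have h2 : I x ^ 2 = I x := by rcases hI x with h | h <;> simp [h]
      linear_combination h1 + h2
    rw [this]
    nlinarith
  have hsq2 : ∑ x, (√(u₁ x) + I x) ^ 2 ≤ 4 * L := by
    calc _ ≤ ∑ x, (2 * u₁ x + 2 * I x) := sum_le_sum fun x _ => by
          have h1 := Real.sq_sqrt (hu₁ x)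
          have h2 : I x ^ 2 = I x := by rcases hI x with h | h <;> simp [h]
          nlinarith [sq_nonneg (√(u₁ x) - I x)]
      _ = 4 * L := by rw [sum_add_distrib, ← mul_sum, ← mul_sum, hsu₁, hsI]; ring
  have hfin : (∑ x, |u₁ x - I x|) ^ 2 ≤ (4 * ω * L) ^ 2 := by
    calc (∑ x, |u₁ x - I x|) ^ 2 = (∑ x, |√(u₁ x) - I x| * (√(u₁ x) + I x)) ^ 2 := by
          congr 1
          refine sum_congr rfl fun x _ => ?_
          have h1 := Real.sq_sqrt (hu₁ x)
          have h2 : I x ^ 2 = I x := by rcases hI x with h | h <;> simp [h]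
          have h3 : 0 ≤ I x := by rcases hI x with h | h <;> simp [h]
          rw [← abs_of_nonneg (add_nonneg (Real.sqrt_nonneg (u₁ x)) h3), ← abs_mul]
          congr 1
          linear_combination h2 - h1
      _ ≤ (∑ x, |√(u₁ x) - I x| ^ 2) * ∑ x, (√(u₁ x) + I x) ^ 2 :=
          sum_mul_sq_le_sq_mul_sq _ _ _
      _ ≤ (4 * ω ^ 2 * L) * (4 * L) := by
          simp only [sq_abs]
          gcongr
      _ = _ := by ring
  exact (abs_le_of_sq_le_sq' hfin (by positivity)).2

end Regularity

/-- A set of lattice points without axis-parallel corners. -/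
def CornerFree (A : Finset (ℤ × ℤ)) : Prop :=
  ∀ a b d : ℤ, d ≠ 0 → (a, b) ∈ A → (a + d, b) ∈ A → (a, b + d) ∉ A

/-- A corner-free subset of a product set inside `[L] × [L]`. -/
structure IsConfig (L : ℕ) (A : Finset (ℤ × ℤ)) (F₁ F₂ : Finset ℤ) : Prop where
  sub₁ : F₁ ⊆ Ico 0 (L : ℤ)
  sub₂ : F₂ ⊆ Ico 0 (L : ℤ)
  sub : A ⊆ F₁ ×ˢ F₂
  cornerFree : CornerFree A

/-- There is a nonempty configuration of scale `L` whose relative density increment is at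
least `φ`. -/
def HasDensity (κ : ℝ) (L : ℕ) (φ : ℝ) : Prop :=
  ∃ A F₁ F₂, IsConfig L A F₁ F₂ ∧ A.Nonempty ∧
    φ * ((#F₁ : ℝ) * #F₂ / L ^ 2) ^ (1 - κ) * L ^ 2 ≤ #A

/-- All configurations of scale `L` have relative density increment at most `φ`. -/
def DensityAtMost (κ : ℝ) (L : ℕ) (φ : ℝ) : Prop :=
  ∀ A F₁ F₂, IsConfig L A F₁ F₂ → (#A : ℝ) ≤ φ * ((#F₁ : ℝ) * #F₂ / L ^ 2) ^ (1 - κ) * L ^ 2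

lemma densityAtMost_of_not_hasDensity {κ φ : ℝ} {L : ℕ} (hφ : 0 ≤ φ) (h : ¬ HasDensity κ L φ) :
    DensityAtMost κ L φ := by
  intro A F₁ F₂ hA
  rcases A.eq_empty_or_nonempty with rfl | hne
  · simp only [card_empty, Nat.cast_zero]
    positivity
  · by_contra! hlt
    exact h ⟨A, F₁, F₂, hA, hne, hlt.le⟩

lemma CornerFree.subset {A B : Finset (ℤ × ℤ)} (hB : CornerFree B) (h : A ⊆ B) : CornerFree A :=
  fun a b d hd h1 h2 h3 => hB a b d hd (h h1) (h h2) (h h3)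

section Rectangles

variable {L : ℕ} {A : Finset (ℤ × ℤ)} {F₁ F₂ : Finset ℤ} {κ η φ : ℝ}

lemma IsConfig.card_inter_le (hA : IsConfig L A F₁ F₂) (hκ : 0 < κ) (hκ' : κ ≤ 1 / 2)
    (hη : 0 ≤ η) (hηκ : η ≤ κ) (hN : 0 < (#F₁ : ℝ) * #F₂)
    (hφ : φ * ((#F₁ : ℝ) * #F₂ / L ^ 2) ^ (1 - κ) * L ^ 2 ≤ #A)
    (hmax : DensityAtMost κ L ((1 + η) * φ)) {X Y : Finset ℤ} (hX : X ⊆ F₁) (hY : Y ⊆ F₂) :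
    (#(A ∩ X ×ˢ Y) : ℝ) - #A * ((#X : ℝ) * #Y / (#F₁ * #F₂)) ≤ 3 * κ * #A := by
  have hconf : IsConfig L (A ∩ X ×ˢ Y) X Y :=
    ⟨hX.trans hA.sub₁, hY.trans hA.sub₂, inter_subset_right,
      hA.cornerFree.subset inter_subset_left⟩
  have h := hmax _ _ _ hconf
  set θ : ℝ := (#X : ℝ) * #Y / (#F₁ * #F₂) with hθ
  have hθ0 : 0 ≤ θ := by positivity
  have hθ1 : θ ≤ 1 := by
    rw [hθ, div_le_one hN]
    have h1 : (#X : ℝ) ≤ #F₁ := by exact_mod_cast card_le_card hX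
    have h2 : (#Y : ℝ) ≤ #F₂ := by exact_mod_cast card_le_card hY
    gcongr
  have e : (#X : ℝ) * #Y / L ^ 2 = θ * (#F₁ * #F₂ / L ^ 2) := by
    rw [hθ, ← mul_div_assoc, div_mul_cancel₀ _ hN.ne']
  have hpow : θ ^ (1 - κ) ≤ (1 - κ) * θ + κ := by
    have := Real.geom_mean_le_arith_mean2_weighted (w₁ := 1 - κ) (w₂ := κ) (p₁ := θ)
      (p₂ := 1) (by linarith) hκ.le hθ0 zero_le_one (by ring)
    simpa using this
  have hpow0 : 0 ≤ θ ^ (1 - κ) := Real.rpow_nonneg hθ0 _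
  have hn : (0 : ℝ) ≤ #A := Nat.cast_nonneg _
  rw [e, Real.mul_rpow hθ0 (by positivity)] at h
  have h2 : (#(A ∩ X ×ˢ Y) : ℝ) ≤ (1 + η) * ((1 - κ) * θ + κ) * #A := by
    calc _ ≤ (1 + η) * θ ^ (1 - κ) *
          (φ * ((#F₁ : ℝ) * #F₂ / L ^ 2) ^ (1 - κ) * L ^ 2) := h.trans (le_of_eq (by ring))
      _ ≤ (1 + η) * θ ^ (1 - κ) * #A := by gcongr
      _ ≤ _ := by gcongr
  have h3 : (1 + η) * ((1 - κ) * θ + κ) - θ ≤ 3 * κ := by nlinarith [mul_nonneg hη hθ0]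
  have h4 := mul_le_mul_of_nonneg_right h3 hn
  linarith

lemma IsConfig.abs_card_inter_sub_le (hA : IsConfig L A F₁ F₂) (hκ : 0 < κ) (hκ' : κ ≤ 1 / 2)
    (hη : 0 ≤ η) (hηκ : η ≤ κ) (hN : 0 < (#F₁ : ℝ) * #F₂)
    (hφ : φ * ((#F₁ : ℝ) * #F₂ / L ^ 2) ^ (1 - κ) * L ^ 2 ≤ #A)
    (hmax : DensityAtMost κ L ((1 + η) * φ)) {X Y : Finset ℤ} (hX : X ⊆ F₁) (hY : Y ⊆ F₂) :
    |(#(A ∩ X ×ˢ Y) : ℝ) - #A * ((#X : ℝ) * #Y / (#F₁ * #F₂))| ≤ 6 * κ * #A := by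
  have h1 := hA.card_inter_le hκ hκ' hη hηκ hN hφ hmax hX hY
  have h2 := hA.card_inter_le hκ hκ' hη hηκ hN hφ hmax (sdiff_subset : F₁ \ X ⊆ F₁) subset_rfl
  have h3 := hA.card_inter_le hκ hκ' hη hηκ hN hφ hmax hX (sdiff_subset : F₂ \ Y ⊆ F₂)
  have hc : (#A : ℝ) = #(A ∩ X ×ˢ Y) + #(A ∩ (F₁ \ X) ×ˢ F₂) + #(A ∩ X ×ˢ (F₂ \ Y)) := by
    have hsplit : A = (A ∩ X ×ˢ Y ∪ A ∩ (F₁ \ X) ×ˢ F₂) ∪ A ∩ X ×ˢ (F₂ \ Y) := by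
      ext ⟨a, b⟩
      have := @hA.sub (a, b)
      simp only [mem_union, mem_inter, mem_product, mem_sdiff] at this ⊢
      tauto
    have d1 : Disjoint (A ∩ X ×ˢ Y) (A ∩ (F₁ \ X) ×ˢ F₂) := by
      rw [Finset.disjoint_left]
      rintro ⟨a, b⟩
      simp only [mem_inter, mem_product, mem_sdiff]
      tauto
    have d2 : Disjoint (A ∩ X ×ˢ Y ∪ A ∩ (F₁ \ X) ×ˢ F₂) (A ∩ X ×ˢ (F₂ \ Y)) := by
      rw [Finset.disjoint_left]
      rintro ⟨a, b⟩
      simp only [mem_union, mem_inter, mem_product, mem_sdiff]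
      tauto
    nth_rewrite 1 [hsplit]
    rw [card_union_of_disjoint d2, card_union_of_disjoint d1]
    push_cast
    ring
  have c1 : (#(F₁ \ X) : ℝ) = #F₁ - #X := by
    rw [card_sdiff_of_subset hX, Nat.cast_sub (card_le_card hX)]
  have c2 : (#(F₂ \ Y) : ℝ) = #F₂ - #Y := by
    rw [card_sdiff_of_subset hY, Nat.cast_sub (card_le_card hY)]
  rw [c1] at h2
  rw [c2] at h3
  have e : (#A : ℝ) * ((#X : ℝ) * #Y / (#F₁ * #F₂)) +
      #A * ((#F₁ - #X : ℝ) * #F₂ / (#F₁ * #F₂)) +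
      #A * ((#X : ℝ) * (#F₂ - #Y) / (#F₁ * #F₂)) = #A := by
    rw [← mul_add, ← mul_add, ← add_div, ← add_div]
    have : (#X : ℝ) * #Y + (#F₁ - #X) * #F₂ + #X * (#F₂ - #Y) = #F₁ * #F₂ := by ring
    rw [this, div_self hN.ne', mul_one]
  have hn : 0 ≤ κ * #A := by positivity
  rw [abs_le]
  constructor <;> linarith

end Rectangles

section Transfer

variable {L : ℕ} [NeZero L]

/-- The indicator function of a set of integers, on `ZMod (2 * L)`. -/
noncomputable def zmodInd (S : Finset ℤ) (x : ZMod (2 * L)) : ℝ :=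
  if (x.val : ℤ) ∈ S then 1 else 0

/-- The indicator function of a set of lattice points, on `ZMod (2 * L)` squared. -/
noncomputable def zmodInd₂ (S : Finset (ℤ × ℤ)) (x y : ZMod (2 * L)) : ℝ :=
  if ((x.val : ℤ), (y.val : ℤ)) ∈ S then 1 else 0

omit [NeZero L] in
lemma zmodInd_mem (S : Finset ℤ) (x : ZMod (2 * L)) : zmodInd S x = 0 ∨ zmodInd S x = 1 := by
  unfold zmodInd; split_ifs <;> simp

omit [NeZero L] in
lemma zmodInd₂_mem (S : Finset (ℤ × ℤ)) (x y : ZMod (2 * L)) :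
    zmodInd₂ S x y = 0 ∨ zmodInd₂ S x y = 1 := by
  unfold zmodInd₂; split_ifs <;> simp

lemma sum_val_zmod (f : ℤ → ℝ) :
    ∑ x : ZMod (2 * L), f x.val = ∑ i ∈ Ico (0 : ℤ) (2 * L : ℕ), f i := by
  refine sum_nbij' (fun x => (x.val : ℤ)) (fun i => (i : ZMod (2 * L))) ?_ ?_ ?_ ?_ ?_
  · intro x _
    have := ZMod.val_lt x
    simp only [mem_Ico]
    omega
  · simp
  · intro x _
    simp
  · intro i hi
    rw [mem_Ico] at hi
    rw [ZMod.val_intCast, Int.emod_eq_of_lt hi.1 hi.2]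
  · simp

lemma sum_zmodInd {S : Finset ℤ} (hS : S ⊆ Ico 0 (L : ℤ)) :
    ∑ x : ZMod (2 * L), zmodInd S x = #S := by
  unfold zmodInd
  rw [sum_val_zmod (fun i => if i ∈ S then (1 : ℝ) else 0)]
  simp only [sum_boole, Nat.cast_inj]
  congr 1
  ext i
  have := @hS i
  simp only [mem_Ico, mem_filter] at this ⊢
  constructor
  · exact fun h => h.2
  · intro h
    have := this h
    refine ⟨⟨this.1, ?_⟩, h⟩
    push_cast
    omega

lemma sum_zmodInd₂ {A : Finset (ℤ × ℤ)} (hA : A ⊆ Ico 0 (L : ℤ) ×ˢ Ico 0 (L : ℤ)) :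
    ∑ x : ZMod (2 * L), ∑ y : ZMod (2 * L), zmodInd₂ A x y = #A := by
  unfold zmodInd₂
  have h : ∀ x : ZMod (2 * L), ∑ y : ZMod (2 * L),
      (if ((x.val : ℤ), (y.val : ℤ)) ∈ A then (1 : ℝ) else 0) =
      ∑ j ∈ Ico (0 : ℤ) (2 * L : ℕ), if ((x.val : ℤ), j) ∈ A then (1 : ℝ) else 0 :=
    fun x => sum_val_zmod (fun j => if ((x.val : ℤ), j) ∈ A then (1 : ℝ) else 0)
  rw [sum_congr rfl fun x _ => h x]
  rw [sum_val_zmod (fun i => ∑ j ∈ Ico (0 : ℤ) (2 * L : ℕ),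
    if (i, j) ∈ A then (1 : ℝ) else 0), ← sum_product']
  simp only [sum_boole, Nat.cast_inj]
  congr 1
  ext ⟨i, j⟩
  have := @hA (i, j)
  simp only [mem_Ico, mem_filter, mem_product] at this ⊢
  constructor
  · exact fun h => h.2
  · intro h
    have := this h
    refine ⟨⟨⟨this.1.1, ?_⟩, ⟨this.2.1, ?_⟩⟩, h⟩ <;> push_cast <;> omega

lemma val_intCast_eq {x : ℤ} (h1 : -(L : ℤ) ≤ x) (h2 : x < 2 * L) :
    ((x : ZMod (2 * L)).val : ℤ) = x ∨
      x < 0 ∧ (L : ℤ) ≤ ((x : ZMod (2 * L)).val : ℤ) := by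
  rw [ZMod.val_intCast]
  rcases le_or_gt 0 x with h | h
  · left
    exact Int.emod_eq_of_lt h (by push_cast; omega)
  · right
    refine ⟨h, ?_⟩
    rw [← Int.add_emod_right, Int.emod_eq_of_lt] <;> push_cast <;> omega

lemma zmodInd_intCast {S : Finset ℤ} (hS : S ⊆ Ico 0 (L : ℤ)) {x : ℤ} (h1 : -(L : ℤ) ≤ x)
    (h2 : x < 2 * L) : zmodInd S (x : ZMod (2 * L)) = if x ∈ S then 1 else 0 := by
  unfold zmodInd
  rcases val_intCast_eq h1 h2 with h | ⟨h, h'⟩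
  · rw [h]
  · rw [if_neg, if_neg]
    · intro hx
      have := mem_Ico.mp (hS hx)
      omega
    · intro hx
      have := mem_Ico.mp (hS hx)
      omega

lemma zmodInd₂_intCast {A : Finset (ℤ × ℤ)} (hA : A ⊆ Ico 0 (L : ℤ) ×ˢ Ico 0 (L : ℤ)) {x y : ℤ}
    (h1 : -(L : ℤ) ≤ x) (h2 : x < 2 * L) (h3 : -(L : ℤ) ≤ y) (h4 : y < 2 * L) :
    zmodInd₂ A (x : ZMod (2 * L)) (y : ZMod (2 * L)) =
      if (x, y) ∈ A then 1 else 0 := by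
  unfold zmodInd₂
  have key : ∀ {a b : ℤ}, (a, b) ∈ A → (0 ≤ a ∧ a < L) ∧ 0 ≤ b ∧ b < L := fun h => by
    simpa using hA h
  rcases val_intCast_eq h1 h2 with h | ⟨h, h'⟩
  · rcases val_intCast_eq h3 h4 with k | ⟨k, k'⟩
    · rw [h, k]
    · rw [if_neg, if_neg]
      · intro hx
        have := key hx
        omega
      · intro hx
        have := key hx
        omega
  · rw [if_neg, if_neg]
    · intro hx
      have := key hx
      omega
    · intro hx
      have := key hx
      omega

end Transfer

section Progressions

variable {L : ℕ} [NeZero L]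

lemma sum_range_intCast (f : ℤ → ℝ) (n : ℕ) :
    ∑ j ∈ range n, f j = ∑ i ∈ Ico (0 : ℤ) n, f i := by
  refine sum_nbij' (fun j => (j : ℤ)) (fun i => i.toNat) ?_ ?_ ?_ ?_ ?_
  · intro j hj
    simpa using hj
  · intro i hi
    simp only [mem_Ico, mem_range] at hi ⊢
    omega
  · simp
  · intro i hi
    simp only [mem_Ico] at hi
    omega
  · simp

omit [NeZero L] in
lemma add_mul_eq_intCast_valMinAbs (s : ZMod (2 * L)) (q j : ℕ) :
    s + q * j = ((s.valMinAbs + q * (j : ℤ) : ℤ) : ZMod (2 * L)) := by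
  simp

lemma valMinAbs_add_mul_bounds (s : ZMod (2 * L)) {q ℓ j : ℕ} (hq : 1 ≤ q) (hqℓ : q * ℓ ≤ L)
    (hj : j < ℓ) : -(L : ℤ) ≤ s.valMinAbs + q * (j : ℤ) ∧ s.valMinAbs + q * (j : ℤ) < 2 * L := by
  have h := s.valMinAbs_mem_Ioc
  rw [Set.mem_Ioc] at h
  push_cast at h
  have h1 : q * j + 1 ≤ L := by nlinarith
  have h2 : (q : ℤ) * j + 1 ≤ L := by exact_mod_cast h1
  have h3 : (0 : ℤ) ≤ (q : ℤ) * j := by positivity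
  constructor <;> linarith

lemma progAvg_zmodInd {F : Finset ℤ} (hF : F ⊆ Ico 0 (L : ℤ)) {q ℓ : ℕ} (hq : 1 ≤ q)
    (hqℓ : q * ℓ ≤ L) (s : ZMod (2 * L)) :
    progAvg q ℓ (zmodInd F) s =
      #{j ∈ Ico (0 : ℤ) ℓ | s.valMinAbs + q * j ∈ F} / (ℓ : ℝ) := by
  unfold progAvg
  congr 1
  rw [← sum_boole, ← sum_range_intCast]
  refine sum_congr rfl fun j hj => ?_
  have hb := valMinAbs_add_mul_bounds s hq hqℓ (mem_range.mp hj)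
  rw [add_mul_eq_intCast_valMinAbs, zmodInd_intCast hF hb.1 hb.2]

lemma DensityAtMost.sum_progression_le {A : Finset (ℤ × ℤ)} {F₁ F₂ : Finset ℤ}
    (hA : IsConfig L A F₁ F₂) {q ℓ : ℕ} (hq : 1 ≤ q) (hqℓ : q * ℓ ≤ L) {κ φ : ℝ}
    (hmax : DensityAtMost κ ℓ φ) (s t : ZMod (2 * L)) :
    ∑ j ∈ range ℓ, ∑ k ∈ range ℓ, zmodInd₂ (L := L) A (s + q * j) (t + q * k) ≤
      φ * (progAvg q ℓ (zmodInd F₁) s * progAvg q ℓ (zmodInd F₂) t) ^ (1 - κ) * ℓ ^ 2 := by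
  have hAI : A ⊆ Ico 0 (L : ℤ) ×ˢ Ico 0 (L : ℤ) :=
    hA.sub.trans (product_subset_product hA.sub₁ hA.sub₂)
  set A' := {p ∈ Ico (0 : ℤ) ℓ ×ˢ Ico (0 : ℤ) ℓ |
    (s.valMinAbs + q * p.1, t.valMinAbs + q * p.2) ∈ A} with hA'
  have hconf : IsConfig ℓ A' {j ∈ Ico (0 : ℤ) ℓ | s.valMinAbs + q * j ∈ F₁}
      {j ∈ Ico (0 : ℤ) ℓ | t.valMinAbs + q * j ∈ F₂} := by
    refine ⟨filter_subset _ _, filter_subset _ _, ?_, ?_⟩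
    · rintro ⟨a, b⟩ h
      simp only [hA', mem_filter, mem_product] at h ⊢
      have := mem_product.mp (hA.sub h.2)
      exact ⟨⟨h.1.1, this.1⟩, h.1.2, this.2⟩
    · intro a b d hd h1 h2 h3
      simp only [hA', mem_filter] at h1 h2 h3
      refine hA.cornerFree _ _ (q * d) ?_ h1.2 ?_ ?_
      · have : (q : ℤ) ≠ 0 := by exact_mod_cast (by omega : q ≠ 0)
        positivity
      · convert h2.2 using 2
        ring
      · convert h3.2 using 2
        ring
  have h := hmax _ _ _ hconf
  have e : ∑ j ∈ range ℓ, ∑ k ∈ range ℓ, zmodInd₂ (L := L) A (s + q * j) (t + q * k) = #A' := by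
    rw [hA', ← sum_boole, sum_product]
    rw [← sum_range_intCast (fun i => ∑ j ∈ Ico (0 : ℤ) ℓ,
      if (s.valMinAbs + q * i, t.valMinAbs + q * j) ∈ A then (1 : ℝ) else 0)]
    refine sum_congr rfl fun j hj => ?_
    rw [← sum_range_intCast (fun i =>
      if (s.valMinAbs + q * (j : ℤ), t.valMinAbs + q * i) ∈ A then (1 : ℝ) else 0)]
    refine sum_congr rfl fun k hk => ?_
    have hb := valMinAbs_add_mul_bounds s hq hqℓ (mem_range.mp hj)
    have hc := valMinAbs_add_mul_bounds t hq hqℓ (mem_range.mp hk)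
    rw [add_mul_eq_intCast_valMinAbs, add_mul_eq_intCast_valMinAbs,
      zmodInd₂_intCast hAI hb.1 hb.2 hc.1 hc.2]
  rw [e, progAvg_zmodInd hA.sub₁ hq hqℓ, progAvg_zmodInd hA.sub₂ hq hqℓ, div_mul_div_comm, ← sq]
  exact h

lemma progAvg_nonneg {M : ℕ} {f : ZMod M → ℝ} (hf : ∀ x, 0 ≤ f x) (q ℓ : ℕ) (x : ZMod M) :
    0 ≤ progAvg q ℓ f x :=
  div_nonneg (sum_nonneg fun _ _ => hf _) (Nat.cast_nonneg _)

lemma sum_progAvg {M : ℕ} [NeZero M] (f : ZMod M → ℝ) (q : ℕ) {ℓ : ℕ} (hℓ : 0 < ℓ) :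
    ∑ x, progAvg q ℓ f x = ∑ x, f x := by
  unfold progAvg
  rw [← sum_div, sum_comm]
  have h : ∀ j ∈ range ℓ, ∑ x, f (x + q * j) = ∑ x, f x :=
    fun j _ => Equiv.sum_comp (Equiv.addRight ((q : ZMod M) * j)) f
  rw [sum_congr rfl h, sum_const, card_range, nsmul_eq_mul]
  field_simp

omit [NeZero L] in
lemma zmodInd_nonneg (S : Finset ℤ) (x : ZMod (2 * L)) : 0 ≤ zmodInd S x := by
  rcases zmodInd_mem S x with h | h <;> simp [h]

lemma sum_sum_sum_sum_comm {α β γ δ : Type*} (s : Finset α) (t : Finset β) (u : Finset γ)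
    (v : Finset δ) (f : α → β → γ → δ → ℝ) :
    ∑ a ∈ s, ∑ b ∈ t, ∑ c ∈ u, ∑ d ∈ v, f a b c d =
      ∑ c ∈ u, ∑ d ∈ v, ∑ a ∈ s, ∑ b ∈ t, f a b c d := by
  calc _ = ∑ a ∈ s, ∑ c ∈ u, ∑ b ∈ t, ∑ d ∈ v, f a b c d := sum_congr rfl fun _ _ => sum_comm
    _ = ∑ c ∈ u, ∑ a ∈ s, ∑ d ∈ v, ∑ b ∈ t, f a b c d := by
      rw [sum_comm]
      exact sum_congr rfl fun _ _ => sum_congr rfl fun _ _ => sum_comm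
    _ = _ := sum_congr rfl fun _ _ => sum_comm

lemma DensityAtMost.card_le {A : Finset (ℤ × ℤ)} {F₁ F₂ : Finset ℤ}
    (hA : IsConfig L A F₁ F₂) {q ℓ : ℕ} (hq : 1 ≤ q) (hℓ : 0 < ℓ) (hqℓ : q * ℓ ≤ L) {κ φ : ℝ}
    (hmax : DensityAtMost κ ℓ φ) :
    (#A : ℝ) ≤ φ * ((∑ s : ZMod (2 * L), progAvg q ℓ (zmodInd F₁) s ^ (1 - κ)) *
      ∑ t : ZMod (2 * L), progAvg q ℓ (zmodInd F₂) t ^ (1 - κ)) := by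
  have hAI : A ⊆ Ico 0 (L : ℤ) ×ˢ Ico 0 (L : ℤ) :=
    hA.sub.trans (product_subset_product hA.sub₁ hA.sub₂)
  have hshift : ∀ j k : ℕ, ∑ s : ZMod (2 * L), ∑ t : ZMod (2 * L),
      zmodInd₂ (L := L) A (s + q * j) (t + q * k) = #A := by
    intro j k
    rw [← sum_zmodInd₂ hAI]
    rw [← Equiv.sum_comp (Equiv.addRight ((q : ZMod (2 * L)) * j))
      fun x => ∑ y, zmodInd₂ (L := L) A x y]
    exact sum_congr rfl fun s _ => Equiv.sum_comp (Equiv.addRight ((q : ZMod (2 * L)) * k))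
      fun y => zmodInd₂ (L := L) A (s + q * j) y
  have h1 : (ℓ : ℝ) ^ 2 * #A = ∑ s : ZMod (2 * L), ∑ t : ZMod (2 * L),
      ∑ j ∈ range ℓ, ∑ k ∈ range ℓ, zmodInd₂ (L := L) A (s + q * j) (t + q * k) := by
    rw [sum_sum_sum_sum_comm]
    simp only [hshift, sum_const, card_range, nsmul_eq_mul]
    ring
  have h2 : (ℓ : ℝ) ^ 2 * #A ≤ (ℓ : ℝ) ^ 2 * (φ *
      ((∑ s : ZMod (2 * L), progAvg q ℓ (zmodInd F₁) s ^ (1 - κ)) *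
        ∑ t : ZMod (2 * L), progAvg q ℓ (zmodInd F₂) t ^ (1 - κ))) := by
    rw [h1, sum_mul_sum, mul_sum, mul_sum]
    refine sum_le_sum fun s _ => ?_
    rw [mul_sum, mul_sum]
    refine sum_le_sum fun t _ => (hmax.sum_progression_le hA hq hqℓ s t).trans (le_of_eq ?_)
    rw [Real.mul_rpow (progAvg_nonneg (zmodInd_nonneg F₁) _ _ _)
      (progAvg_nonneg (zmodInd_nonneg F₂) _ _ _)]
    ring
  exact le_of_mul_le_mul_left h2 (by positivity)

end Progressions

section OutsideCounting

variable {L : ℕ} [NeZero L]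

lemma sum_sqrt_progAvg_outside_le {F : Finset ℤ} (hF : F ⊆ Ico 0 (L : ℤ)) {q ℓ : ℕ} (hq : 1 ≤ q)
    (hqℓ : q * ℓ ≤ L) {β : ℝ} (hβ : 0 < β) (hβ' : β ≤ 1) :
    ∑ x : ZMod (2 * L), √(progAvg q ℓ (zmodInd F) x / β) * (1 - zmodInd (Ico 0 (L : ℤ)) x) ≤
      q * ℓ / β := by
  have hpt : ∀ x : ZMod (2 * L),
      √(progAvg q ℓ (zmodInd F) x / β) * (1 - zmodInd (Ico 0 (L : ℤ)) x) ≤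
        if x.valMinAbs ∈ Ico (-((q * ℓ : ℕ) : ℤ)) 0 then 1 / β else 0 := by
    intro x
    have hv := x.valMinAbs_mem_Ioc
    rw [Set.mem_Ioc] at hv
    push_cast at hv
    have hI : zmodInd (Ico 0 (L : ℤ)) x = if x.valMinAbs ∈ Ico 0 (L : ℤ) then 1 else 0 := by
      conv_lhs => rw [← ZMod.coe_valMinAbs x]
      exact zmodInd_intCast subset_rfl (by linarith) (by linarith)
    have hh := progAvg_zmodInd hF hq hqℓ x
    by_cases hx : x.valMinAbs ∈ Ico 0 (L : ℤ)
    · rw [hI, if_pos hx, sub_self, mul_zero]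
      split_ifs <;> positivity
    · rw [hI, if_neg hx, sub_zero, mul_one]
      split_ifs with hy
      · have h1 : progAvg q ℓ (zmodInd F) x ≤ 1 := by
          rw [hh]
          refine div_le_one_of_le₀ ?_ (Nat.cast_nonneg _)
          have := card_filter_le (Ico (0 : ℤ) ℓ) (fun j => x.valMinAbs + q * j ∈ F)
          rw [Int.card_Ico, sub_zero, Int.toNat_natCast] at this
          exact_mod_cast this
        have h2 : 1 ≤ 1 / β := by rwa [le_div_iff₀ hβ, one_mul]
        calc √(progAvg q ℓ (zmodInd F) x / β) ≤ √((1 / β) ^ 2) := by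
              apply Real.sqrt_le_sqrt
              calc _ ≤ 1 / β := by gcongr
                _ ≤ _ := by nlinarith
          _ = 1 / β := Real.sqrt_sq (by positivity)
      · have h0 : #{j ∈ Ico (0 : ℤ) ℓ | x.valMinAbs + q * j ∈ F} = 0 := by
          rw [card_eq_zero, filter_eq_empty_iff]
          intro j hj hjF
          have hj' := mem_Ico.mp hj
          have hF' := mem_Ico.mp (hF hjF)
          have hq' : (q : ℤ) * j ≤ q * ℓ := by
            have : (j : ℤ) ≤ ℓ := hj'.2.le
            gcongr
          have hq'' : 0 ≤ (q : ℤ) * j := mul_nonneg (by positivity) hj'.1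
          rw [mem_Ico] at hx hy
          push_cast at hy
          omega
        rw [hh, h0]
        simp
  refine (sum_le_sum fun x _ => hpt x).trans ?_
  rw [← sum_filter, sum_const, nsmul_eq_mul, mul_one_div]
  have hcard : #{x : ZMod (2 * L) | x.valMinAbs ∈ Ico (-((q * ℓ : ℕ) : ℤ)) 0} ≤ q * ℓ := by
    calc _ ≤ #(Ico (-((q * ℓ : ℕ) : ℤ)) 0) := by
          refine card_le_card_of_injOn ZMod.valMinAbs ?_ ?_
          · intro x hx
            simpa using hx
          · exact fun x _ y _ h => ZMod.injective_valMinAbs h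
      _ = q * ℓ := by rw [Int.card_Ico, zero_sub, neg_neg, Int.toNat_natCast]
  gcongr
  exact_mod_cast hcard

lemma CornerFree.sum_zmodInd₂_le {A : Finset (ℤ × ℤ)} (hA : CornerFree A)
    (hAI : A ⊆ Ico 0 (L : ℤ) ×ˢ Ico 0 (L : ℤ)) :
    ∑ z, ∑ x, ∑ y, zmodInd₂ (L := L) A x (z - x) * zmodInd₂ A (z - y) y * zmodInd₂ A x y ≤
      ∑ x, ∑ y, zmodInd₂ (L := L) A x y := by
  have hmem : ∀ x y : ZMod (2 * L), zmodInd₂ A x y ≠ 0 → ((x.val : ℤ), (y.val : ℤ)) ∈ A := by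
    intro x y h
    by_contra hn
    exact h (if_neg hn)
  have hI : ∀ {a b : ℤ}, (a, b) ∈ A → (0 ≤ a ∧ a < L) ∧ 0 ≤ b ∧ b < L := fun h => by
    simpa using hAI h
  rw [sum_comm]
  refine sum_le_sum fun x _ => ?_
  rw [sum_comm]
  refine sum_le_sum fun y _ => ?_
  have hz : ∀ z, z ≠ x + y →
      zmodInd₂ (L := L) A x (z - x) * zmodInd₂ A (z - y) y * zmodInd₂ A x y = 0 := by
    intro z hne
    by_contra h
    have h1 := hmem _ _ (left_ne_zero_of_mul (left_ne_zero_of_mul h))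
    have h2 := hmem _ _ (right_ne_zero_of_mul (left_ne_zero_of_mul h))
    have h3 := hmem _ _ (right_ne_zero_of_mul h)
    set d₁ : ℤ := ((z - x).val : ℤ) - y.val with hd₁
    set d₂ : ℤ := ((z - y).val : ℤ) - x.val with hd₂
    have hd : d₁ = d₂ := by
      have hc : ((d₁ - d₂ : ℤ) : ZMod (2 * L)) = 0 := by
        simp only [hd₁, hd₂]
        push_cast
        simp only [ZMod.natCast_zmod_val]
        ring
      rw [ZMod.intCast_zmod_eq_zero_iff_dvd] at hc
      have b1 := hI h1
      have b2 := hI h2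
      have b3 := hI h3
      have := Int.eq_zero_of_abs_lt_dvd hc (by rw [abs_lt]; push_cast; constructor <;> omega)
      omega
    by_cases h0 : d₂ = 0
    · apply hne
      have : (z - y).val = x.val := by omega
      have := ZMod.val_injective _ this
      rw [← this]
      ring
    · refine hA x.val y.val d₂ h0 h3 ?_ ?_
      · convert h2 using 2
        omega
      · convert h1 using 2
        omega
  rw [Fintype.sum_eq_single (x + y) hz]
  rcases zmodInd₂_mem A x y with h | h
  · simp [h]
  · rw [h, mul_one]
    rcases zmodInd₂_mem A x (x + y - x) with h | h <;>
    rcases zmodInd₂_mem A (x + y - y) y with h' | h' <;> simp only [h, h'] <;> norm_num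

lemma zmodInd_mul_eq (F : Finset ℤ) {u : ZMod (2 * L) → ℝ} (hu : ∀ x, u x = 0 ∨ u x = 1)
    (x : ZMod (2 * L)) :
    zmodInd F x * u x = zmodInd (F.filter fun i : ℤ => u i = 1) x := by
  unfold zmodInd
  rcases hu x with h | h <;> simp [h]

lemma zmodInd₂_eq_mul {A : Finset (ℤ × ℤ)} {F₁ F₂ : Finset ℤ} (hA : A ⊆ F₁ ×ˢ F₂)
    {u v : ZMod (2 * L) → ℝ} (hu : ∀ x, u x = 0 ∨ u x = 1) (hv : ∀ x, v x = 0 ∨ v x = 1)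
    (x y : ZMod (2 * L)) :
    zmodInd₂ A x y * u x * v y = zmodInd₂ (A ∩ (F₁.filter fun i : ℤ => u i = 1) ×ˢ
      (F₂.filter fun i : ℤ => v i = 1)) x y := by
  unfold zmodInd₂
  by_cases hm : ((x.val : ℤ), (y.val : ℤ)) ∈ A
  · have := mem_product.mp (hA hm)
    rcases hu x with h | h <;> rcases hv y with h' | h' <;>
      simp [h, h', hm, this.1, this.2, ZMod.natCast_zmod_val, -ZMod.natCast_val]
  · simp [hm, -ZMod.natCast_val]

end OutsideCounting

section Increment

variable {L : ℕ} {A : Finset (ℤ × ℤ)} {F₁ F₂ : Finset ℤ}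

lemma IsConfig.subset_box (hA : IsConfig L A F₁ F₂) : A ⊆ Ico 0 (L : ℤ) ×ˢ Ico 0 (L : ℤ) :=
  hA.sub.trans (product_subset_product hA.sub₁ hA.sub₂)

lemma IsConfig.card_le (hA : IsConfig L A F₁ F₂) : (#A : ℝ) ≤ #F₁ * #F₂ := by
  have := card_le_card hA.sub
  rw [card_product] at this
  exact_mod_cast this

lemma IsConfig.card_pos₁ (hA : IsConfig L A F₁ F₂) (hne : A.Nonempty) : (0 : ℝ) < #F₁ := by
  obtain ⟨p, hp⟩ := hne
  exact_mod_cast card_pos.mpr ⟨p.1, (mem_product.mp (hA.sub hp)).1⟩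

lemma IsConfig.card_pos₂ (hA : IsConfig L A F₁ F₂) (hne : A.Nonempty) : (0 : ℝ) < #F₂ := by
  obtain ⟨p, hp⟩ := hne
  exact_mod_cast card_pos.mpr ⟨p.2, (mem_product.mp (hA.sub hp)).2⟩

lemma card_le_of_subset_Ico {F : Finset ℤ} (hF : F ⊆ Ico 0 (L : ℤ)) : (#F : ℝ) ≤ L := by
  have := card_le_card hF
  rw [Int.card_Ico, sub_zero, Int.toNat_natCast] at this
  exact_mod_cast this

lemma IsConfig.scale_pos (hA : IsConfig L A F₁ F₂) (hne : A.Nonempty) : 0 < L := by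
  have : (0 : ℝ) < L := (hA.card_pos₁ hne).trans_le (card_le_of_subset_Ico hA.sub₁)
  exact_mod_cast this

lemma approxBy_of_abs_sum_le {G : Type*} [AddCommGroup G] [Fintype G] {F h I : G → ℝ} {β ζ : ℝ}
    (hF : ∀ a b : G → ℝ, (∀ z, |a z| ≤ 1) → (∀ x, |b x| ≤ 1) →
      |∑ z, ∑ x, a z * b x * (F (z - x) - h (z - x))| ≤ ζ) :
    ApproxBy F I β ζ fun x => |h x - β * I x| := by
  intro a b ha hb
  have e : ∑ z, ∑ x, a z * b x * (F (z - x) - β * I (z - x)) =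
      ∑ z, ∑ x, a z * b x * (F (z - x) - h (z - x)) +
        ∑ z, ∑ x, a z * b x * (h (z - x) - β * I (z - x)) := by
    simp only [← sum_add_distrib]
    exact sum_congr rfl fun z _ => sum_congr rfl fun x _ => by ring
  rw [e]
  refine (abs_add_le _ _).trans (add_le_add (hF a b ha hb) ?_)
  refine (abs_sum_le_sum_abs _ _).trans (sum_le_sum fun z _ => ?_)
  refine (abs_sum_le_sum_abs _ _).trans (sum_le_sum fun x _ => ?_)
  rw [abs_mul, abs_mul]

/-- The counting data on `ZMod (2 * L)` attached to a configuration of scale `L`. -/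
noncomputable def IsConfig.toCornerSystem [NeZero L] (hA : IsConfig L A F₁ F₂)
    (hne : A.Nonempty) : CornerSystem (ZMod (2 * L)) where
  A := zmodInd₂ A
  F₁ := zmodInd F₁
  F₂ := zmodInd F₂
  I := zmodInd (Ico 0 (L : ℤ))
  L := L
  τ := #A / (#F₁ * #F₂)
  β₁ := #F₁ / L
  β₂ := #F₂ / L
  hL := Nat.cast_pos.mpr (NeZero.pos L)
  hτ := div_pos (Nat.cast_pos.mpr hne.card_pos) (mul_pos (hA.card_pos₁ hne) (hA.card_pos₂ hne))
  hτ' := div_le_one_of_le₀ hA.card_le (by positivity)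
  hβ₁ := div_pos (hA.card_pos₁ hne) (Nat.cast_pos.mpr (NeZero.pos L))
  hβ₂ := div_pos (hA.card_pos₂ hne) (Nat.cast_pos.mpr (NeZero.pos L))
  hβ₁' := div_le_one_of_le₀ (card_le_of_subset_Ico hA.sub₁) (Nat.cast_nonneg _)
  hβ₂' := div_le_one_of_le₀ (card_le_of_subset_Ico hA.sub₂) (Nat.cast_nonneg _)
  A_mem := zmodInd₂_mem A
  I_mem := zmodInd_mem _
  F₁_mem := zmodInd_mem _
  F₂_mem := zmodInd_mem _
  A_le x y := by
    unfold zmodInd₂ zmodInd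
    by_cases h : ((x.val : ℤ), (y.val : ℤ)) ∈ A
    · obtain ⟨h1, h2⟩ := mem_product.mp (hA.sub h)
      rw [if_pos h, if_pos h1, if_pos h2, one_mul]
    · rw [if_neg h]
      positivity
  sum_I := by rw [sum_zmodInd subset_rfl, Int.card_Ico, sub_zero, Int.toNat_natCast]
  card_le := by
    rw [ZMod.card]
    push_cast
    rfl
  sum_F₁ := by
    have : (L : ℝ) ≠ 0 := Nat.cast_ne_zero.mpr (NeZero.ne L)
    rw [sum_zmodInd hA.sub₁]
    field_simp
  sum_F₂ := by
    have : (L : ℝ) ≠ 0 := Nat.cast_ne_zero.mpr (NeZero.ne L)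
    rw [sum_zmodInd hA.sub₂]
    field_simp
  sum_A := by
    have : (L : ℝ) ≠ 0 := Nat.cast_ne_zero.mpr (NeZero.ne L)
    have := (hA.card_pos₁ hne).ne'
    have := (hA.card_pos₂ hne).ne'
    rw [sum_zmodInd₂ hA.subset_box]
    field_simp

lemma IsConfig.abs_sum_bal_le [NeZero L] {κ η φ : ℝ} (hA : IsConfig L A F₁ F₂) (hne : A.Nonempty)
    (hκ : 0 < κ) (hκ' : κ ≤ 1 / 2) (hη : 0 ≤ η) (hηκ : η ≤ κ)
    (hφ : φ * ((#F₁ : ℝ) * #F₂ / L ^ 2) ^ (1 - κ) * L ^ 2 ≤ #A)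
    (hmax : DensityAtMost κ L ((1 + η) * φ)) {u v : ZMod (2 * L) → ℝ}
    (hu : ∀ x, u x = 0 ∨ u x = 1) (hv : ∀ x, v x = 0 ∨ v x = 1) :
    |∑ x, ∑ y, (hA.toCornerSystem hne).bal x y * u x * v y| ≤ 6 * κ * #A := by
  have h := hA.abs_card_inter_sub_le hκ hκ' hη hηκ (mul_pos (hA.card_pos₁ hne) (hA.card_pos₂ hne))
    hφ hmax (filter_subset (fun i : ℤ => u i = 1) F₁) (filter_subset (fun i : ℤ => v i = 1) F₂)
  have e : ∑ x, ∑ y, (hA.toCornerSystem hne).bal x y * u x * v y =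
      ∑ x, ∑ y, zmodInd₂ A x y * u x * v y -
        #A / (#F₁ * #F₂) * ((∑ x, zmodInd F₁ x * u x) * ∑ y, zmodInd F₂ y * v y) := by
    rw [sum_mul_sum, mul_sum, ← sum_sub_distrib]
    refine sum_congr rfl fun x _ => ?_
    rw [mul_sum, ← sum_sub_distrib]
    refine sum_congr rfl fun y _ => ?_
    simp only [CornerSystem.bal, toCornerSystem]
    ring
  simp only [zmodInd_mul_eq _ hu, zmodInd_mul_eq _ hv, zmodInd₂_eq_mul hA.sub hu hv] at e
  rw [sum_zmodInd₂ (inter_subset_left.trans hA.subset_box),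
    sum_zmodInd ((filter_subset _ _).trans hA.sub₁),
    sum_zmodInd ((filter_subset _ _).trans hA.sub₂)] at e
  rw [e]
  refine le_of_eq_of_le ?_ h
  congr 2
  ring

end Increment

section Step

variable {L : ℕ} {A : Finset (ℤ × ℤ)} {F₁ F₂ : Finset ℤ}

lemma sq_le_mul_moments [NeZero L] {κ η φ : ℝ} (hA : IsConfig L A F₁ F₂) (hne : A.Nonempty)
    (hφ0 : 0 < φ) (hφ : φ * ((#F₁ : ℝ) * #F₂ / L ^ 2) ^ (1 - κ) * L ^ 2 ≤ #A)
    {q ℓ : ℕ} (hq : 1 ≤ q) (hℓ : 0 < ℓ) (hqℓ : q * ℓ ≤ L)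
    (hmax : DensityAtMost κ ℓ ((1 + η) * φ)) :
    (L : ℝ) ^ 2 ≤ (1 + η) *
      ((∑ x : ZMod (2 * L), (progAvg q ℓ (zmodInd F₁) x / (#F₁ / L)) ^ (1 - κ)) *
        ∑ x : ZMod (2 * L), (progAvg q ℓ (zmodInd F₂) x / (#F₂ / L)) ^ (1 - κ)) := by
  have hL : (0 : ℝ) < L := Nat.cast_pos.mpr (NeZero.pos L)
  have hβ₁ : 0 < (#F₁ : ℝ) / L := div_pos (hA.card_pos₁ hne) hL
  have hβ₂ : 0 < (#F₂ : ℝ) / L := div_pos (hA.card_pos₂ hne) hL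
  have h := hmax.card_le hA hq hℓ hqℓ
  simp only [Real.div_rpow (progAvg_nonneg (zmodInd_nonneg _) _ _ _) hβ₁.le,
    Real.div_rpow (progAvg_nonneg (zmodInd_nonneg _) _ _ _) hβ₂.le, ← sum_div]
  rw [div_mul_div_comm, ← Real.mul_rpow hβ₁.le hβ₂.le, div_mul_div_comm, ← sq]
  have hW : 0 < ((#F₁ : ℝ) * #F₂ / L ^ 2) ^ (1 - κ) := by
    have := hA.card_pos₁ hne
    have := hA.card_pos₂ hne
    positivity
  rw [← mul_div_assoc, le_div_iff₀ hW]
  refine le_of_mul_le_mul_left ?_ hφ0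
  calc _ = φ * ((#F₁ : ℝ) * #F₂ / L ^ 2) ^ (1 - κ) * L ^ 2 := by ring
    _ ≤ _ := hφ.trans h
    _ = _ := by ring

lemma HasDensity.le_one {κ φ : ℝ} (h : HasDensity κ L φ) (hκ : 0 ≤ κ) : φ ≤ 1 := by
  obtain ⟨A, F₁, F₂, hA, hne, hφ⟩ := h
  have h1 := hA.card_pos₁ hne
  have h2 := hA.card_pos₂ hne
  have hL : (0 : ℝ) < L := Nat.cast_pos.mpr (hA.scale_pos hne)
  set W : ℝ := (#F₁ : ℝ) * #F₂ / L ^ 2 with hW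
  have hW0 : 0 < W := by positivity
  have hW1 : W ≤ 1 := by
    rw [hW, sq]
    exact div_le_one_of_le₀ (mul_le_mul (card_le_of_subset_Ico hA.sub₁)
      (card_le_of_subset_Ico hA.sub₂) h2.le hL.le) (by positivity)
  have hWL : W * L ^ 2 = #F₁ * #F₂ := by rw [hW]; field_simp
  have h3 : W ≤ W ^ (1 - κ) := by
    conv_lhs => rw [← Real.rpow_one W]
    exact Real.rpow_le_rpow_of_exponent_ge hW0 hW1 (by linarith)
  by_contra! hlt
  have h4 : W * L ^ 2 < φ * W ^ (1 - κ) * L ^ 2 := by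
    have : W < φ * W ^ (1 - κ) := by nlinarith
    gcongr
  linarith [hA.card_le]

theorem HasDensity.increment {κ ω η δ w φ : ℝ} {m ℓ : ℕ} (h : HasDensity κ L φ)
    (hδ : 0 < δ) (hδφ : δ ≤ φ) (hκ : 0 < κ) (hκ' : κ ≤ 1 / 2) (hω : 0 ≤ ω) (hω' : ω ≤ 1)
    (hη : η = κ * ω ^ 2) (hκδ : 6 * κ ≤ δ ^ 11 / 2 ^ 26) (hωδ : 4 * ω ≤ δ ^ 12 / 2 ^ 24)
    (hw : 0 < w) (hwδ : w ^ κ ≤ δ) (hm : 0 < m) (hmw : 8 / m ≤ δ ^ 12 * w ^ 4 / 2 ^ 28)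
    (hℓ : 0 < ℓ) (hbig : 16 ≤ δ ^ 2 * w * L)
    (hsmall : (((7 * ℓ * m) ^ (2 * m ^ 2) * ℓ : ℕ) : ℝ) ≤ η * w * L) :
    ∃ L', ℓ ≤ L' ∧ HasDensity κ L' ((1 + η) * φ) := by
  by_contra! hno
  obtain ⟨A, F₁, F₂, hA, hne, hφ⟩ := h
  have : NeZero L := ⟨(hA.scale_pos hne).ne'⟩
  have hL : (0 : ℝ) < L := Nat.cast_pos.mpr (NeZero.pos L)
  have hη0 : 0 ≤ η := by rw [hη]; positivity
  have hηκ : η ≤ κ := by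
    rw [hη]
    exact mul_le_of_le_one_right hκ.le (pow_le_one₀ hω hω')
  have hφ0 : 0 < φ := hδ.trans_le hδφ
  have hmax : ∀ L', ℓ ≤ L' → DensityAtMost κ L' ((1 + η) * φ) := fun L' h =>
    densityAtMost_of_not_hasDensity (by positivity) (hno L' h)
  have hn₁ := hA.card_pos₁ hne
  have hn₂ := hA.card_pos₂ hne
  set S := hA.toCornerSystem hne with hS
  have hSL : S.L = L := rfl
  have hSβ₁ : S.β₁ = #F₁ / L := rfl
  have hSβ₂ : S.β₂ = #F₂ / L := rfl
  have hSτ : S.τ = #A / (#F₁ * #F₂) := rfl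
  have hW : (#F₁ : ℝ) * #F₂ / L ^ 2 = S.β₁ * S.β₂ := by
    rw [hSβ₁, hSβ₂, div_mul_div_comm, sq]
  have hW0 : 0 < S.β₁ * S.β₂ := mul_pos S.hβ₁ S.hβ₂
  have hW1 : S.β₁ * S.β₂ ≤ 1 := mul_le_one₀ S.hβ₁' S.hβ₂.le S.hβ₂'
  have hφτ : φ ≤ S.τ * (S.β₁ * S.β₂) ^ κ := by
    rw [hW, ← le_div_iff₀ (by positivity), ← le_div_iff₀ (by positivity)] at hφ
    refine hφ.trans (le_of_eq ?_)
    rw [Real.rpow_sub hW0, Real.rpow_one, hSτ, ← hW]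
    field_simp
  have hτδ : δ ≤ S.τ := by
    refine (hδφ.trans hφτ).trans (mul_le_of_le_one_right S.hτ.le ?_)
    exact Real.rpow_le_one hW0.le hW1 hκ.le
  have hwW : w ≤ S.β₁ * S.β₂ := by
    rw [← Real.rpow_le_rpow_iff hw.le hW0.le hκ]
    refine hwδ.trans ((hδφ.trans hφτ).trans (mul_le_of_le_one_left ?_ S.hτ'))
    positivity
  have hw₁ : w ≤ S.β₁ := hwW.trans (mul_le_of_le_one_right S.hβ₁.le S.hβ₂')
  have hw₂ : w ≤ S.β₂ := hwW.trans (mul_le_of_le_one_left S.hβ₂.le S.hβ₁')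
  have hw1 : w ≤ 1 := hwW.trans hW1
  have habs : ∀ (F : Finset ℤ) (x : ZMod (2 * L)), |zmodInd F x| ≤ 1 := fun F x => by
    rcases zmodInd_mem F x with h | h <;> simp [h]
  obtain ⟨q, hq, hq', happ⟩ := exists_progAvg_approx (habs F₁) (habs F₂) hm hℓ
  have hqℓ' : (q : ℝ) * ℓ ≤ η * w * L := by
    refine le_trans ?_ hsmall
    exact_mod_cast Nat.mul_le_mul_right ℓ hq'
  have hηw : η * w ≤ 1 := mul_le_one₀ (by linarith) hw.le hw1
  have hqℓ : q * ℓ ≤ L := by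
    have : (q : ℝ) * ℓ ≤ L := hqℓ'.trans (mul_le_of_le_one_left hL.le hηw)
    exact_mod_cast this
  have hℓL : ℓ ≤ L := (Nat.le_mul_of_pos_left ℓ (by omega)).trans hqℓ
  set h₁ : ZMod (2 * L) → ℝ := progAvg q ℓ (zmodInd F₁) with hh₁
  set h₂ : ZMod (2 * L) → ℝ := progAvg q ℓ (zmodInd F₂) with hh₂
  have hout : ∀ {F : Finset ℤ} {β : ℝ}, F ⊆ Ico 0 (L : ℤ) → w ≤ β → β ≤ 1 →
      ∑ x : ZMod (2 * L), √(progAvg q ℓ (zmodInd F) x / β) * (1 - zmodInd (Ico 0 (L : ℤ)) x) ≤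
        κ * ω ^ 2 * L := by
    intro F β hF hwβ hβ
    have hβ0 : 0 < β := hw.trans_le hwβ
    refine (sum_sqrt_progAvg_outside_le hF hq hqℓ hβ0 hβ).trans ?_
    rw [div_le_iff₀ hβ0, ← hη]
    calc (q : ℝ) * ℓ ≤ η * w * L := hqℓ'
      _ ≤ η * β * L := by gcongr
      _ = _ := by ring
  have hsum : ∀ {F : Finset ℤ} {β : ℝ}, 0 < β → ∑ x : ZMod (2 * L), zmodInd F x = β * L →
      ∑ x : ZMod (2 * L), progAvg q ℓ (zmodInd F) x / β = L := by
    intro F β hβ h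
    rw [← sum_div, sum_progAvg _ _ hℓ, h, mul_div_cancel_left₀ _ hβ.ne']
  have hu₁ : ∀ x, 0 ≤ h₁ x / S.β₁ := fun x =>
    div_nonneg (progAvg_nonneg (zmodInd_nonneg _) _ _ _) S.hβ₁.le
  have hu₂ : ∀ x, 0 ≤ h₂ x / S.β₂ := fun x =>
    div_nonneg (progAvg_nonneg (zmodInd_nonneg _) _ _ _) S.hβ₂.le
  have hmom := sq_le_mul_moments hA hne hφ0 hφ hq hℓ hqℓ (hmax ℓ le_rfl)
  rw [hη] at hmom
  have hd₁ := sum_abs_sub_le_of_moments hu₁ hu₂ S.I_mem hL (hsum S.hβ₁ S.sum_F₁)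
    (hsum S.hβ₂ S.sum_F₂) S.sum_I hκ hκ' hω (hout hA.sub₁ hw₁ S.hβ₁') (hout hA.sub₂ hw₂ S.hβ₂') hmom
  rw [mul_comm (∑ x, _) (∑ x, _)] at hmom
  have hd₂ := sum_abs_sub_le_of_moments hu₂ hu₁ S.I_mem hL (hsum S.hβ₂ S.sum_F₂)
    (hsum S.hβ₁ S.sum_F₁) S.sum_I hκ hκ' hω (hout hA.sub₂ hw₂ S.hβ₂') (hout hA.sub₁ hw₁ S.hβ₁') hmom
  have herr : ∀ {h : ZMod (2 * L) → ℝ} {β : ℝ}, 0 < β →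
      ∑ x, |h x / β - S.I x| ≤ 4 * ω * L → ∑ x, |h x - β * S.I x| ≤ 4 * ω * (β * S.L) := by
    intro h β hβ hle
    have e : ∀ x, |h x - β * S.I x| = β * |h x / β - S.I x| := fun x => by
      rw [← abs_of_pos hβ, ← abs_mul, abs_of_pos hβ, mul_sub, mul_div_cancel₀ _ hβ.ne']
    rw [sum_congr rfl fun x _ => e x, ← mul_sum, hSL]
    calc _ ≤ β * (4 * ω * L) := by gcongr
      _ = _ := by ring
  have hpow : δ ^ 12 ≤ S.τ ^ 12 := by gcongr
  refine S.not_regular_of_cornerFree (ε := 4 * ω) (σ := 6 * κ * S.τ)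
    (ζ := 2 / m * ((2 * L : ℕ) : ℝ) ^ 2)
    (approxBy_of_abs_sum_le fun a b ha hb => (happ a b ha hb).1)
    (approxBy_of_abs_sum_le fun a b ha hb => (happ a b ha hb).2)
    (fun x => abs_nonneg _) (fun x => abs_nonneg _) (herr S.hβ₁ hd₁) (herr S.hβ₂ hd₂)
    (by positivity) ?_ (hA.cornerFree.sum_zmodInd₂_le hA.subset_box) ?_ ?_ ?_ ?_
  · intro u v hu hv
    refine (hA.abs_sum_bal_le hne hκ hκ' hη0 hηκ hφ (hmax L hℓL) hu hv).trans (le_of_eq ?_)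
    rw [hSL, hSβ₁, hSβ₂, hSτ]
    field_simp
  · refine hbig.trans ?_
    rw [hSL, mul_assoc (S.τ ^ 2)]
    gcongr
  · exact hωδ.trans (by gcongr)
  · calc 6 * κ * S.τ ≤ δ ^ 11 / 2 ^ 26 * S.τ := by
          have := S.hτ
          gcongr
      _ ≤ S.τ ^ 11 / 2 ^ 26 * S.τ := by
          have := S.hτ
          gcongr
      _ = _ := by ring
  · rw [hSL]
    calc 2 / m * ((2 * L : ℕ) : ℝ) ^ 2 = 8 / m * (L : ℝ) ^ 2 := by push_cast; ring
      _ ≤ δ ^ 12 * w ^ 4 / 2 ^ 28 * (L : ℝ) ^ 2 := by gcongr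
      _ ≤ S.τ ^ 12 * (S.β₁ * S.β₂) ^ 4 / 2 ^ 28 * (L : ℝ) ^ 2 := by gcongr
      _ = _ := by ring

end Step

section Iteration

lemma pow_le_three_pow {D : ℕ} {k n : ℕ} (h : k ≤ n) (hD : 1 ≤ D) : D ^ k ≤ 3 ^ D ^ n :=
  (Nat.pow_le_pow_right hD h).trans (Nat.lt_pow_self (by norm_num)).le

theorem HasDensity.increment_of_pow_le {D L ℓ m : ℕ} {φ : ℝ} (hD : 2 ^ 30 ≤ D)
    (hm : m = 3 ^ (5 * D ^ 14)) (h : HasDensity ((D : ℝ)⁻¹ ^ 12) L φ) (hφ : (D : ℝ)⁻¹ ≤ φ)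
    (hmℓ : m ≤ ℓ) (hℓL : ℓ ^ (7 * m ^ 2) ≤ L) :
    ∃ L', ℓ ≤ L' ∧ HasDensity ((D : ℝ)⁻¹ ^ 12) L' ((1 + (D : ℝ)⁻¹ ^ 38) * φ) := by
  have hD1 : 1 ≤ D := le_trans (by norm_num) hD
  have hDr : (2 : ℝ) ^ 30 ≤ D := by exact_mod_cast hD
  have hD0 : (0 : ℝ) < D := lt_of_lt_of_le (by norm_num) hDr
  set δ : ℝ := (D : ℝ)⁻¹ with hδ
  have hδ0 : 0 < δ := inv_pos.mpr hD0
  have hδ30 : δ ≤ 1 / 2 ^ 30 := by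
    rw [hδ, inv_eq_one_div]
    exact one_div_le_one_div_of_le (by norm_num) hDr
  have hδ1 : δ ≤ 1 := hδ30.trans (by norm_num)
  set t : ℕ := 3 ^ D ^ 14 with ht
  have htm : m = t ^ 5 := by rw [hm, ht, ← pow_mul, mul_comm]
  have hDt : D ^ 14 ≤ t := pow_le_three_pow le_rfl hD1
  have hDt' : D ≤ t := by simpa using pow_le_three_pow (k := 1) (n := 14) (by norm_num) hD1
  have ht7 : 2 ^ 30 ≤ t := hD.trans hDt'
  have ht1 : 1 ≤ t := le_trans (by norm_num) ht7
  have htm' : t ≤ m := htm ▸ Nat.le_self_pow (by norm_num) t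
  have hm7 : 7 ≤ m := le_trans (by norm_num) (ht7.trans htm')
  have hexp : Real.exp ((D : ℝ) ^ 13) ≤ t := by
    calc Real.exp ((D : ℝ) ^ 13) = Real.exp 1 ^ D ^ 13 := by
          rw [← Real.exp_nat_mul, mul_one, Nat.cast_pow]
      _ ≤ 3 ^ D ^ 13 := by
          gcongr
          exact Real.exp_one_lt_three.le
      _ ≤ 3 ^ D ^ 14 := by
          gcongr <;> norm_num
      _ = t := by rw [ht]; push_cast; rfl
  have htr : (0 : ℝ) < t := by exact_mod_cast ht1
  set w : ℝ := Real.exp (-(D : ℝ) ^ 13) with hw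
  have hw0 : 0 < w := Real.exp_pos _
  have hwt : (t : ℝ)⁻¹ ≤ w := by
    rw [hw, Real.exp_neg]
    gcongr
  have hδt : (t : ℝ)⁻¹ ≤ δ ^ 14 := by
    rw [hδ, inv_pow]
    have : ((D ^ 14 : ℕ) : ℝ) ≤ t := by exact_mod_cast hDt
    push_cast at this
    gcongr
  have hℓpos : 0 < ℓ := by omega
  have hpow : t ^ 5 * ((7 * ℓ * m) ^ (2 * m ^ 2) * ℓ) ≤ L := by
    calc t ^ 5 * ((7 * ℓ * m) ^ (2 * m ^ 2) * ℓ) ≤ ℓ * ((ℓ * ℓ * ℓ) ^ (2 * m ^ 2) * ℓ) := by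
          rw [← htm]
          gcongr
          omega
      _ = ℓ ^ (6 * m ^ 2 + 2) := by ring
      _ ≤ ℓ ^ (7 * m ^ 2) := Nat.pow_le_pow_right hℓpos (by nlinarith)
      _ ≤ L := hℓL
  have hpowr : (t : ℝ) ^ 5 * (((7 * ℓ * m) ^ (2 * m ^ 2) * ℓ : ℕ) : ℝ) ≤ L := by
    exact_mod_cast hpow
  have hlow : (t : ℝ)⁻¹ ^ 4 ≤ δ ^ 38 * w := by
    calc (t : ℝ)⁻¹ ^ 4 = (t : ℝ)⁻¹ ^ 3 * (t : ℝ)⁻¹ := by ring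
      _ ≤ (δ ^ 14) ^ 3 * w := by gcongr
      _ = δ ^ 42 * w := by ring
      _ ≤ δ ^ 38 * w := by
          gcongr ?_ * w
          exact pow_le_pow_of_le_one hδ0.le hδ1 (by norm_num)
  have hsmall : (t : ℝ) * (((7 * ℓ * m) ^ (2 * m ^ 2) * ℓ : ℕ) : ℝ) ≤ δ ^ 38 * w * L := by
    calc (t : ℝ) * (((7 * ℓ * m) ^ (2 * m ^ 2) * ℓ : ℕ) : ℝ)
        = (t : ℝ)⁻¹ ^ 4 * ((t : ℝ) ^ 5 * (((7 * ℓ * m) ^ (2 * m ^ 2) * ℓ : ℕ) : ℝ)) := by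
          field_simp
      _ ≤ _ := by gcongr
  have hcnt : (1 : ℝ) ≤ (((7 * ℓ * m) ^ (2 * m ^ 2) * ℓ : ℕ) : ℝ) := by
    have : 0 < (7 * ℓ * m) ^ (2 * m ^ 2) * ℓ := by
      have : 0 < m := by omega
      positivity
    exact_mod_cast this
  have ht1r : (1 : ℝ) ≤ t := by exact_mod_cast ht1
  have ht16 : (16 : ℝ) ≤ t := by
    have : ((2 ^ 30 : ℕ) : ℝ) ≤ t := by exact_mod_cast ht7
    refine le_trans ?_ this
    norm_num
  refine h.increment (ω := δ ^ 13) (w := w) (m := m) (ℓ := ℓ) (δ := δ) hδ0 hφ (by positivity) ?_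
    (by positivity) (pow_le_one₀ hδ0.le hδ1) (by ring) ?_ ?_ hw0 ?_ (by omega) ?_ hℓpos ?_ ?_
  · calc δ ^ 12 ≤ δ := pow_le_of_le_one hδ0.le hδ1 (by norm_num)
      _ ≤ 1 / 2 := hδ30.trans (by norm_num)
  · have : 0 < δ ^ 11 := by positivity
    rw [pow_succ δ 11]
    nlinarith
  · have : 0 < δ ^ 12 := by positivity
    rw [pow_succ δ 12]
    nlinarith
  · rw [hw, ← Real.exp_mul]
    have e : -(D : ℝ) ^ 13 * δ ^ 12 = -D := by
      rw [hδ]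
      field_simp
    rw [e, Real.exp_neg, hδ]
    gcongr
    linarith [Real.add_one_le_exp (D : ℝ)]
  · rw [htm]
    have h2 : 8 * δ ^ 14 ≤ δ ^ 12 / 2 ^ 28 := by
      have h3 : 0 < δ ^ 12 := by positivity
      have h4 : δ ^ 2 ≤ (1 / 2 ^ 30) ^ 2 := by gcongr
      have e : δ ^ 14 = δ ^ 12 * δ ^ 2 := by ring
      rw [e]
      nlinarith
    calc 8 / ((t ^ 5 : ℕ) : ℝ) = 8 * (t : ℝ)⁻¹ * (t : ℝ)⁻¹ ^ 4 := by
          push_cast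
          field_simp
      _ ≤ 8 * δ ^ 14 * w ^ 4 := by gcongr
      _ ≤ δ ^ 12 / 2 ^ 28 * w ^ 4 := by gcongr
      _ = _ := by ring
  · calc (16 : ℝ) ≤ t * 1 := by linarith
      _ ≤ t * (((7 * ℓ * m) ^ (2 * m ^ 2) * ℓ : ℕ) : ℝ) := by gcongr
      _ ≤ δ ^ 38 * w * L := hsmall
      _ ≤ δ ^ 2 * w * L := by
          gcongr ?_ * w * L
          exact pow_le_pow_of_le_one hδ0.le hδ1 (by norm_num)
  · refine le_trans ?_ hsmall
    exact le_mul_of_one_le_left (by positivity) ht1r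

theorem HasDensity.lt_of_pow_le {D L m : ℕ} (hD : 2 ^ 30 ≤ D) (hm : m = 3 ^ (5 * D ^ 14))
    (h : HasDensity ((D : ℝ)⁻¹ ^ 12) L (D : ℝ)⁻¹) : L < m ^ (7 * m ^ 2) ^ D ^ 39 := by
  have hD0 : (0 : ℝ) < D := by
    have : 0 < D := lt_of_lt_of_le (by norm_num) hD
    exact_mod_cast this
  have hm1 : 1 ≤ m := hm ▸ Nat.one_le_pow _ _ (by norm_num)
  have key : ∀ k L φ, (D : ℝ)⁻¹ ≤ φ → HasDensity ((D : ℝ)⁻¹ ^ 12) L φ →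
      m ^ (7 * m ^ 2) ^ k ≤ L →
      ∃ L', HasDensity ((D : ℝ)⁻¹ ^ 12) L' ((1 + (D : ℝ)⁻¹ ^ 38) ^ k * φ) := by
    intro k
    induction k with
    | zero => exact fun L φ _ h _ => ⟨L, by simpa using h⟩
    | succ k ih =>
      intro L φ hφ h hL
      rw [pow_succ, pow_mul] at hL
      obtain ⟨L₁, hL₁, h₁⟩ := h.increment_of_pow_le hD hm hφ
        (Nat.le_self_pow (pow_ne_zero _ (by positivity)) m) hL
      have hφ' : φ ≤ (1 + (D : ℝ)⁻¹ ^ 38) * φ :=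
        le_mul_of_one_le_left ((inv_pos.mpr hD0).le.trans hφ)
          (le_add_of_nonneg_right (by positivity))
      obtain ⟨L₂, h₂⟩ := ih L₁ _ (hφ.trans hφ') h₁ hL₁
      exact ⟨L₂, by rwa [pow_succ _ k, mul_assoc]⟩
  by_contra! hL
  obtain ⟨L', h'⟩ := key _ _ _ le_rfl h hL
  have h1 := h'.le_one (by positivity)
  have h2 := one_add_mul_le_pow (a := (D : ℝ)⁻¹ ^ 38) (by
    have : 0 ≤ (D : ℝ)⁻¹ ^ 38 := by positivity
    linarith) (D ^ 39)
  have e : ((D ^ 39 : ℕ) : ℝ) * (D : ℝ)⁻¹ ^ 38 = D := by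
    push_cast
    field_simp
  rw [e] at h2
  rw [mul_inv_le_iff₀ hD0] at h1
  linarith

lemma pow_pow_le_exp_exp {D m : ℕ} (hD : 2 ^ 30 ≤ D) (hm : m = 3 ^ (5 * D ^ 14)) :
    ((m ^ (7 * m ^ 2) ^ D ^ 39 : ℕ) : ℝ) ≤ Real.exp (Real.exp ((D : ℝ) ^ 56)) := by
  have hDr : (2 : ℝ) ^ 30 ≤ D := by exact_mod_cast hD
  have hD1 : (1 : ℝ) ≤ D := le_trans (by norm_num) hDr
  have hme : (m : ℝ) ≤ Real.exp ((D : ℝ) ^ 15) := by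
    have h3 : (3 : ℝ) ≤ Real.exp 2 := by linarith [Real.add_one_le_exp (2 : ℝ)]
    rw [hm]
    push_cast
    calc (3 : ℝ) ^ (5 * D ^ 14) ≤ Real.exp 2 ^ (5 * D ^ 14) := by gcongr
      _ = Real.exp (10 * (D : ℝ) ^ 14) := by
          rw [← Real.exp_nat_mul]
          push_cast
          ring_nf
      _ ≤ _ := by
          rw [Real.exp_le_exp, pow_succ _ 14, mul_comm]
          gcongr
          linarith
  have h7 : (7 : ℝ) ≤ Real.exp ((D : ℝ) ^ 15) := by
    have h1 : (D : ℝ) ≤ (D : ℝ) ^ 15 := le_self_pow₀ hD1 (by norm_num)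
    linarith [Real.add_one_le_exp ((D : ℝ) ^ 15)]
  have hbase : 7 * (m : ℝ) ^ 2 ≤ Real.exp ((D : ℝ) ^ 16) := by
    calc 7 * (m : ℝ) ^ 2 ≤ Real.exp ((D : ℝ) ^ 15) * Real.exp ((D : ℝ) ^ 15) ^ 2 := by gcongr
      _ = Real.exp (3 * (D : ℝ) ^ 15) := by
          rw [← pow_succ', ← Real.exp_nat_mul]
          norm_num
      _ ≤ _ := by
          rw [Real.exp_le_exp, pow_succ _ 15, mul_comm]
          gcongr
          linarith
  have hexpo : (7 * (m : ℝ) ^ 2) ^ D ^ 39 ≤ Real.exp ((D : ℝ) ^ 55) := by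
    calc (7 * (m : ℝ) ^ 2) ^ D ^ 39 ≤ Real.exp ((D : ℝ) ^ 16) ^ D ^ 39 := by gcongr
      _ = _ := by
          rw [← Real.exp_nat_mul]
          push_cast
          ring_nf
  push_cast
  calc (m : ℝ) ^ (7 * m ^ 2) ^ D ^ 39 ≤ Real.exp ((D : ℝ) ^ 15) ^ (7 * m ^ 2) ^ D ^ 39 := by
        gcongr
    _ = Real.exp ((7 * (m : ℝ) ^ 2) ^ D ^ 39 * (D : ℝ) ^ 15) := by
        rw [← Real.exp_nat_mul]
        push_cast
        rfl
    _ ≤ Real.exp (Real.exp ((D : ℝ) ^ 55) * Real.exp ((D : ℝ) ^ 15)) := by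
        gcongr
        linarith [Real.add_one_le_exp ((D : ℝ) ^ 15)]
    _ ≤ _ := by
        rw [← Real.exp_add]
        gcongr
        have h1 : (D : ℝ) ^ 15 ≤ (D : ℝ) ^ 55 := pow_le_pow_right₀ hD1 (by norm_num)
        have h2 : (2 : ℝ) * (D : ℝ) ^ 55 ≤ D * (D : ℝ) ^ 55 := by
          gcongr
          linarith
        linarith [pow_succ' (D : ℝ) 55]

end Iteration

/-- Shkredov's quantitative corner theorem: there is an absolute constant `c > 0`
and a threshold `N₀` such that for all `N ≥ N₀`, every subset `A` of the grid
`[N] × [N]` with `|A| ≥ N² / (log log N)^c` contains an axis-parallel corner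
`(a, b), (a + d, b), (a, b + d)` with `d ≠ 0`. -/
theorem corners_density_shkredov :
    ∃ c : ℝ, 0 < c ∧ ∃ N₀ : ℕ, ∀ N : ℕ, N₀ ≤ N →
      ∀ A : Finset (ℤ × ℤ),
        A ⊆ Finset.Ico (0 : ℤ) (N : ℤ) ×ˢ Finset.Ico (0 : ℤ) (N : ℤ) →
        (N : ℝ) ^ 2 / (Real.log (Real.log N)) ^ c ≤ (A.card : ℝ) →
        ∃ a b d : ℤ, d ≠ 0 ∧ (a, b) ∈ A ∧ (a + d, b) ∈ A ∧ (a, b + d) ∈ A := by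
  have hlim : Filter.Tendsto (fun N : ℕ => Real.log (Real.log N)) Filter.atTop Filter.atTop :=
    Real.tendsto_log_atTop.comp (Real.tendsto_log_atTop.comp tendsto_natCast_atTop_atTop)
  obtain ⟨N₀, hN₀⟩ := Filter.eventually_atTop.mp (hlim.eventually_ge_atTop ((2 ^ 30 : ℝ) ^ 112))
  refine ⟨1 / 112, by norm_num, max N₀ 2, fun N hN A hAN hA => ?_⟩
  have hN1 : 2 ≤ N := (le_max_right N₀ 2).trans hN
  have hNr : (0 : ℝ) < N := Nat.cast_pos.mpr (by omega)
  have hT := hN₀ N ((le_max_left N₀ 2).trans hN)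
  set T : ℝ := Real.log (Real.log N) with hTdef
  have hT0 : 0 < T := lt_of_lt_of_le (by positivity) hT
  set x : ℝ := T ^ (1 / 112 : ℝ) with hx
  have hxT : x ^ 112 = T := by
    rw [hx, ← Real.rpow_natCast, ← Real.rpow_mul hT0.le]
    norm_num
  have hx0 : 0 < x := Real.rpow_pos_of_pos hT0 _
  have hx30 : (2 : ℝ) ^ 30 ≤ x := by
    rw [← hxT] at hT
    exact le_of_pow_le_pow_left₀ (by norm_num) hx0.le hT
  set D : ℕ := ⌈x⌉₊ with hDdef
  have hxD : x ≤ D := Nat.le_ceil x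
  have hDx : (D : ℝ) ≤ x ^ 2 := by
    have := (Nat.ceil_lt_add_one hx0.le).le
    nlinarith
  have hD30 : 2 ^ 30 ≤ D := by
    have : (2 : ℝ) ^ 30 ≤ D := hx30.trans hxD
    exact_mod_cast this
  have hDT : (D : ℝ) ^ 56 ≤ T := by
    calc (D : ℝ) ^ 56 ≤ (x ^ 2) ^ 56 := by gcongr
      _ = T := by rw [← pow_mul, ← hxT]
  have hcard : (D : ℝ)⁻¹ * N ^ 2 ≤ #A := by
    refine le_trans ?_ hA
    rw [div_eq_inv_mul]
    gcongr
  by_contra! hcf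
  have hdens : HasDensity ((D : ℝ)⁻¹ ^ 12) N (D : ℝ)⁻¹ := by
    refine ⟨A, Ico 0 (N : ℤ), Ico 0 (N : ℤ), ⟨subset_rfl, subset_rfl, hAN, hcf⟩, ?_, ?_⟩
    · have : 0 < #A := by
        have : (0 : ℝ) < #A := lt_of_lt_of_le (by positivity) hcard
        exact_mod_cast this
      exact card_pos.mp this
    · have e : (N : ℝ) * N / N ^ 2 = 1 := by field_simp
      simpa [e] using hcard
  have hlt := hdens.lt_of_pow_le hD30 rfl
  have hle := pow_pow_le_exp_exp hD30 rfl
  have hlog : 0 < Real.log N := Real.log_pos (by exact_mod_cast hN1)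
  have hNe : Real.exp (Real.exp T) = N := by
    rw [hTdef, Real.exp_log hlog, Real.exp_log hNr]
  have hfin : (N : ℝ) < N := by
    calc (N : ℝ) < _ := Nat.cast_lt.mpr hlt
      _ ≤ _ := hle
      _ ≤ Real.exp (Real.exp T) := by gcongr
      _ = N := hNe
  exact lt_irrefl _ hfin
end

section
/- There exists a threshold N₀ such that for every N ≥ N₀ and every colouring of the grid [N] × [N] using fewer than log log N colours, there is a monochromatic axis-parallel corner, i.e., three points (x, y), (x + d, y), (x, y + d) with d ≠ 0 all receiving the same colour. -/
/-- A corner with `d ≠ 0` in the grid `[N] × [N]` that is monochromatic under `χ`. -/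
def HasMonochromaticCorner {r : ℕ} (N : ℕ) (χ : ℤ × ℤ → Fin r) : Prop :=
  ∃ x y d : ℤ, d ≠ 0 ∧
    (x, y) ∈ Finset.Ico (0 : ℤ) (N : ℤ) ×ˢ Finset.Ico (0 : ℤ) (N : ℤ) ∧
    (x + d, y) ∈ Finset.Ico (0 : ℤ) (N : ℤ) ×ˢ Finset.Ico (0 : ℤ) (N : ℤ) ∧
    (x, y + d) ∈ Finset.Ico (0 : ℤ) (N : ℤ) ×ˢ Finset.Ico (0 : ℤ) (N : ℤ) ∧
    χ (x + d, y) = χ (x, y) ∧ χ (x, y + d) = χ (x, y)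

theorem Finset.two_mul_card_filter_lt_offDiag {α : Type*} [LinearOrder α] (A : Finset α) :
    2 * (A.offDiag.filter fun p => p.1 < p.2).card = A.card * A.card - A.card := by
  have hswap : (A.offDiag.filter fun p => p.1 < p.2).card =
      (A.offDiag.filter fun p => ¬ p.1 < p.2).card := by
    refine Finset.card_bij' (fun p _ => p.swap) (fun p _ => p.swap) ?_ ?_ ?_ ?_
    · rintro ⟨a, b⟩ h
      simp only [Finset.mem_filter, Finset.mem_offDiag, Prod.swap] at h ⊢
      exact ⟨⟨h.1.2.1, h.1.1, h.1.2.2.symm⟩, h.2.not_gt⟩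
    · rintro ⟨a, b⟩ h
      simp only [Finset.mem_filter, Finset.mem_offDiag, Prod.swap] at h ⊢
      exact ⟨⟨h.1.2.1, h.1.1, h.1.2.2.symm⟩, lt_of_le_of_ne (not_lt.1 h.2) h.1.2.2.symm⟩
    · intro p _
      exact p.swap_swap
    · intro p _
      exact p.swap_swap
  rw [← Finset.offDiag_card, ← Finset.card_filter_add_card_filter_not (s := A.offDiag)
    (fun p => p.1 < p.2), ← hswap, two_mul]

/-- Some difference `d > 0` and colour `c` are shared by at least `|A|² / (4 r N)` of the points
`(a, s - b)` with `a < b` in `A`. -/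
theorem exists_popular_difference_and_colour {r N : ℕ} (χ : ℤ × ℤ → Fin r) (A : Finset ℤ) (s : ℤ)
    (hA : ∀ a ∈ A, 0 ≤ a ∧ a < N) (hcard : 2 ≤ A.card) :
    ∃ d : ℤ, 0 < d ∧ ∃ c : Fin r, ∃ C ⊆ A, (∀ a ∈ C, a + d ∈ A ∧ χ (a, s - (a + d)) = c) ∧
      A.card ^ 2 ≤ C.card * (4 * r * N) := by
  classical
  set S := A.offDiag.filter fun p => p.1 < p.2 with hS
  set T := Finset.Ico (1 : ℤ) N ×ˢ (Finset.univ : Finset (Fin r)) with hT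
  have hmaps : ∀ p ∈ S, (p.2 - p.1, χ (p.1, s - p.2)) ∈ T := by
    rintro ⟨a, b⟩ h
    simp only [hS, Finset.mem_filter, Finset.mem_offDiag] at h
    have := hA a h.1.1
    have := hA b h.1.2.1
    simp only [hT, Finset.mem_product, Finset.mem_Ico, Finset.mem_univ, and_true]
    omega
  have hTcard : T.card ≤ r * N := by
    simp only [hT, Finset.card_product, Int.card_Ico, Finset.card_univ, Fintype.card_fin]
    rw [mul_comm]
    exact Nat.mul_le_mul_left _ (by omega)
  have hScard : A.card ^ 2 ≤ 4 * S.card := by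
    have h := Finset.two_mul_card_filter_lt_offDiag A
    rw [← hS] at h
    have : 2 * A.card ≤ A.card * A.card := Nat.mul_le_mul_right _ hcard
    rw [pow_two]
    omega
  obtain ⟨⟨d, c⟩, hdc, hfib⟩ : ∃ y ∈ T, A.card ^ 2 ≤
      (S.filter fun p => (p.2 - p.1, χ (p.1, s - p.2)) = y).card * (4 * r * N) := by
    by_contra! hsmall
    have hSne : S.Nonempty := by
      rw [← Finset.card_pos]
      nlinarith
    obtain ⟨p, hp⟩ := hSne
    have hlt : ∑ y ∈ T, (S.filter fun p => (p.2 - p.1, χ (p.1, s - p.2)) = y).card * (4 * r * N) <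
        ∑ _y ∈ T, A.card ^ 2 := Finset.sum_lt_sum_of_nonempty ⟨_, hmaps p hp⟩ hsmall
    rw [← Finset.sum_mul, ← Finset.card_eq_sum_card_fiberwise hmaps, Finset.sum_const,
      smul_eq_mul] at hlt
    have := Nat.mul_le_mul hTcard hScard
    nlinarith
  simp only [hT, Finset.mem_product, Finset.mem_Ico] at hdc
  refine ⟨d, by omega, c, (S.filter fun p => (p.2 - p.1, χ (p.1, s - p.2)) = (d, c)).image Prod.fst,
    ?_, ?_, ?_⟩
  · intro a ha
    simp only [hS, Finset.mem_image, Finset.mem_filter, Finset.mem_offDiag] at ha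
    obtain ⟨p, hp, rfl⟩ := ha
    exact hp.1.1.1
  · intro a ha
    simp only [hS, Finset.mem_image, Finset.mem_filter, Finset.mem_offDiag, Prod.mk.injEq] at ha
    obtain ⟨p, ⟨⟨hp, -⟩, hd, hc⟩, rfl⟩ := ha
    have : p.1 + d = p.2 := by omega
    rw [this]
    exact ⟨hp.2.1, hc⟩
  · rwa [Finset.card_image_of_injOn]
    rintro ⟨a, b⟩ hp ⟨a', b'⟩ hq h
    simp only [Finset.coe_filter, Set.mem_ofPred_eq, Prod.mk.injEq] at hp hq h ⊢
    omega

/-- The Graham–Solymosi iteration: if the points `(a, s - b)` with `a < b` in `A` avoid all but `k`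
colours and `A` is dense enough, then there is a monochromatic corner. -/
theorem hasMonochromaticCorner_of_avoids_colours {r N : ℕ} (hr : 0 < r) (hN : 0 < N)
    (χ : ℤ × ℤ → Fin r) (k : ℕ) (A : Finset ℤ) (s : ℤ) (F : Finset (Fin r))
    (hF : r ≤ F.card + k) (hA : ∀ a ∈ A, (0 ≤ a ∧ a < N) ∧ 0 ≤ s - a ∧ s - a < N)
    (havoid : ∀ a ∈ A, ∀ b ∈ A, a < b → χ (a, s - b) ∉ F)
    (hcard : 2 * (4 * r * N) ^ 2 ^ k ≤ A.card ^ 2 ^ k * (4 * r * N)) :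
    HasMonochromaticCorner N χ := by
  induction k generalizing A s F with
  | zero =>
    have hM : 0 < 4 * r * N := by positivity
    have h2 : 1 < A.card := by
      simp only [pow_zero, pow_one] at hcard
      exact Nat.le_of_mul_le_mul_right hcard hM
    obtain ⟨a, ha, b, hb, hab⟩ := Finset.one_lt_card.1 h2
    have hFu : F = Finset.univ := by
      rw [← Finset.card_eq_iff_eq_univ, Fintype.card_fin]
      exact le_antisymm (by simpa using F.card_le_univ) hF
    rcases lt_or_gt_of_ne hab with h | h
    · exact absurd (by simp [hFu]) (havoid a ha b hb h)
    · exact absurd (by simp [hFu]) (havoid b hb a ha h)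
  | succ k ih =>
    have hM : 0 < 4 * r * N := by positivity
    have h2 : 2 ≤ A.card := by
      by_contra! hlt
      have h1 : A.card ^ 2 ^ (k + 1) ≤ 1 := pow_le_one₀ (Nat.zero_le _) (by omega)
      have h3 : 4 * r * N ≤ (4 * r * N) ^ 2 ^ (k + 1) := Nat.le_self_pow (by positivity) _
      nlinarith
    obtain ⟨d, hd, c, C, hCA, hC, hCcard⟩ :=
      exists_popular_difference_and_colour χ A s (fun a ha => (hA a ha).1) h2
    by_contra hno
    have hnotc : ∀ a ∈ C, ∀ b ∈ C, a < b → χ (a, s - d - b) ≠ c := by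
      intro a ha b hb hab hc
      have hac := (hC a ha).2
      have hbc := (hC b hb).2
      have ha1 := hA a (hCA ha)
      have hb1 := hA b (hCA hb)
      have ha2 := hA _ (hC a ha).1
      have hb2 := hA _ (hC b hb).1
      refine hno ⟨a, s - d - b, b - a, by omega, ?_, ?_, ?_, ?_, ?_⟩
      · simp only [Finset.mem_product, Finset.mem_Ico]; omega
      · simp only [Finset.mem_product, Finset.mem_Ico]; omega
      · simp only [Finset.mem_product, Finset.mem_Ico]; omega
      · rw [hc, ← hbc]; congr 2 <;> ring
      · rw [hc, ← hac]; congr 2; ring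
    have havoidC : ∀ a ∈ C, ∀ b ∈ C, a < b → χ (a, s - d - b) ∉ F := by
      intro a ha b hb hab
      have h := havoid a (hCA ha) (b + d) (hC b hb).1 (by omega)
      rwa [show s - d - b = s - (b + d) by ring]
    have hcF : c ∉ F := by
      have hCne : C.Nonempty := by
        rw [← Finset.card_pos]
        by_contra! h0
        rw [Nat.le_zero.1 h0] at hCcard
        nlinarith
      obtain ⟨a, ha⟩ := hCne
      rw [← (hC a ha).2]
      exact havoid a (hCA ha) _ (hC a ha).1 (by omega)
    refine hno (ih C (s - d) (insert c F) ?_ ?_ ?_ ?_)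
    · rw [Finset.card_insert_of_notMem hcF]
      omega
    · intro a ha
      have h1 := hA a (hCA ha)
      have h2 := hA _ (hC a ha).1
      omega
    · intro a ha b hb hab
      rw [Finset.mem_insert, not_or]
      exact ⟨hnotc a ha b hb hab, havoidC a ha b hb hab⟩
    · have hpow := Nat.pow_le_pow_left hCcard (2 ^ k)
      rw [← pow_mul, mul_pow, ← pow_succ'] at hpow
      have hMpos : 0 < (4 * r * N) ^ 2 ^ k := by positivity
      refine Nat.le_of_mul_le_mul_right ?_ hMpos
      calc 2 * (4 * r * N) ^ 2 ^ k * (4 * r * N) ^ 2 ^ k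
          = 2 * (4 * r * N) ^ 2 ^ (k + 1) := by rw [pow_succ 2 k, pow_mul]; ring
        _ ≤ A.card ^ 2 ^ (k + 1) * (4 * r * N) := hcard
        _ ≤ C.card ^ 2 ^ k * (4 * r * N) ^ 2 ^ k * (4 * r * N) := Nat.mul_le_mul_right _ hpow
        _ = C.card ^ 2 ^ k * (4 * r * N) * (4 * r * N) ^ 2 ^ k := by ring

theorem hasMonochromaticCorner_of_pow_le {r N : ℕ} (hr : 0 < r) (hN : (4 * r) ^ 2 ^ r ≤ N)
    (χ : ℤ × ℤ → Fin r) : HasMonochromaticCorner N χ := by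
  have hN0 : 0 < N := lt_of_lt_of_le (by positivity) hN
  refine hasMonochromaticCorner_of_avoids_colours hr hN0 χ r (Finset.Ico (0 : ℤ) N) (N - 1) ∅
    (by simp) ?_ (by simp) ?_
  · intro a ha
    rw [Finset.mem_Ico] at ha
    omega
  · simp only [Int.card_Ico, sub_zero, Int.toNat_natCast]
    rw [mul_pow]
    have h : 2 * (4 * r) ^ 2 ^ r ≤ 4 * r * N := Nat.mul_le_mul (by omega) hN
    calc 2 * ((4 * r) ^ 2 ^ r * N ^ 2 ^ r) = N ^ 2 ^ r * (2 * (4 * r) ^ 2 ^ r) := by ring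
      _ ≤ N ^ 2 ^ r * (4 * r * N) := Nat.mul_le_mul_left _ h

theorem eventually_pow_le_of_lt_log_log :
    ∀ᶠ N : ℕ in Filter.atTop, ∀ r : ℕ, 0 < r → (r : ℝ) < Real.log (Real.log N) →
      (4 * r) ^ 2 ^ r ≤ N := by
  have hb : 0 < 1 - Real.log 2 := by linarith [Real.log_two_lt_d9]
  have hT : ∀ᶠ t : ℝ in Filter.atTop, 4 * t ≤ Real.exp ((1 - Real.log 2) * t) := by
    have h := (isLittleO_pow_exp_pos_mul_atTop 1 hb).bound (show (0 : ℝ) < 1 / 4 by norm_num)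
    filter_upwards [h] with t ht
    rw [pow_one, Real.norm_eq_abs, Real.norm_eq_abs, Real.abs_exp] at ht
    linarith [le_abs_self t]
  have hlog : Filter.Tendsto (fun N : ℕ => Real.log (Real.log N)) Filter.atTop Filter.atTop :=
    Real.tendsto_log_atTop.comp (Real.tendsto_log_atTop.comp tendsto_natCast_atTop_atTop)
  filter_upwards [hlog.eventually hT, Filter.eventually_gt_atTop 1] with N hN hN1 r hr hrN
  set t := Real.log (Real.log N) with ht
  have hN1' : (1 : ℝ) < N := by exact_mod_cast hN1
  have hexp : Real.exp t = Real.log N := Real.exp_log (Real.log_pos hN1')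
  have hr' : (0 : ℝ) < 4 * r := by positivity
  have hpow : (2 : ℝ) ^ r ≤ Real.exp (Real.log 2 * t) := by
    rw [← Real.rpow_natCast, Real.rpow_def_of_pos two_pos]
    have := Real.log_pos one_lt_two
    gcongr
  have hlogr : Real.log (4 * r) ≤ Real.exp ((1 - Real.log 2) * t) := by
    linarith [Real.log_le_sub_one_of_pos hr']
  have hmain : (2 : ℝ) ^ r * Real.log (4 * r) ≤ Real.log N := by
    calc (2 : ℝ) ^ r * Real.log (4 * r)
        ≤ 2 ^ r * Real.exp ((1 - Real.log 2) * t) := by gcongr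
      _ ≤ Real.exp (Real.log 2 * t) * Real.exp ((1 - Real.log 2) * t) := by gcongr
      _ = Real.log N := by rw [← Real.exp_add, ← hexp]; congr 1; ring
  have hreal : ((4 * r : ℝ)) ^ 2 ^ r ≤ N := by
    rw [← Real.log_le_log_iff (by positivity) (by positivity), Real.log_pow]
    exact_mod_cast hmain
  exact_mod_cast hreal


/-- Graham–Solymosi: for `N` large enough, any colouring of the grid `[N] × [N]`
with fewer than `log log N` colours contains a monochromatic axis-parallel corner
`(x, y), (x + d, y), (x, y + d)` with `d ≠ 0`. -/
theorem monochromatic_corner_of_few_colours :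
    ∃ N₀ : ℕ, ∀ N : ℕ, N₀ ≤ N →
      ∀ r : ℕ, (r : ℝ) < Real.log (Real.log N) →
        ∀ χ : ℤ × ℤ → Fin r,
          ∃ x y d : ℤ, d ≠ 0 ∧
            (x, y) ∈ Finset.Ico (0 : ℤ) (N : ℤ) ×ˢ Finset.Ico (0 : ℤ) (N : ℤ) ∧
            (x + d, y) ∈ Finset.Ico (0 : ℤ) (N : ℤ) ×ˢ Finset.Ico (0 : ℤ) (N : ℤ) ∧
            (x, y + d) ∈ Finset.Ico (0 : ℤ) (N : ℤ) ×ˢ Finset.Ico (0 : ℤ) (N : ℤ) ∧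
            χ (x + d, y) = χ (x, y) ∧ χ (x, y + d) = χ (x, y) := by
  obtain ⟨N₀, hN₀⟩ := Filter.eventually_atTop.1 eventually_pow_le_of_lt_log_log
  refine ⟨N₀, fun N hN r hr χ => ?_⟩
  have hr0 : 0 < r := Fin.pos (χ (0, 0))
  exact hasMonochromaticCorner_of_pow_le hr0 (hN₀ N hN r hr0 hr) χ
end

section
/- For every positive integer r there exists a positive integer T = T(r) such that for every colouring of the lattice points ℤ² with r colours, there exist three points of the same colour forming a right triangle (three non-collinear points such that two of the sides meeting at one vertex are perpendicular) whose area is exactly T. -/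
/-- **Van der Waerden's theorem** with bounded start and step: the progression of length `L + 1`
can be found with start and step at most some `W` independent of the colouring. -/
theorem exists_mono_arithmetic_progression_of_bounded (κ : Type*) [Finite κ] (L : ℕ) :
    ∃ W : ℕ, ∀ C : ℕ → κ, ∃ a d : ℕ, a ≤ W ∧ 0 < d ∧ d ≤ W ∧
      ∀ t ≤ L, C (a + d * t) = C a := by
  classical
  obtain ⟨ι, _, hι⟩ := Combinatorics.Line.exists_mono_in_high_dimension (Fin (L + 1)) κ
  refine ⟨Fintype.card ι * (L + 1), fun C => ?_⟩
  obtain ⟨l, c, hl⟩ := hι fun v => C (∑ i, (v i : ℕ))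
  have hsum : ∀ t : Fin (L + 1), ∑ i, (l t i : ℕ) =
      ∑ i, (l 0 i : ℕ) + (Finset.univ.filter fun i => l.idxFun i = none).card * t := by
    intro t
    rw [← smul_eq_mul, ← Finset.sum_const, Finset.sum_filter, ← Finset.sum_add_distrib]
    refine Finset.sum_congr rfl fun i _ => ?_
    cases h : l.idxFun i with
    | none => simp [h]
    | some y => simp [h]
  refine ⟨∑ i, (l 0 i : ℕ), (Finset.univ.filter fun i => l.idxFun i = none).card, ?_, ?_, ?_, ?_⟩
  · calc ∑ i, (l 0 i : ℕ) ≤ ∑ _i : ι, (L + 1) := Finset.sum_le_sum fun i _ => (l 0 i).isLt.le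
      _ = Fintype.card ι * (L + 1) := by simp
  · obtain ⟨i, hi⟩ := l.proper
    exact Finset.card_pos.mpr ⟨i, by simpa using hi⟩
  · exact (Finset.card_le_univ _).trans (Nat.le_mul_of_pos_right _ L.succ_pos)
  · intro t ht
    have h := hsum ⟨t, Nat.lt_succ_of_le ht⟩
    rw [← h]
    exact (hl ⟨t, Nat.lt_succ_of_le ht⟩).trans (hl 0).symm

/-- If a colouring of `ℕ × ℕ` uses at most `k` colours on a sufficiently large square, it contains
a monochromatic right triangle with axis-parallel legs whose lengths have product exactly `M`. -/
theorem exists_mono_axis_parallel_triangle (κ : Type*) [Finite κ] (k : ℕ) :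
    ∃ M N : ℕ, 0 < M ∧ ∀ S : Finset κ, S.card ≤ k → ∀ f : ℕ → ℕ → κ,
      (∀ x ≤ N, ∀ y ≤ N, f x y ∈ S) →
        ∃ x y u v : ℕ, f (x + u) y = f x y ∧ f x (y + v) = f x y ∧ u * v = M := by
  classical
  induction k with
  | zero =>
    refine ⟨1, 0, one_pos, fun S hS f hf => ?_⟩
    have h := hf 0 le_rfl 0 le_rfl
    simp [Finset.card_eq_zero.mp (Nat.le_zero.mp hS)] at h
  | succ k ih =>
    obtain ⟨M, N, hM, ih⟩ := ih
    set q := (N + 1).factorial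
    obtain ⟨W, hW⟩ := exists_mono_arithmetic_progression_of_bounded κ (q * N + q * M)
    refine ⟨W.factorial * q * M, W + W * q * N + W.factorial * (N + 1), by positivity,
      fun S hS f hf => ?_⟩
    obtain ⟨a, d, ha, hd, hdW, hap⟩ := hW fun x => f x 0
    obtain ⟨e, he⟩ := Nat.dvd_factorial hd hdW
    have heW : e ≤ W.factorial := by rw [he]; exact Nat.le_mul_of_pos_left e hd
    by_cases hc : ∃ x ≤ N, ∃ y ≤ N, f (a + d * (q * x)) (e * (y + 1)) = f a 0
    · obtain ⟨x, hx, y, hy, hxy⟩ := hc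
      obtain ⟨b, hb⟩ : y + 1 ∣ q := Nat.dvd_factorial y.succ_pos (by lia)
      have hbq : b ≤ q := by rw [hb]; exact Nat.le_mul_of_pos_left b y.succ_pos
      have h₁ := hap (q * x) (by nlinarith)
      have h₂ := hap (q * x + b * M) (by gcongr)
      refine ⟨a + d * (q * x), 0, d * (b * M), e * (y + 1), ?_, ?_, ?_⟩
      · rw [h₁, ← h₂]
        congr 1
        ring
      · rw [h₁, ← hxy, zero_add]
      · rw [he, hb]
        ring
    · push Not at hc
      obtain ⟨x, y, u, v, h₁, h₂, h₃⟩ := ih (S.erase (f a 0))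
        (by
          have := hf a (by lia) 0 (Nat.zero_le _)
          rw [Finset.card_erase_of_mem this]
          lia)
        (fun x y => f (a + d * (q * x)) (e * (y + 1)))
        (fun x hx y hy => Finset.mem_erase.mpr ⟨hc x hx y hy, hf _
          (by
            have : d * (q * x) ≤ W * (q * N) := by gcongr
            have : W * (q * N) = W * q * N := by ring
            lia) _
          (by
            have : e * (y + 1) ≤ W.factorial * (N + 1) := by gcongr
            lia)⟩)
      refine ⟨a + d * (q * x), e * (y + 1), d * (q * u), e * v, ?_, ?_, ?_⟩
      · rw [← h₁]
        congr 1
        ring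
      · rw [← h₂]
        congr 1
        ring
      · rw [he, ← h₃]
        ring


/-- Graham: for every `r` there is a positive integer `T = T(r)` such that any
`r`-colouring of `ℤ²` contains a monochromatic right triangle of area exactly `T`.
Non-collinearity and the right angle at `p` are expressed via the determinant and
the dot product of the side vectors `q - p` and `s - p`; the area is `|det|/2`. -/
theorem monochromatic_right_triangle_of_area :
    ∀ r : ℕ, 0 < r → ∃ T : ℕ, 0 < T ∧
      ∀ χ : ℤ × ℤ → Fin r,
        ∃ p q s : ℤ × ℤ,
          χ q = χ p ∧ χ s = χ p ∧
          -- the sides meeting at `p` are perpendicular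
          (q.1 - p.1) * (s.1 - p.1) + (q.2 - p.2) * (s.2 - p.2) = 0 ∧
          -- the points are not collinear
          (q.1 - p.1) * (s.2 - p.2) - (q.2 - p.2) * (s.1 - p.1) ≠ 0 ∧
          -- the area equals exactly `T`
          |(q.1 - p.1) * (s.2 - p.2) - (q.2 - p.2) * (s.1 - p.1)| = 2 * (T : ℤ) := by
  intro r _
  obtain ⟨M, N, hM, h⟩ := exists_mono_axis_parallel_triangle (Fin r) r
  refine ⟨2 * M, by positivity, fun χ => ?_⟩
  obtain ⟨x, y, u, v, h₁, h₂, h₃⟩ := h Finset.univ (by simp)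
    (fun x y => χ (2 * (x : ℤ), 2 * (y : ℤ))) (fun _ _ _ _ => Finset.mem_univ _)
  have hdet : (2 * ((x + u : ℕ) : ℤ) - 2 * x) * (2 * ((y + v : ℕ) : ℤ) - 2 * y)
      - (2 * (y : ℤ) - 2 * y) * (2 * (x : ℤ) - 2 * x) = 2 * ((2 * M : ℕ) : ℤ) := by
    rw [← h₃]
    push_cast
    ring
  refine ⟨(2 * (x : ℤ), 2 * (y : ℤ)), (2 * ((x + u : ℕ) : ℤ), 2 * (y : ℤ)),
    (2 * (x : ℤ), 2 * ((y + v : ℕ) : ℤ)), h₁, h₂, by simp, ?_, ?_⟩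
  · rw [hdet]
    positivity
  · rw [hdet]
    exact abs_of_nonneg (by positivity)
end

section
/- Let p be a prime and let S ⊆ 𝔽_p × 𝔽_p be a corner-saturated set, i.e., S contains no (tilted) corner, but for every point x ∉ S the set S ∪ {x} contains a (tilted) corner. Then |S| ≥ p/√3. -/
/-- In `𝔽₂ × 𝔽₂`, where corners may degenerate, the saturation property alone forces two points. -/
theorem two_le_card_of_corner_saturated_two :
    ∀ S : Finset (ZMod 2 × ZMod 2),
      (∀ z : ZMod 2 × ZMod 2, z ∉ S →
        ∃ (x d : ZMod 2 × ZMod 2), d ≠ 0 ∧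
          x ∈ insert z S ∧ x + d ∈ insert z S ∧ x + (-d.2, d.1) ∈ insert z S) →
      2 ≤ S.card := by
  decide

/-- Every ordered pair of points of `S` completes to a corner in at most three ways, so in odd
characteristic a corner-saturated set `S` satisfies `p² ≤ 3 |S|²`. -/
theorem sq_le_three_mul_card_sq_of_corner_saturated {p : ℕ} (hp : p.Prime) (hp2 : p ≠ 2)
    (S : Finset (ZMod p × ZMod p))
    (hfree : ¬ ∃ (x d : ZMod p × ZMod p), d ≠ 0 ∧
      x ∈ S ∧ x + d ∈ S ∧ x + (-d.2, d.1) ∈ S)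
    (hsat : ∀ z : ZMod p × ZMod p, z ∉ S →
      ∃ (x d : ZMod p × ZMod p), d ≠ 0 ∧
        x ∈ insert z S ∧ x + d ∈ insert z S ∧ x + (-d.2, d.1) ∈ insert z S) :
    p ^ 2 ≤ 3 * S.card ^ 2 := by
  have : Fact p.Prime := ⟨hp⟩
  have h2 : (2 : ZMod p) ≠ 0 := Ring.two_ne_zero (by rwa [ZMod.ringChar_zmod_n])
  let apex : (ZMod p × ZMod p) × (ZMod p × ZMod p) → ZMod p × ZMod p := fun q =>
    (q.1.1 - ((q.1.1 - q.2.1) - (q.1.2 - q.2.2)) / 2,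
      q.1.2 - ((q.1.1 - q.2.1) + (q.1.2 - q.2.2)) / 2)
  let left : (ZMod p × ZMod p) × (ZMod p × ZMod p) → ZMod p × ZMod p := fun q =>
    (q.1.1 + (q.2.2 - q.1.2), q.1.2 - (q.2.1 - q.1.1))
  let right : (ZMod p × ZMod p) × (ZMod p × ZMod p) → ZMod p × ZMod p := fun q =>
    (q.1.1 - (q.2.2 - q.1.2), q.1.2 + (q.2.1 - q.1.1))
  have hcover : (Finset.univ : Finset (ZMod p × ZMod p)) ⊆
      (S ×ˢ S).image apex ∪ (S ×ˢ S).image left ∪ (S ×ˢ S).image right := by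
    intro z _
    simp only [Finset.mem_union, Finset.mem_image, Finset.mem_product]
    by_cases hz : z ∈ S
    · exact Or.inr ⟨(z, z), ⟨hz, hz⟩, by simp [right]⟩
    obtain ⟨x, d, hd, hx, ha, hb⟩ := hsat z hz
    have hxa : x + d ≠ x := by simpa using hd
    have hxb : x + (-d.2, d.1) ≠ x := by
      intro h
      apply hd
      have h' := add_eq_left.mp h
      simp only [Prod.mk_eq_zero, neg_eq_zero] at h'
      exact Prod.ext h'.2 h'.1
    have hab : x + d ≠ x + (-d.2, d.1) := by
      intro h
      have h' := add_left_cancel h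
      have e1 : d.1 = -d.2 := congrArg Prod.fst h'
      have e2 : d.2 = d.1 := congrArg Prod.snd h'
      have h0 : d.1 = 0 :=
        (mul_eq_zero.mp (show 2 * d.1 = 0 by linear_combination e1 - e2)).resolve_left h2
      exact hd (Prod.ext h0 (e2.trans h0))
    rw [Finset.mem_insert] at hx ha hb
    rcases hx with hx | hx
    · refine Or.inl (Or.inl ⟨(x + d, x + (-d.2, d.1)), ⟨ha.resolve_left (hx ▸ hxa),
        hb.resolve_left (hx ▸ hxb)⟩, ?_⟩)
      rw [← hx]
      ext <;> simp only [apex, Prod.fst_add, Prod.snd_add] <;> field_simp <;> ring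
    rcases ha with ha | ha
    · refine Or.inl (Or.inr ⟨(x, x + (-d.2, d.1)), ⟨hx,
        hb.resolve_left (ha ▸ hab.symm)⟩, ?_⟩)
      rw [← ha]
      ext <;> simp [left]
    rcases hb with hb | hb
    · refine Or.inr ⟨(x, x + d), ⟨hx, ha⟩, ?_⟩
      rw [← hb]
      ext <;> simp [right, sub_eq_add_neg]
    · exact absurd ⟨x, d, hd, hx, ha, hb⟩ hfree
  calc p ^ 2 = (Finset.univ : Finset (ZMod p × ZMod p)).card := by
        simp [ZMod.card, sq]
    _ ≤ _ := Finset.card_le_card hcover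
    _ ≤ ((S ×ˢ S).image apex).card + ((S ×ˢ S).image left).card
        + ((S ×ˢ S).image right).card :=
      (Finset.card_union_le _ _).trans (Nat.add_le_add_right (Finset.card_union_le _ _) _)
    _ ≤ (S ×ˢ S).card + (S ×ˢ S).card + (S ×ˢ S).card := by
      gcongr <;> exact Finset.card_image_le
    _ = 3 * S.card ^ 2 := by rw [Finset.card_product]; ring

/-- Lower bound for corner-saturated sets in `𝔽_p × 𝔽_p`: if `S` contains no
(tilted) corner `x, x + d, x + d⊥` (with `d ≠ 0`, `d⊥ = (-d₂, d₁)`) but adding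
any point outside `S` creates such a corner, then `|S| ≥ p / √3`. -/
theorem corner_saturated_lower_bound (p : ℕ) (hp : p.Prime)
    (S : Finset (ZMod p × ZMod p))
    (hfree : ¬ ∃ (x d : ZMod p × ZMod p), d ≠ 0 ∧
      x ∈ S ∧ x + d ∈ S ∧ x + (-d.2, d.1) ∈ S)
    (hsat : ∀ z : ZMod p × ZMod p, z ∉ S →
      ∃ (x d : ZMod p × ZMod p), d ≠ 0 ∧
        x ∈ insert z S ∧ x + d ∈ insert z S ∧ x + (-d.2, d.1) ∈ insert z S) :
    (p : ℝ) / Real.sqrt 3 ≤ (S.card : ℝ) := by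
  have hsq : p ^ 2 ≤ 3 * S.card ^ 2 := by
    by_cases hp2 : p = 2
    · subst hp2
      have := two_le_card_of_corner_saturated_two S hsat
      nlinarith
    · exact sq_le_three_mul_card_sq_of_corner_saturated hp hp2 S hfree hsat
  rw [div_le_iff₀ (by positivity)]
  refine le_of_sq_le_sq ?_ (by positivity)
  rw [mul_pow, Real.sq_sqrt (by norm_num), mul_comm]
  exact_mod_cast hsq
end

section
/- Let p be a prime. The set S = {(0, i) : i ∈ 𝔽_p} ⊆ 𝔽_p × 𝔽_p is corner-saturated: S contains no (tilted) corner, and for every point (a, b) with a ≠ 0 there exist two points of S forming a (tilted) corner together with (a, b). Consequently the minimum size of a corner-saturated subset of 𝔽_p × 𝔽_p is at most p. -/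
/-- The column `S = {(0, i) : i ∈ 𝔽_p}` is corner-saturated: it contains no
(tilted) corner `x, x + d, x + d⊥` (`d ≠ 0`, `d⊥ = (-d₂, d₁)`), and every point
`(a, b)` with `a ≠ 0` forms a corner together with two points of `S`.
Consequently, the minimum size of a corner-saturated subset of `𝔽_p × 𝔽_p`
is at most `p`. -/
theorem column_is_corner_saturated (p : ℕ) [Fact p.Prime] :
    (¬ ∃ (x d : ZMod p × ZMod p), d ≠ 0 ∧
        x ∈ Finset.univ.image (fun i : ZMod p => ((0 : ZMod p), i)) ∧
        x + d ∈ Finset.univ.image (fun i : ZMod p => ((0 : ZMod p), i)) ∧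
        x + (-d.2, d.1) ∈ Finset.univ.image (fun i : ZMod p => ((0 : ZMod p), i))) ∧
    (∀ a b : ZMod p, a ≠ 0 →
      ∃ x d : ZMod p × ZMod p, d ≠ 0 ∧
        (a, b) ∈ ({x, x + d, x + (-d.2, d.1)} : Set (ZMod p × ZMod p)) ∧
        ({x, x + d, x + (-d.2, d.1)} : Set (ZMod p × ZMod p)) ⊆
          insert ((a, b) : ZMod p × ZMod p)
            (Finset.univ.image (fun i : ZMod p => ((0 : ZMod p), i)) : Set (ZMod p × ZMod p))) ∧
    (∃ S : Finset (ZMod p × ZMod p),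
      (¬ ∃ (x d : ZMod p × ZMod p), d ≠ 0 ∧
          x ∈ S ∧ x + d ∈ S ∧ x + (-d.2, d.1) ∈ S) ∧
      (∀ z : ZMod p × ZMod p, z ∉ S →
        ∃ (x d : ZMod p × ZMod p), d ≠ 0 ∧
          x ∈ insert z S ∧ x + d ∈ insert z S ∧ x + (-d.2, d.1) ∈ insert z S) ∧
      S.card ≤ p) := by
  have no_corner : ¬ ∃ (x d : ZMod p × ZMod p), d ≠ 0 ∧
      x ∈ Finset.univ.image (fun i : ZMod p => ((0 : ZMod p), i)) ∧
      x + d ∈ Finset.univ.image (fun i : ZMod p => ((0 : ZMod p), i)) ∧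
      x + (-d.2, d.1) ∈ Finset.univ.image (fun i : ZMod p => ((0 : ZMod p), i)) := by
    rintro ⟨⟨x₁, x₂⟩, ⟨d₁, d₂⟩, hd, hx, hxd, hxd'⟩
    simp only [Finset.mem_image, Finset.mem_univ, true_and, Prod.mk_add_mk, Prod.mk.injEq,
      exists_eq_right] at hx hxd hxd'
    apply hd
    ext
    · simpa [← hx] using hxd.symm
    · simpa [← hx] using hxd'.symm
  refine ⟨no_corner, fun a b ha => ?_, _, no_corner, ?_, ?_⟩
  · refine ⟨(0, b), (a, 0), by simp [ha], by simp, ?_⟩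
    rintro z (rfl | rfl | rfl) <;> simp
  · rintro ⟨a, b⟩ hz
    have ha : a ≠ 0 := by
      rintro rfl
      simp at hz
    exact ⟨(0, b), (a, 0), by simp [ha], by simp, by simp, by simp⟩
  · exact Finset.card_image_le.trans (by simp [ZMod.card])
end

section
/- Let A and B be finite subsets of a torsion-free abelian group, let G ⊆ A × B, and let N be such that |A| ≤ N, |B| ≤ N, and |{a + b : (a, b) ∈ G}| ≤ N. Then |{a − b : (a, b) ∈ G}| ≤ N^{11/6}. -/
/-- A weighted Cauchy–Schwarz inequality for the fibres of a map `f : V → T`. -/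
theorem sum_sq_le_card_mul_sum_fiber {β γ : Type*} [DecidableEq γ] {V : Finset β}
    {T : Finset γ} {f : β → γ} (hf : ∀ v ∈ V, f v ∈ T) {r u w : β → ℝ}
    (hu : ∀ v ∈ V, 0 ≤ u v) (hw : ∀ v ∈ V, 0 ≤ w v)
    (hr : ∀ v ∈ V, r v ^ 2 ≤ u v * w v) :
    (∑ v ∈ V, r v) ^ 2 ≤
      T.card * ∑ p ∈ (V ×ˢ V).filter (fun p => f p.1 = f p.2), u p.1 * w p.2 := by
  have hfiber : ∑ p ∈ (V ×ˢ V).filter (fun p => f p.1 = f p.2), u p.1 * w p.2 =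
      ∑ t ∈ T, (∑ x ∈ V with f x = t, u x) * ∑ x ∈ V with f x = t, w x := by
    rw [← Finset.sum_fiberwise_of_maps_to (t := T) (g := fun p => f p.1)
      (fun p hp => hf _ (by simp at hp; exact hp.1.1))]
    refine Finset.sum_congr rfl fun t _ => ?_
    rw [Finset.sum_mul_sum, ← Finset.sum_product']
    refine Finset.sum_congr ?_ fun _ _ => rfl
    ext p
    simp only [Finset.mem_filter, Finset.mem_product]
    grind
  rw [hfiber, ← Finset.sum_fiberwise_of_maps_to hf]
  refine sq_sum_le_card_mul_sum_sq.trans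
    (mul_le_mul_of_nonneg_left (Finset.sum_le_sum fun t _ => ?_) (Nat.cast_nonneg _))
  exact Finset.sum_sq_le_sum_mul_sum_of_sq_le_mul _
    (fun v hv => hu v (Finset.mem_filter.1 hv).1) (fun v hv => hw v (Finset.mem_filter.1 hv).1)
    (fun v hv => hr v (Finset.mem_filter.1 hv).1)

/-- The number of pairs in a common fibre is at least `|V|² / |T|`. -/
theorem card_sq_le_card_mul_card_fiber_pairs {β γ : Type*} [DecidableEq γ] {V : Finset β}
    {T : Finset γ} {f : β → γ} (hf : ∀ v ∈ V, f v ∈ T) :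
    V.card ^ 2 ≤ T.card * ((V ×ˢ V).filter (fun p => f p.1 = f p.2)).card := by
  have h := sum_sq_le_card_mul_sum_fiber hf (r := fun _ => 1) (u := fun _ => 1)
    (w := fun _ => 1) (by simp) (by simp) (by simp)
  simp only [Finset.sum_const, nsmul_eq_mul, mul_one] at h
  exact_mod_cast h

/-- Summing the inverse fibre sizes counts the nonempty fibres. -/
theorem sum_inv_card_fiber_le {β γ : Type*} [DecidableEq γ] {V : Finset β}
    {T : Finset γ} {f : β → γ} (hf : ∀ v ∈ V, f v ∈ T) :
    ∑ v ∈ V, ((V.filter (fun w => f w = f v)).card : ℝ)⁻¹ ≤ T.card := by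
  rw [← Finset.sum_fiberwise_of_maps_to hf]
  have hle : ∀ t ∈ T,
      ∑ v ∈ V with f v = t, ((V.filter (fun w => f w = f v)).card : ℝ)⁻¹ ≤ 1 := by
    intro t _
    rw [Finset.sum_congr rfl (g := fun _ => ((V.filter (fun w => f w = t)).card : ℝ)⁻¹)
      (fun v hv => by rw [(Finset.mem_filter.1 hv).2]), Finset.sum_const, nsmul_eq_mul]
    exact mul_inv_le_one
  simpa using Finset.sum_le_sum hle

/-- Lower bound for the number of chains `v₀, v₁, v₂, v₃` in `V` with
`f₁ v₀ = f₁ v₁`, `f₂ v₁ = f₂ v₂` and `f₃ v₂ = f₃ v₃`. -/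
theorem card_pow_four_le_mul_sum_chains {β γ₁ γ₂ γ₃ : Type*} [DecidableEq γ₁] [DecidableEq γ₂]
    [DecidableEq γ₃] {V : Finset β} {T₁ : Finset γ₁} {T₂ : Finset γ₂} {T₃ : Finset γ₃}
    {f₁ : β → γ₁} {f₂ : β → γ₂} {f₃ : β → γ₃} (h₁ : ∀ v ∈ V, f₁ v ∈ T₁)
    (h₂ : ∀ v ∈ V, f₂ v ∈ T₂) (h₃ : ∀ v ∈ V, f₃ v ∈ T₃) :
    V.card ^ 4 ≤ T₁.card * T₂.card * T₃.card *
      ∑ p ∈ (V ×ˢ V).filter (fun p => f₂ p.1 = f₂ p.2),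
        (V.filter (fun v => f₁ v = f₁ p.1)).card * (V.filter (fun v => f₃ v = f₃ p.2)).card := by
  set d₁ : β → ℝ := fun v => (V.filter (fun w => f₁ w = f₁ v)).card with hd₁
  set d₃ : β → ℝ := fun v => (V.filter (fun w => f₃ w = f₃ v)).card with hd₃
  have hpos₁ : ∀ v ∈ V, 0 < d₁ v := fun v hv =>
    Nat.cast_pos.2 (Finset.card_pos.2 ⟨v, Finset.mem_filter.2 ⟨hv, rfl⟩⟩)
  have hpos₃ : ∀ v ∈ V, 0 < d₃ v := fun v hv =>
    Nat.cast_pos.2 (Finset.card_pos.2 ⟨v, Finset.mem_filter.2 ⟨hv, rfl⟩⟩)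
  have hmid := sum_sq_le_card_mul_sum_fiber h₂ (r := fun v => √(d₁ v * d₃ v))
    (fun v hv => (hpos₁ v hv).le) (fun v hv => (hpos₃ v hv).le)
    (fun v hv => (Real.sq_sqrt (mul_pos (hpos₁ v hv) (hpos₃ v hv)).le).le)
  have hcard : (V.card : ℝ) ^ 2 ≤
      (∑ v ∈ V, √(d₁ v * d₃ v)) * ∑ v ∈ V, (√(d₁ v * d₃ v))⁻¹ := by
    have h := Finset.sum_sq_le_sum_mul_sum_of_sq_le_mul V (r := fun _ => (1 : ℝ))
      (f := fun v => √(d₁ v * d₃ v)) (g := fun v => (√(d₁ v * d₃ v))⁻¹)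
      (fun v _ => by positivity) (fun v _ => by positivity)
      (fun v hv => by
        have := Real.sqrt_pos.2 (mul_pos (hpos₁ v hv) (hpos₃ v hv))
        rw [mul_inv_cancel₀ this.ne', one_pow])
    simpa using h
  have hinv : (∑ v ∈ V, (√(d₁ v * d₃ v))⁻¹) ^ 2 ≤ T₁.card * T₃.card := by
    refine (Finset.sum_sq_le_sum_mul_sum_of_sq_le_mul V
      (f := fun v => (d₁ v)⁻¹) (g := fun v => (d₃ v)⁻¹)
      (fun v hv => (inv_pos.2 (hpos₁ v hv)).le) (fun v hv => (inv_pos.2 (hpos₃ v hv)).le)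
      (fun v hv => by
        rw [inv_pow, Real.sq_sqrt (mul_pos (hpos₁ v hv) (hpos₃ v hv)).le, mul_inv])).trans ?_
    exact mul_le_mul (sum_inv_card_fiber_le h₁) (sum_inv_card_fiber_le h₃)
      (Finset.sum_nonneg fun v hv => (inv_pos.2 (hpos₃ v hv)).le) (Nat.cast_nonneg _)
  have key : (V.card : ℝ) ^ 4 ≤ T₁.card * T₂.card * T₃.card *
      ∑ p ∈ (V ×ˢ V).filter (fun p => f₂ p.1 = f₂ p.2), d₁ p.1 * d₃ p.2 :=
    calc (V.card : ℝ) ^ 4 = (V.card ^ 2) ^ 2 := by ring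
      _ ≤ ((∑ v ∈ V, √(d₁ v * d₃ v)) * ∑ v ∈ V, (√(d₁ v * d₃ v))⁻¹) ^ 2 := by gcongr
      _ = (∑ v ∈ V, √(d₁ v * d₃ v)) ^ 2 * (∑ v ∈ V, (√(d₁ v * d₃ v))⁻¹) ^ 2 := mul_pow ..
      _ ≤ _ := mul_le_mul hmid hinv (sq_nonneg _) ((sq_nonneg _).trans hmid)
      _ = _ := by ring
  simp only [hd₁, hd₃] at key
  exact_mod_cast key

/-- If `a - b` determines `(a, b)` in `G`, then `|G| ^ 6 ≤ N ^ 11`. -/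
theorem card_pow_six_le_of_injOn_sub {α : Type*} [AddCommGroup α] [DecidableEq α]
    {A B : Finset α} {G : Finset (α × α)} (hG : G ⊆ A ×ˢ B) {N : ℕ}
    (hA : A.card ≤ N) (hB : B.card ≤ N)
    (hsum : (G.image (fun ab => ab.1 + ab.2)).card ≤ N)
    (hinj : Set.InjOn (fun ab : α × α => ab.1 - ab.2) G) :
    G.card ^ 6 ≤ N ^ 11 := by
  set S := G.image (fun ab => ab.1 + ab.2)
  set V := (G ×ˢ G).filter (fun v => v.1.1 = v.2.1)
  have hV : ∀ v ∈ V, (v.1 ∈ G ∧ v.2 ∈ G) ∧ v.1.1 = v.2.1 := by simp [V]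
  have hGA : ∀ g ∈ G, g.1 ∈ A := fun g hg => (Finset.mem_product.1 (hG hg)).1
  have hGB : ∀ g ∈ G, g.2 ∈ B := fun g hg => (Finset.mem_product.1 (hG hg)).2
  have hGS : ∀ g ∈ G, g.1 + g.2 ∈ S := fun g hg =>
    Finset.mem_image_of_mem (fun ab : α × α => ab.1 + ab.2) hg
  have hVcard : G.card ^ 2 ≤ N * V.card :=
    (card_sq_le_card_mul_card_fiber_pairs hGA).trans (Nat.mul_le_mul_right _ hA)
  have hlower := card_pow_four_le_mul_sum_chains (V := V)
    (T₁ := B ×ˢ B) (T₂ := S ×ˢ S) (T₃ := S ×ˢ B)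
    (f₁ := fun v => (v.1.2, v.2.2)) (f₂ := fun v => (v.1.1 + v.1.2, v.2.1 + v.2.2))
    (f₃ := fun v => (v.1.1 + v.1.2, v.2.2))
    (fun v hv => Finset.mem_product.2 ⟨hGB v.1 (hV v hv).1.1, hGB v.2 (hV v hv).1.2⟩)
    (fun v hv => Finset.mem_product.2 ⟨hGS v.1 (hV v hv).1.1, hGS v.2 (hV v hv).1.2⟩)
    (fun v hv => Finset.mem_product.2 ⟨hGS v.1 (hV v hv).1.1, hGB v.2 (hV v hv).1.2⟩)
  simp_rw [← Finset.card_product] at hlower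
  rw [← Finset.card_sigma] at hlower
  set Q := Finset.sigma _ _
  have hQ : Q.card ≤ (V ×ˢ A ×ˢ B).card := by
    refine Finset.card_le_card_of_injOn (fun q => (q.2.1, q.1.2.1.1, q.2.2.1.2)) ?_ ?_
    · rintro ⟨⟨v₁, v₂⟩, v₀, v₃⟩ hq
      simp only [Q, Finset.coe_sigma, Set.mem_sigma_iff, Finset.mem_coe, Finset.mem_filter,
        Finset.mem_product] at hq ⊢
      exact ⟨hq.2.1.1, hGA _ (hV _ hq.1.1.2).1.1, hGB _ (hV _ hq.2.2.1).1.1⟩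
    · rintro ⟨⟨⟨⟨a₁, b₁⟩, a₁', b₁'⟩, ⟨a₂, b₂⟩, a₂', b₂'⟩, ⟨⟨a₀, b₀⟩, a₀', b₀'⟩,
        ⟨a₃, b₃⟩, a₃', b₃'⟩ hq
        ⟨⟨⟨⟨x₁, y₁⟩, x₁', y₁'⟩, ⟨x₂, y₂⟩, x₂', y₂'⟩, ⟨⟨x₀, y₀⟩, x₀', y₀'⟩,
        ⟨x₃, y₃⟩, x₃', y₃'⟩ hr heq
      simp only [Q, V, Finset.coe_sigma, Set.mem_sigma_iff, Finset.mem_coe, Finset.mem_filter,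
        Finset.mem_product, Prod.mk.injEq] at hq hr heq
      obtain ⟨⟨⟨⟨-, rfl⟩, ⟨-, rfl⟩⟩, hs, hs'⟩, ⟨⟨-, rfl⟩, rfl, rfl⟩, ⟨⟨-, hG₃⟩, rfl⟩, ht, rfl⟩ :=
        hq
      obtain ⟨⟨⟨⟨-, rfl⟩, ⟨-, rfl⟩⟩, hu, hu'⟩, ⟨⟨-, rfl⟩, rfl, rfl⟩, ⟨⟨-, hH₃⟩, rfl⟩, hw, rfl⟩ :=
        hr
      obtain ⟨⟨⟨rfl, rfl⟩, -, rfl⟩, rfl, rfl⟩ := heq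
      have hdiff : a₃ - b₃' = x₃ - y₃' := by grind
      have h₃ := hinj hG₃ hH₃ hdiff
      simp only [Prod.mk.injEq] at h₃
      obtain ⟨rfl, rfl⟩ := h₃
      obtain rfl : b₂ = y₂ := by grind
      obtain rfl : a₁ = x₁ := by grind
      rfl
  simp only [Finset.card_product] at hlower hQ
  have hchain : V.card ^ 3 * V.card ≤ N ^ 8 * V.card :=
    calc V.card ^ 3 * V.card = V.card ^ 4 := by ring
      _ ≤ (N * N) * (N * N) * (N * N) * (V.card * (N * N)) := by
        refine hlower.trans ?_
        gcongr
        exact hQ.trans (by gcongr)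
      _ = N ^ 8 * V.card := by ring
  have hV3 : V.card ^ 3 ≤ N ^ 8 := by
    rcases Nat.eq_zero_or_pos V.card with h | h
    · simp [h]
    · exact Nat.le_of_mul_le_mul_right hchain h
  calc G.card ^ 6 = (G.card ^ 2) ^ 3 := by ring
    _ ≤ (N * V.card) ^ 3 := by gcongr
    _ = N ^ 3 * V.card ^ 3 := by ring
    _ ≤ N ^ 3 * N ^ 8 := by gcongr
    _ = N ^ 11 := by ring


/-- Katz–Tao sum-difference theorem: if `A, B` are finite subsets of a
torsion-free abelian group, `G ⊆ A × B`, and `|A|, |B|, |{a + b : (a,b) ∈ G}| ≤ N`,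
then `|{a - b : (a,b) ∈ G}| ≤ N^(11/6)`. -/
theorem katz_tao_sum_difference {α : Type*} [AddCommGroup α] [DecidableEq α]
    (htf : ∀ (g : α) (n : ℕ), n ≠ 0 → n • g = 0 → g = 0)
    (A B : Finset α) (G : Finset (α × α)) (hG : G ⊆ A ×ˢ B) (N : ℕ)
    (hA : A.card ≤ N) (hB : B.card ≤ N)
    (hsum : (G.image (fun ab => ab.1 + ab.2)).card ≤ N) :
    ((G.image (fun ab => ab.1 - ab.2)).card : ℝ) ≤ (N : ℝ) ^ ((11 : ℝ) / 6) := by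
  set f : α × α → α := fun ab => ab.1 - ab.2
  obtain ⟨s, hsG, hs⟩ := (G : Set (α × α)).exists_subset_bijOn f
  lift s to Finset (α × α) using G.finite_toSet.subset hsG
  have himage : s.image f = G.image f := by
    exact_mod_cast hs.image_eq
  rw [Finset.coe_subset] at hsG
  have h6 := card_pow_six_le_of_injOn_sub (hsG.trans hG) hA hB
    ((Finset.card_le_card (Finset.image_subset_image hsG)).trans hsum) hs.injOn
  rw [← himage, Finset.card_image_of_injOn hs.injOn]
  refine le_of_pow_le_pow_left₀ (n := 6) (by norm_num) (by positivity) ?_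
  rw [← Real.rpow_mul_natCast (Nat.cast_nonneg N)]
  norm_num
  exact_mod_cast h6
end
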